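/- Let d ≥ 3, 0 < λ < d − 2, σ > 0, κ ∈ {1, −1}, T > 0, η ∈ (0,1], and set p* = d/(d−λ). There exists a constant C* > 0 depending only on d, λ, σ, and for every M > 0 a constant C > 0 depending only on d, λ, σ, T, M and the mollifier χ, such that the following holds. Let u₀ be a probability density on ℝ^d with ‖u₀‖_{L^{p*}(ℝ^d)} < C* and ‖u₀‖_{L¹(ℝ^d)} + ‖u₀‖_{L^∞(ℝ^d)} ≤ M. If w is a classical Schwartz-class solution of the intermediate equation ∂_t w = σΔw − κ div(w ∇V^η * w) on [0,T] with w(0) = u₀, and u is a classical Schwartz-class solution of the limit equation ∂_t u = σΔu − κ div(u ∇Φ * u) on [0,T] with u(0) = u₀, then sup_{0 ≤ t ≤ T} ( ‖w(t) − u(t)‖_{L¹(ℝ^d)} + ‖w(t) − u(t)‖_{L^∞(ℝ^d)} ) ≤ C η. -/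

import Mathlib

open MeasureTheory Set

noncomputable section

/-- Laplacian of a scalar function on `ℝ^d`. -/
def lapl {d : ℕ} (f : EuclideanSpace ℝ (Fin d) → ℝ) (x : EuclideanSpace ℝ (Fin d)) : ℝ :=
  ∑ i : Fin d, fderiv ℝ (fun y => fderiv ℝ f y (EuclideanSpace.single i 1)) x
    (EuclideanSpace.single i 1)

/-- Divergence of a vector field on `ℝ^d`. -/
def diverg {d : ℕ} (F : EuclideanSpace ℝ (Fin d) → EuclideanSpace ℝ (Fin d))
    (x : EuclideanSpace ℝ (Fin d)) : ℝ :=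
  ∑ i : Fin d, fderiv ℝ (fun y => F y i) x (EuclideanSpace.single i 1)

/-- The mollified Riesz potential `V^η = χ^η * Φ` with `χ^η(x) = η^{-d} χ(x/η)` and
`Φ(x) = |x|^{-λ}`. -/
def Veta {d : ℕ} (lam : ℝ) (χ : EuclideanSpace ℝ (Fin d) → ℝ) (η : ℝ)
    (z : EuclideanSpace ℝ (Fin d)) : ℝ :=
  ∫ y, (η ^ (-(d : ℝ)) * χ (η⁻¹ • (z - y))) * ‖y‖ ^ (-lam)

/-- A classical Schwartz-class solution of `∂_t w = σΔw − κ div(w (K * w))` on `[0,T]`,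
where `(K * w)(x) = ∫ K(x−y) w(y) dy` for a vector-valued interaction kernel `K`
(in the application, `K = ∇V^η` or `K = ∇Φ`): `(t,x) ↦ w(t,x)` is smooth,
`w(t,·)` is a Schwartz function for every `t ∈ [0,T]`, `w ≥ 0`, `∫ w(t,x) dx = 1`,
and the equation holds pointwise. -/
def IsAggregationSolution {d : ℕ} (σ κ T : ℝ)
    (K : EuclideanSpace ℝ (Fin d) → EuclideanSpace ℝ (Fin d))
    (w : ℝ → EuclideanSpace ℝ (Fin d) → ℝ) : Prop :=
  ContDiffOn ℝ (⊤ : ℕ∞) (fun p : ℝ × EuclideanSpace ℝ (Fin d) => w p.1 p.2) (Icc 0 T ×ˢ univ) ∧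
  (∀ t ∈ Icc (0:ℝ) T, ∃ S : SchwartzMap (EuclideanSpace ℝ (Fin d)) ℝ, ∀ x, w t x = S x) ∧
  (∀ t ∈ Icc (0:ℝ) T, ∀ x, 0 ≤ w t x) ∧
  (∀ t ∈ Icc (0:ℝ) T, (∫ x, w t x) = 1) ∧
  (∀ t ∈ Icc (0:ℝ) T, ∀ x, HasDerivWithinAt (fun s => w s x)
    (σ * lapl (w t) x - κ * diverg (fun z => w t z • ∫ y, w t y • K (z - y)) x)
    (Icc 0 T) t)



abbrev EE (d : ℕ) := EuclideanSpace ℝ (Fin d)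

open Filter Topology

open MeasureTheory Set

def gk (d : ℕ) (s : ℝ) (x : EE d) : ℝ :=
  (4 * Real.pi * s) ^ (-(d : ℝ) / 2) * Real.exp (-‖x‖ ^ 2 / (4 * s))

lemma gk_pos {d : ℕ} {s : ℝ} (hs : 0 < s) (x : EE d) : 0 < gk d s x := by
  unfold gk; positivity

lemma gk_le {d : ℕ} {s : ℝ} (hs : 0 < s) (x : EE d) :
    gk d s x ≤ (4 * Real.pi * s) ^ (-(d : ℝ) / 2) := by
  unfold gk
  have : Real.exp (-‖x‖ ^ 2 / (4 * s)) ≤ 1 := by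
    rw [Real.exp_le_one_iff]
    apply div_nonpos_of_nonpos_of_nonneg <;> [(have := sq_nonneg ‖x‖; linarith); positivity]
  have h2 : 0 ≤ (4 * Real.pi * s) ^ (-(d : ℝ) / 2) := by positivity
  nlinarith

lemma gk_neg {d : ℕ} (s : ℝ) (x : EE d) : gk d s (-x) = gk d s x := by
  simp [gk]

lemma gk_sub_comm {d : ℕ} (s : ℝ) (x y : EE d) : gk d s (x - y) = gk d s (y - x) := by
  rw [← gk_neg, neg_sub]

lemma gk_contDiff {d : ℕ} (s : ℝ) : ContDiff ℝ (⊤ : ℕ∞) (gk d s) := by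
  unfold gk
  refine contDiff_const.mul ?_
  refine Real.contDiff_exp.comp ?_
  exact ((contDiff_norm_sq ℝ).neg).div_const _

lemma gk_continuous {d : ℕ} (s : ℝ) : Continuous (gk d s) := (gk_contDiff s).continuous

lemma gk_integral_aux {d : ℕ} {s : ℝ} (hs : 0 < s) : ∫ x, gk d s x = 1 := by
  unfold gk
  rw [integral_const_mul]
  have h := GaussianFourier.integral_rexp_neg_mul_sq_norm (V := EE d) (b := 1 / (4 * s)) (by positivity)
  have e : (fun v : EE d => Real.exp (-(1 / (4 * s)) * ‖v‖ ^ 2)) = fun x => Real.exp (-‖x‖ ^ 2 / (4 * s)) := by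
    funext v; congr 1; field_simp
  rw [e] at h
  rw [h]
  have : Real.pi / (1 / (4 * s)) = 4 * Real.pi * s := by field_simp
  rw [this, ← Real.rpow_add (by positivity)]
  simp
  ring_nf; simp

lemma gk_integrable {d : ℕ} {s : ℝ} (hs : 0 < s) : Integrable (gk d s) := by
  by_contra h
  have := gk_integral_aux (d := d) hs
  rw [integral_undef h] at this
  norm_num at this

lemma gk_hasFDerivAt {d : ℕ} (s : ℝ) (x : EE d) :
    HasFDerivAt (gk d s) ((-(gk d s x) / (2 * s)) • (innerSL ℝ x)) x := by
  unfold gk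
  have h1 : HasFDerivAt (fun x : EE d => ‖x‖ ^ 2) ((2:ℝ) • (innerSL ℝ x)) x := by
    simpa [two_smul] using (hasStrictFDerivAt_norm_sq x).hasFDerivAt
  have h2 : HasFDerivAt (fun x : EE d => -‖x‖ ^ 2 / (4 * s)) ((4 * s)⁻¹ • (-((2:ℝ) • (innerSL ℝ x)))) x := by
    simpa [div_eq_inv_mul] using (h1.neg).const_mul ((4 * s)⁻¹)
  have h3 := (h2.exp).const_mul ((4 * Real.pi * s) ^ (-(d : ℝ) / 2))
  refine h3.congr_fderiv ?_
  ext v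
  simp
  by_cases hs : s = 0
  · simp [hs]
  · field_simp; ring

lemma gk_fderiv {d : ℕ} (s : ℝ) (x v : EE d) :
    fderiv ℝ (gk d s) x v = -(gk d s x) / (2 * s) * inner ℝ x v := by
  rw [(gk_hasFDerivAt s x).fderiv]; simp

lemma gk_lapl {d : ℕ} {s : ℝ} (hs : 0 < s) (x : EE d) :
    lapl (gk d s) x = gk d s x * (‖x‖ ^ 2 / (4 * s ^ 2) - d / (2 * s)) := by
  unfold lapl
  have key : ∀ i : Fin d, fderiv ℝ (fun y => fderiv ℝ (gk d s) y (EuclideanSpace.single i 1)) x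
      (EuclideanSpace.single i 1) = gk d s x * ((x i) ^ 2 / (4 * s ^ 2) - 1 / (2 * s)) := by
    intro i
    have e : (fun y => fderiv ℝ (gk d s) y (EuclideanSpace.single i 1)) =
        fun y => gk d s y * ((-1 / (2 * s)) * inner ℝ (EuclideanSpace.single i (1:ℝ)) y) := by
      funext y
      rw [gk_fderiv, real_inner_comm]; field_simp
    rw [e]
    have h1 : HasFDerivAt (fun y : EE d => (-1 / (2 * s)) * inner ℝ (EuclideanSpace.single i (1:ℝ)) y)
        ((-1 / (2 * s)) • innerSL ℝ (EuclideanSpace.single i (1:ℝ))) x :=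
      ((innerSL ℝ (EuclideanSpace.single i (1:ℝ) : EE d)).hasFDerivAt).const_mul _
    rw [((gk_hasFDerivAt s x).fun_mul h1).fderiv]
    simp [EuclideanSpace.inner_single_left, EuclideanSpace.inner_single_right]
    field_simp; ring
  rw [Finset.sum_congr rfl (fun i _ => key i), ← Finset.mul_sum, Finset.sum_sub_distrib, ← Finset.sum_div,
    ← EuclideanSpace.real_norm_sq_eq]
  simp; left; field_simp

lemma gk_hasDerivAt {d : ℕ} {s : ℝ} (hs : 0 < s) (x : EE d) :
    HasDerivAt (fun s => gk d s x) (lapl (gk d s) x) s := by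
  rw [gk_lapl hs]
  unfold gk
  have hb : 0 < 4 * Real.pi * s := by positivity
  have h1 : HasDerivAt (fun s : ℝ => 4 * Real.pi * s) (4 * Real.pi) s := by
    simpa using (hasDerivAt_id s).const_mul (4 * Real.pi)
  have h2 := h1.rpow_const (p := -(d:ℝ)/2) (Or.inl hb.ne')
  have h3 : HasDerivAt (fun s : ℝ => -‖x‖ ^ 2 / (4 * s)) (‖x‖ ^ 2 / (4 * s ^ 2)) s := by
    have h4 : HasDerivAt (fun s : ℝ => 4 * s) 4 s := by simpa using (hasDerivAt_id s).const_mul 4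
    have := (hasDerivAt_const s (-‖x‖^2)).fun_div h4 (by positivity)
    refine this.congr_deriv ?_
    field_simp; ring
  refine (h2.fun_mul h3.exp).congr_deriv ?_
  rw [Real.rpow_sub_one hb.ne']
  field_simp
  ring

lemma gk_joint_continuousOn {d : ℕ} :
    ContinuousOn (fun p : ℝ × EE d => gk d p.1 p.2) (Ioi 0 ×ˢ univ) := by
  unfold gk
  intro p hp
  have hp0 : 0 < p.1 := hp.1
  apply ContinuousAt.continuousWithinAt
  have hpi := Real.pi_pos
  apply ContinuousAt.mul
  · apply ContinuousAt.rpow_const (by fun_prop)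
    left; positivity
  · apply Real.continuous_exp.continuousAt.comp
    apply ContinuousAt.div (by fun_prop) (by fun_prop)
    positivity

lemma gk_fderiv_le {d : ℕ} {s : ℝ} (hs : 0 < s) (x : EE d) :
    ‖fderiv ℝ (gk d s) x‖ ≤ (2:ℝ) ^ ((d : ℝ) / 2) * s ^ (-(1:ℝ)/2) * gk d (2 * s) x := by
  rw [(gk_hasFDerivAt s x).fderiv, norm_smul, innerSL_apply_norm]
  have hq : s ^ (-(1:ℝ)/2) = (√s)⁻¹ := by
    rw [neg_div, Real.rpow_neg hs.le, Real.sqrt_eq_rpow]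
  rw [hq, norm_div, norm_neg, Real.norm_of_nonneg (gk_pos hs x).le, Real.norm_of_nonneg (by positivity : 0 ≤ 2 * s)]
  have h1 : (2:ℝ) ^ ((d : ℝ) / 2) * (4 * Real.pi * (2 * s)) ^ (-(d : ℝ) / 2) = (4 * Real.pi * s) ^ (-(d : ℝ) / 2) := by
    rw [neg_div, Real.rpow_neg (by positivity), Real.rpow_neg (by positivity),
      ← Real.inv_rpow (by positivity), ← Real.inv_rpow (by positivity), ← Real.mul_rpow (by positivity) (by positivity)]
    congr 1; field_simp
  unfold gk
  have hr := Real.sqrt_pos.2 hs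
  set r := √s with hrdef
  have hs2 : s = r ^ 2 := (Real.sq_sqrt hs.le).symm
  have h2 : Real.exp (-‖x‖ ^ 2 / (4 * s)) = Real.exp (-‖x‖ ^ 2 / (4 * (2 * s))) * Real.exp (-‖x‖ ^ 2 / (4 * (2 * s))) := by
    rw [← Real.exp_add]; congr 1; field_simp; norm_num
  set y := ‖x‖ / r with hy
  have hy0 : 0 ≤ y := by positivity
  have h3 : -‖x‖ ^ 2 / (4 * (2 * s)) = -(y ^ 2 / 8) := by
    rw [hy, hs2]; field_simp; ring
  have h4 : y / 2 * Real.exp (-(y^2/8)) ≤ 1 := by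
    rw [Real.exp_neg, ← div_eq_mul_inv, div_le_one (Real.exp_pos _)]
    have := Real.add_one_le_exp (y^2/8)
    nlinarith [sq_nonneg (y - 2)]
  rw [h2]
  calc _ = (4 * Real.pi * s) ^ (-(d : ℝ) / 2) * r⁻¹ * Real.exp (-‖x‖ ^ 2 / (4 * (2 * s))) * (y / 2 * Real.exp (-‖x‖ ^ 2 / (4 * (2 * s)))) := by
        rw [hy, hs2]; field_simp
    _ ≤ (4 * Real.pi * s) ^ (-(d : ℝ) / 2) * r⁻¹ * Real.exp (-‖x‖ ^ 2 / (4 * (2 * s))) * 1 := by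
        rw [← h3] at h4
        gcongr
    _ = _ := by rw [← h1]; ring

def GG (d : ℕ) (r : ℝ) (f : EE d → ENNReal) (x : EE d) : ENNReal :=
  ∫⁻ y, ENNReal.ofReal (gk d r (x - y)) * f y

def RI (d : ℕ) (β : ℝ) (f : EE d → ENNReal) (x : EE d) : ENNReal :=
  ∫⁻ y, ENNReal.ofReal (‖x - y‖ ^ (-β)) * f y

lemma gk_measurable (d : ℕ) : Measurable (fun p : ℝ × EE d => gk d p.1 p.2) := by
  unfold gk; fun_prop

lemma lintegral_gk {d : ℕ} {r : ℝ} (hr : 0 < r) (x : EE d) :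
    ∫⁻ y, ENNReal.ofReal (gk d r (x - y)) = 1 := by
  rw [lintegral_sub_left_eq_self (fun y => ENNReal.ofReal (gk d r y)) x,
    ← ofReal_integral_eq_lintegral_ofReal (gk_integrable hr) (ae_of_all _ fun y => (gk_pos hr y).le),
    gk_integral_aux hr]
  simp

lemma GG_le_sup {d : ℕ} {r : ℝ} (hr : 0 < r) {f : EE d → ENNReal} {L : ENNReal} (hf : ∀ y, f y ≤ L) (x : EE d) :
    GG d r f x ≤ L := by
  calc GG d r f x ≤ ∫⁻ y, ENNReal.ofReal (gk d r (x - y)) * L := by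
        unfold GG; gcongr with y; exact hf y
    _ = L := by
        rw [lintegral_mul_const _ (by have := (gk_continuous (d := d) r); fun_prop), lintegral_gk hr, one_mul]

lemma GG_le_mass {d : ℕ} {r : ℝ} (hr : 0 < r) {f : EE d → ENNReal} (hf : Measurable f) (x : EE d) :
    GG d r f x ≤ ENNReal.ofReal ((4 * Real.pi * r) ^ (-(d : ℝ) / 2)) * ∫⁻ y, f y := by
  calc GG d r f x ≤ ∫⁻ y, ENNReal.ofReal ((4 * Real.pi * r) ^ (-(d : ℝ) / 2)) * f y := by
        unfold GG; gcongr with y; exact gk_le hr _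
    _ = _ := by rw [lintegral_const_mul _ hf]

lemma riesz_pt (d : ℕ) (β : ℝ) (hβ : 0 < β) : ∃ C : ℝ, 0 < C ∧ ∀ x : EE d,
    ENNReal.ofReal (‖x‖ ^ (-β)) ≤ ENNReal.ofReal C *
      ∫⁻ r in Ioi (0:ℝ), ENNReal.ofReal (r ^ (((d:ℝ) - β) / 2 - 1) * gk d r x) := by
  set c : ℝ := (4 * Real.pi) ^ (-(d:ℝ)/2) * Real.exp (-1/4) * 2 ^ (-β/2-1) with hc
  have hc0 : 0 < c := by positivity
  refine ⟨c⁻¹, by positivity, fun x => ?_⟩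
  rcases eq_or_ne x 0 with rfl | hx
  · rw [norm_zero, Real.zero_rpow (by linarith)]; simp
  have hR : 0 < ‖x‖ := norm_pos_iff.2 hx
  set R := ‖x‖ with hRdef
  have h1 : ∫⁻ r in Ioi (0:ℝ), ENNReal.ofReal (r ^ (((d:ℝ) - β) / 2 - 1) * gk d r x) ≥
      ∫⁻ r in Ioc (R^2) (2*R^2), ENNReal.ofReal (c * (R^2) ^ (-β/2-1)) := by
    refine (setLIntegral_mono' measurableSet_Ioc ?_).trans (lintegral_mono_set (s := Ioc (R^2) (2*R^2)) (t := Ioi 0) ?_)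
    · intro r hr
      apply ENNReal.ofReal_le_ofReal
      have hr0 : 0 < r := lt_trans (by positivity) hr.1
      unfold gk
      have e1 : r ^ (((d:ℝ) - β) / 2 - 1) * (4 * Real.pi * r) ^ (-(d:ℝ)/2) = (4 * Real.pi) ^ (-(d:ℝ)/2) * r ^ (-β/2-1) := by
        rw [Real.mul_rpow (by positivity) hr0.le, mul_left_comm, ← Real.rpow_add hr0]
        congr 2; ring
      rw [← mul_assoc, e1]
      have e2 : (2 * R^2) ^ (-β/2-1) ≤ r ^ (-β/2-1) :=
        Real.rpow_le_rpow_of_nonpos hr0 hr.2 (by linarith)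
      have e3 : Real.exp (-1/4) ≤ Real.exp (-‖x‖^2/(4*r)) := by
        apply Real.exp_le_exp.2
        rw [neg_div, neg_div, neg_le_neg_iff, div_le_div_iff₀ (by positivity) (by norm_num)]
        have := hr.1; rw [← hRdef]; linarith
      rw [Real.mul_rpow (by norm_num) (by positivity)] at e2
      calc _ = (4 * Real.pi) ^ (-(d:ℝ)/2) * (2 ^ (-β/2-1) * (R^2) ^ (-β/2-1)) * Real.exp (-1/4) := by rw [hc]; ring
        _ ≤ _ := by gcongr
    · intro r hr; exact lt_trans (by positivity) hr.1
  rw [ENNReal.ofReal_eq_coe_nnreal (by positivity : 0 ≤ R ^ (-β))]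
  refine le_trans ?_ (mul_le_mul_right h1 _)
  rw [setLIntegral_const, Real.volume_Ioc, ← ENNReal.ofReal_mul (by positivity), ← ENNReal.ofReal_mul (by positivity),
    ← ENNReal.ofReal_eq_coe_nnreal]
  apply ENNReal.ofReal_le_ofReal
  apply le_of_eq
  have : R ^ (-β) = (R^2) ^ (-β/2-1) * R^2 := by
    rw [← Real.rpow_natCast R 2, ← Real.rpow_mul hR.le, ← Real.rpow_add hR]
    congr 1; push_cast; ring
  rw [this]; field_simp; ring

lemma RI_le_GG (d : ℕ) (β : ℝ) (hβ : 0 < β) : ∃ C : ℝ, 0 < C ∧ ∀ (f : EE d → ENNReal), Measurable f → ∀ x : EE d,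
    RI d β f x ≤ ENNReal.ofReal C *
      ∫⁻ r in Ioi (0:ℝ), ENNReal.ofReal (r ^ (((d:ℝ) - β) / 2 - 1)) * GG d r f x := by
  obtain ⟨C, hC, h⟩ := riesz_pt d β hβ
  refine ⟨C, hC, fun f hf x => ?_⟩
  have hg := gk_measurable d
  have hm : Measurable (fun p : EE d × ℝ => ENNReal.ofReal (p.2 ^ (((d:ℝ) - β) / 2 - 1) * gk d p.2 (x - p.1)) * f p.1) := by
    have : Measurable (fun p : EE d × ℝ => gk d p.2 (x - p.1)) := hg.comp (g := fun p : ℝ × EE d => gk d p.1 p.2) (f := fun p : EE d × ℝ => (p.2, x - p.1)) (by fun_prop)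
    fun_prop
  calc RI d β f x ≤ ∫⁻ y, (ENNReal.ofReal C *
      ∫⁻ r in Ioi (0:ℝ), ENNReal.ofReal (r ^ (((d:ℝ) - β) / 2 - 1) * gk d r (x - y))) * f y := by
        unfold RI; gcongr with y; exact h _
    _ = ENNReal.ofReal C * ∫⁻ y, ∫⁻ r in Ioi (0:ℝ), ENNReal.ofReal (r ^ (((d:ℝ) - β) / 2 - 1) * gk d r (x - y)) * f y := by
        rw [← lintegral_const_mul _ (by exact hm.lintegral_prod_right')]
        congr 1; funext y
        rw [mul_assoc, lintegral_mul_const]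
        have : Measurable (fun r : ℝ => gk d r (x - y)) := hg.comp (g := fun p : ℝ × EE d => gk d p.1 p.2) (f := fun r => (r, x - y)) (by fun_prop)
        fun_prop
    _ = ENNReal.ofReal C * ∫⁻ r in Ioi (0:ℝ), ∫⁻ y, ENNReal.ofReal (r ^ (((d:ℝ) - β) / 2 - 1) * gk d r (x - y)) * f y := by
        rw [lintegral_lintegral_swap hm.aemeasurable]
    _ = _ := by
        congr 1
        apply setLIntegral_congr_fun measurableSet_Ioi
        intro r hr
        simp only [GG]
        rw [← lintegral_const_mul]
        · congr 1; funext y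
          rw [ENNReal.ofReal_mul (by have : 0 < r := hr; positivity), mul_assoc]
        · have := gk_continuous (d := d) r
          fun_prop

lemma lint_rpow_Ioc {p A : ℝ} (hp : -1 < p) (hA : 0 < A) :
    ∫⁻ r in Ioc 0 A, ENNReal.ofReal (r ^ p) = ENNReal.ofReal (A ^ (p+1) / (p+1)) := by
  rw [← ofReal_integral_eq_lintegral_ofReal]
  · rw [← intervalIntegral.integral_of_le hA.le, integral_rpow (Or.inl hp), Real.zero_rpow (by linarith), sub_zero]
  · exact (intervalIntegrable_iff_integrableOn_Ioc_of_le hA.le).1 (intervalIntegral.intervalIntegrable_rpow' hp)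
  · filter_upwards [ae_restrict_mem measurableSet_Ioc] with r hr
    have := hr.1
    simp; positivity

lemma lint_rpow_Ioi {p A : ℝ} (hp : p < -1) (hA : 0 < A) :
    ∫⁻ r in Ioi A, ENNReal.ofReal (r ^ p) = ENNReal.ofReal (A ^ (p+1) / (-(p+1))) := by
  rw [← ofReal_integral_eq_lintegral_ofReal]
  · rw [integral_Ioi_rpow_of_lt hp hA]; congr 1; rw [div_neg, neg_div]
  · exact integrableOn_Ioi_rpow_of_lt hp hA
  · filter_upwards [ae_restrict_mem measurableSet_Ioi] with r hr
    have : 0 < r := hA.trans hr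
    simp; positivity

lemma lint_split {A : ℝ} (hA : 0 < A) (f : ℝ → ENNReal) :
    ∫⁻ r in Ioi 0, f r = (∫⁻ r in Ioc 0 A, f r) + ∫⁻ r in Ioi A, f r := by
  rw [← lintegral_union measurableSet_Ioi, Ioc_union_Ioi_eq_Ioi hA.le]
  exact Ioc_disjoint_Ioi le_rfl

lemma riesz_1inf (d : ℕ) (β : ℝ) (hβ : 0 < β) (hβd : β < d) : ∃ C : ℝ, 0 < C ∧
    ∀ (f : EE d → ENNReal) (L mm : ENNReal), Measurable f → (∀ y, f y ≤ L) → ∫⁻ y, f y ≤ mm →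
    ∀ x, RI d β f x ≤ ENNReal.ofReal C * (mm + L) := by
  obtain ⟨C, hC, h⟩ := RI_le_GG d β hβ
  set p := ((d:ℝ) - β) / 2 - 1 with hp
  set K1 : ℝ := 1 / (p+1)
  set K2 : ℝ := (4 * Real.pi) ^ (-(d:ℝ)/2) * (1 / (β/2))
  have hK1 : 0 < K1 := by have : 0 < p + 1 := by { rw [hp]; linarith }
                          positivity
  have hK2 : 0 < K2 := by positivity
  refine ⟨C * (K1 + K2), by positivity, fun f L mm hf hL hmm x => (h f hf x).trans ?_⟩
  rw [ENNReal.ofReal_mul hC.le, mul_assoc]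
  gcongr
  rw [lint_split one_pos]
  have h1 : ∫⁻ r in Ioc (0:ℝ) 1, ENNReal.ofReal (r ^ p) * GG d r f x ≤ ENNReal.ofReal K1 * L := by
    calc _ ≤ ∫⁻ r in Ioc (0:ℝ) 1, ENNReal.ofReal (r ^ p) * L := by
          apply setLIntegral_mono' measurableSet_Ioc
          intro r hr; gcongr; exact GG_le_sup hr.1 hL x
      _ = _ := by
          rw [lintegral_mul_const _ (by fun_prop), lint_rpow_Ioc (by rw [hp]; linarith) one_pos]
          simp [K1]
  have h2 : ∫⁻ r in Ioi (1:ℝ), ENNReal.ofReal (r ^ p) * GG d r f x ≤ ENNReal.ofReal K2 * mm := by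
    calc _ ≤ ∫⁻ r in Ioi (1:ℝ), ENNReal.ofReal (r ^ (-β/2-1)) * (ENNReal.ofReal ((4 * Real.pi) ^ (-(d:ℝ)/2)) * mm) := by
          apply setLIntegral_mono' measurableSet_Ioi
          intro r hr
          have hr0 : 0 < r := one_pos.trans hr
          calc _ ≤ ENNReal.ofReal (r ^ p) * (ENNReal.ofReal ((4 * Real.pi * r) ^ (-(d : ℝ) / 2)) * mm) := by
                gcongr
                exact (GG_le_mass hr0 hf x).trans (by gcongr)
            _ = _ := by
                rw [← mul_assoc, ← mul_assoc, ← ENNReal.ofReal_mul (by positivity), ← ENNReal.ofReal_mul (by positivity)]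
                congr 2
                rw [Real.mul_rpow (by positivity) hr0.le, mul_left_comm, ← Real.rpow_add hr0, mul_comm]
                congr 2; rw [hp]; ring
      _ = _ := by
          rw [lintegral_mul_const _ (by fun_prop), lint_rpow_Ioi (by linarith) one_pos, ← mul_assoc,
            ← ENNReal.ofReal_mul (by apply div_nonneg <;> [simp; linarith])]
          congr 2
          simp only [K2, Real.one_rpow]
          rw [mul_comm]; congr 2; ring
  calc _ ≤ ENNReal.ofReal K1 * L + ENNReal.ofReal K2 * mm := add_le_add h1 h2
    _ ≤ ENNReal.ofReal (K1 + K2) * L + ENNReal.ofReal (K1+K2) * mm := by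
        gcongr <;> linarith
    _ = _ := by ring

lemma riesz_Q (d : ℕ) (lam : ℝ) (hl : 0 < lam) (hld : lam < d - 2) : ∃ C : ℝ, 0 < C ∧
    ∀ (f : EE d → ENNReal) (X S : ℝ), Measurable f → 0 ≤ X → 0 < S → ∀ x,
    (∀ r, 0 < r → GG d r f x ≤ ENNReal.ofReal (X * (r + S) ^ (-((d - lam)/2)))) →
    RI d (lam + 1) f x ≤ ENNReal.ofReal (C * X * S ^ (-(1:ℝ)/2)) := by
  obtain ⟨C, hC, h⟩ := RI_le_GG d (lam + 1) (by linarith)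
  set a := (d - lam)/2 with ha
  have ha1 : 1 < a := by rw [ha]; linarith
  have hp : ((d:ℝ) - (lam+1)) / 2 - 1 = a - 3/2 := by rw [ha]; ring
  rw [hp] at h
  have : 0 < a - 1/2 := by linarith
  refine ⟨C * (1/(a-1/2) + 2), by positivity, fun f X S hf hX hS x hG => (h f hf x).trans ?_⟩
  rw [mul_assoc, mul_assoc, ENNReal.ofReal_mul hC.le]
  gcongr
  rw [lint_split hS]
  have h1 : ∫⁻ r in Ioc (0:ℝ) S, ENNReal.ofReal (r ^ (a-3/2)) * GG d r f x ≤ ENNReal.ofReal (X * S^(-(1:ℝ)/2) * (1/(a-1/2))) := by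
    calc _ ≤ ∫⁻ r in Ioc (0:ℝ) S, ENNReal.ofReal (r ^ (a-3/2)) * ENNReal.ofReal (X * S^(-a)) := by
          apply setLIntegral_mono' measurableSet_Ioc
          intro r hr; gcongr; refine (hG r hr.1).trans (ENNReal.ofReal_le_ofReal ?_)
          refine mul_le_mul_of_nonneg_left ?_ hX
          exact Real.rpow_le_rpow_of_nonpos hS (by linarith [hr.1]) (by linarith)
      _ = _ := by
          rw [lintegral_mul_const _ (by fun_prop), lint_rpow_Ioc (by linarith) hS, ← ENNReal.ofReal_mul (by apply div_nonneg; positivity; linarith)]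
          congr 1
          have : S ^ (-(1:ℝ)/2) = S ^ (a - 3/2 + 1) * S ^ (-a) := by
            rw [← Real.rpow_add hS]; congr 1; ring
          rw [this, show a - 3/2 + 1 = a - 1/2 by ring]; field_simp
  have h2 : ∫⁻ r in Ioi S, ENNReal.ofReal (r ^ (a-3/2)) * GG d r f x ≤ ENNReal.ofReal (X * S^(-(1:ℝ)/2) * 2) := by
    calc _ ≤ ∫⁻ r in Ioi S, ENNReal.ofReal (r ^ (-(3:ℝ)/2)) * ENNReal.ofReal X := by
          apply setLIntegral_mono' measurableSet_Ioi
          intro r hr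
          have hr0 : 0 < r := hS.trans hr
          calc _ ≤ ENNReal.ofReal (r ^ (a-3/2)) * ENNReal.ofReal (X * r^(-a)) := by
                gcongr; refine (hG r hr0).trans (ENNReal.ofReal_le_ofReal ?_)
                refine mul_le_mul_of_nonneg_left ?_ hX
                exact Real.rpow_le_rpow_of_nonpos hr0 (by linarith) (by linarith)
            _ = _ := by
                rw [← ENNReal.ofReal_mul (by positivity), ← ENNReal.ofReal_mul (by positivity), mul_left_comm, ← Real.rpow_add hr0, mul_comm]
                congr 3; ring
      _ = _ := by
          rw [lintegral_mul_const _ (by fun_prop), lint_rpow_Ioi (by norm_num) hS,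
            ← ENNReal.ofReal_mul (by apply div_nonneg; positivity; norm_num)]
          congr 1
          rw [show -(3:ℝ)/2 + 1 = -1/2 by norm_num]; ring
  refine (add_le_add h1 h2).trans ?_
  rw [← ENNReal.ofReal_add (by positivity) (by positivity)]
  apply ENNReal.ofReal_le_ofReal; apply le_of_eq; ring

def gc (d : ℕ) (r : ℝ) (f : EE d → ℝ) (x : EE d) : ℝ := ∫ y, gk d r (x - y) * f y

lemma gk_sub_continuous {d : ℕ} (r : ℝ) (x : EE d) : Continuous (fun y => gk d r (x - y)) :=
  (gk_continuous r).comp (by fun_prop)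

lemma gc_integrable {d : ℕ} {r : ℝ} (hr : 0 < r) {f : EE d → ℝ} (hf : Integrable f) (x : EE d) :
    Integrable (fun y => gk d r (x - y) * f y) := by
  refine hf.bdd_mul (c := (4 * Real.pi * r) ^ (-(d : ℝ) / 2)) (gk_sub_continuous r x).aestronglyMeasurable ?_
  exact ae_of_all _ fun y => by rw [Real.norm_of_nonneg (gk_pos hr _).le]; exact gk_le hr _

lemma ofReal_gc {d : ℕ} {r : ℝ} (hr : 0 < r) {f : EE d → ℝ} (hf : Integrable f) (hf0 : ∀ y, 0 ≤ f y) (x : EE d) :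
    ENNReal.ofReal (gc d r f x) = GG d r (fun y => ENNReal.ofReal (f y)) x := by
  unfold gc GG
  rw [ofReal_integral_eq_lintegral_ofReal (gc_integrable hr hf x)
    (ae_of_all _ fun y => mul_nonneg (gk_pos hr _).le (hf0 y))]
  congr 1; funext y
  rw [ENNReal.ofReal_mul (gk_pos hr _).le]

lemma gc_nonneg {d : ℕ} {r : ℝ} (hr : 0 < r) {f : EE d → ℝ} (hf0 : ∀ y, 0 ≤ f y) (x : EE d) : 0 ≤ gc d r f x :=
  integral_nonneg fun y => mul_nonneg (gk_pos hr _).le (hf0 y)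

lemma gc_le_sup {d : ℕ} {r : ℝ} (hr : 0 < r) {f : EE d → ℝ} (hf : Integrable f) {L : ℝ} (hL : ∀ y, f y ≤ L) (x : EE d) :
    gc d r f x ≤ L := by
  unfold gc
  have h1 : Integrable (fun y => gk d r (x - y)) := (gk_integrable hr).comp_sub_left x
  calc _ ≤ ∫ y, gk d r (x - y) * L := by
        apply integral_mono (gc_integrable hr hf x) (h1.mul_const L)
        intro y; exact mul_le_mul_of_nonneg_left (hL y) (gk_pos hr _).le
    _ = L := by
        rw [integral_mul_const, integral_sub_left_eq_self (fun y => gk d r y) volume x, gk_integral_aux hr, one_mul]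

lemma gc_le_mass {d : ℕ} {r : ℝ} (hr : 0 < r) {f : EE d → ℝ} (hf : Integrable f) (hf0 : ∀ y, 0 ≤ f y) (x : EE d) :
    gc d r f x ≤ (4 * Real.pi * r) ^ (-(d : ℝ) / 2) * ∫ y, f y := by
  unfold gc
  rw [← integral_const_mul]
  apply integral_mono (gc_integrable hr hf x) (hf.const_mul _)
  intro y; exact mul_le_mul_of_nonneg_right (gk_le hr _) (hf0 y)

lemma gc_scale {d : ℕ} {r : ℝ} (hr : 0 < r) (f : EE d → ℝ) (x : EE d) :
    gc d (r^2) f x = ∫ z, gk d 1 z * f (x - r • z) := by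
  unfold gc
  have h1 := integral_sub_left_eq_self (fun y => gk d (r^2) y * f (x - y)) volume x
  simp only [sub_sub_cancel] at h1
  rw [h1]
  have h2 := Measure.integral_comp_smul (volume : Measure (EE d)) (fun y => gk d (r^2) y * f (x - y)) r
  have h3 : ∀ z : EE d, gk d (r^2) (r • z) = (r ^ d)⁻¹ * gk d 1 z := by
    intro z
    unfold gk
    rw [norm_smul, Real.norm_of_nonneg hr.le, Real.mul_rpow (by positivity) (by positivity)]
    have : (r^2) ^ (-(d:ℝ)/2) = (r^d)⁻¹ := by
      rw [← Real.rpow_natCast r 2, ← Real.rpow_mul hr.le, ← Real.rpow_natCast, ← Real.rpow_neg hr.le]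
      congr 1; push_cast; ring
    rw [this, show -(r * ‖z‖) ^ 2 / (4 * r^2) = -‖z‖^2 / (4*1) by field_simp]
    rw [mul_one]; ring
  simp only [h3] at h2
  rw [finrank_euclideanSpace_fin, abs_of_pos (by positivity), smul_eq_mul] at h2
  simp only [mul_assoc] at h2
  rw [integral_const_mul] at h2
  have : (r ^ d)⁻¹ ≠ 0 := by positivity
  exact (mul_left_cancel₀ this h2).symm

lemma gc_tendsto {d : ℕ} {f : EE d → ℝ} (hf : Continuous f) {L : ℝ} (hL : ∀ y, |f y| ≤ L) (x : EE d) :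
    Tendsto (fun n : ℕ => gc d ((1 / ((n:ℝ) + 1))^2) f x) atTop (𝓝 (f x)) := by
  have e : ∀ n : ℕ, gc d ((1 / ((n:ℝ) + 1))^2) f x = ∫ z, gk d 1 z * f (x - (1 / ((n:ℝ) + 1)) • z) :=
    fun n => gc_scale (by positivity) f x
  simp only [e]
  have e2 : f x = ∫ z, gk d 1 z * f (x - (0:ℝ) • z) := by
    simp [integral_mul_const, gk_integral_aux]
  rw [e2]
  apply tendsto_integral_of_dominated_convergence (fun z => gk d 1 z * L)
  · intro n
    have := gk_continuous (d := d) 1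
    apply Continuous.aestronglyMeasurable; fun_prop
  · exact (gk_integrable one_pos).mul_const L
  · intro n; refine ae_of_all _ fun z => ?_
    rw [norm_mul, Real.norm_of_nonneg (gk_pos one_pos _).le]
    exact mul_le_mul_of_nonneg_left (hL _) (gk_pos one_pos _).le
  · refine ae_of_all _ fun z => ?_
    apply Tendsto.const_mul
    apply (hf.tendsto _).comp
    apply Tendsto.const_sub
    apply Tendsto.smul_const
    exact tendsto_one_div_add_atTop_nhds_zero_nat

lemma gc_holder {d : ℕ} {lam : ℝ} (hl : 0 < lam) (hld : lam < d) {ε : ℝ} {f : EE d → ℝ}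
    (hf : Integrable f) (hf0 : ∀ y, 0 ≤ f y)
    (hε : eLpNorm f (ENNReal.ofReal ((d : ℝ) / ((d : ℝ) - lam))) volume ≤ ENNReal.ofReal ε) (hε0 : 0 ≤ ε)
    {r : ℝ} (hr : 0 < r) (x : EE d) :
    gc d r f x ≤ (4 * Real.pi * r) ^ (-((d - lam)/2)) * ε := by
  rw [← ENNReal.ofReal_le_ofReal_iff (by positivity), ofReal_gc hr hf hf0]
  set p := (d : ℝ) / ((d : ℝ) - lam) with hp
  set q := (d : ℝ) / lam with hq
  have hd0 : 0 < (d:ℝ) := hl.trans hld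
  have hdl : 0 < (d:ℝ) - lam := by linarith
  have hp0 : 0 < p := by positivity
  have hq0 : 0 < q := by positivity
  have hq1 : 1 < q := by rw [hq, lt_div_iff₀ hl]; linarith
  have hpq : q.HolderConjugate p := by
    rw [Real.holderConjugate_iff]
    refine ⟨hq1, ?_⟩
    rw [hp, hq, inv_div, inv_div]; field_simp; simp
  set A := (4 * Real.pi * r) ^ (-(d : ℝ) / 2) with hA
  have hA0 : 0 < A := by positivity
  have h1 : (∫⁻ y, ENNReal.ofReal (gk d r (x - y)) ^ q) ≤ ENNReal.ofReal (A ^ (q - 1)) := by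
    calc _ ≤ ∫⁻ y, ENNReal.ofReal (A ^ (q-1)) * ENNReal.ofReal (gk d r (x - y)) := by
          apply lintegral_mono
          intro y
          have g0 := gk_pos hr (x - y)
          simp only
          rw [ENNReal.ofReal_rpow_of_pos g0, ← ENNReal.ofReal_mul (by positivity)]
          apply ENNReal.ofReal_le_ofReal
          have : gk d r (x-y) ^ q = gk d r (x-y) ^ (q-1) * gk d r (x-y) := by
            rw [Real.rpow_sub_one g0.ne']; field_simp
          rw [this]
          gcongr
          exact gk_le hr _
      _ = _ := by
          have := gk_continuous (d := d) r
          rw [lintegral_const_mul _ (by fun_prop), lintegral_gk hr, mul_one]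
  have h2 : (∫⁻ y, (ENNReal.ofReal (f y)) ^ p) ^ (1/p) ≤ ENNReal.ofReal ε := by
    refine le_trans (le_of_eq ?_) hε
    rw [eLpNorm_eq_lintegral_rpow_enorm_toReal (by simpa using hp0) (by simp)]
    rw [ENNReal.toReal_ofReal hp0.le]
    congr 2; funext y
    rw [Real.enorm_eq_ofReal (hf0 y)]
  have h3 := ENNReal.lintegral_mul_le_Lp_mul_Lq (volume : Measure (EE d)) hpq
    (f := fun y => ENNReal.ofReal (gk d r (x - y))) (g := fun y => ENNReal.ofReal (f y))
    (by have := gk_continuous (d := d) r; fun_prop) (hf.aestronglyMeasurable.aemeasurable.ennreal_ofReal)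
  refine h3.trans ?_
  rw [ENNReal.ofReal_mul (by positivity)]
  refine mul_le_mul' ?_ h2
  refine (ENNReal.rpow_le_rpow h1 (by positivity)).trans ?_
  rw [ENNReal.ofReal_rpow_of_pos (by positivity)]
  apply ENNReal.ofReal_le_ofReal
  rw [hA, ← Real.rpow_mul (by positivity), ← Real.rpow_mul (by positivity)]
  apply le_of_eq; congr 1
  rw [hq]; field_simp

def Kk {d : ℕ} (lam : ℝ) (x : EE d) : EE d := (-lam * ‖x‖ ^ (-lam - 2)) • x

lemma Kk_measurable {d : ℕ} (lam : ℝ) : Measurable (Kk (d := d) lam) := by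
  unfold Kk; fun_prop

lemma Kk_norm {d : ℕ} {lam : ℝ} (hl : 0 < lam) (x : EE d) : ‖Kk lam x‖ = lam * ‖x‖ ^ (-(lam + 1)) := by
  unfold Kk
  rcases eq_or_ne x 0 with rfl | hx
  · rw [norm_zero, Real.zero_rpow (by linarith), Real.zero_rpow (by linarith)]; simp
  have : 0 < ‖x‖ := norm_pos_iff.2 hx
  rw [norm_smul, norm_mul, norm_neg, Real.norm_of_nonneg hl.le, Real.norm_of_nonneg (by positivity), mul_assoc]
  congr 1
  nth_rewrite 2 [← Real.rpow_one ‖x‖]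
  rw [← Real.rpow_add this]; congr 1; ring

lemma phi_hasGradientAt {d : ℕ} (lam : ℝ) {x : EE d} (hx : x ≠ 0) :
    HasGradientAt (fun x : EE d => ‖x‖ ^ (-lam)) (Kk lam x) x := by
  have hx0 : 0 < ‖x‖ := norm_pos_iff.2 hx
  rw [hasGradientAt_iff_hasFDerivAt]
  have e : (fun x : EE d => ‖x‖ ^ (-lam)) = fun x => (‖x‖ ^ 2) ^ (-lam/2) := by
    funext y
    rw [← Real.rpow_natCast ‖y‖ 2, ← Real.rpow_mul (norm_nonneg y)]; congr 1; push_cast; ring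
  rw [e]
  have h1 := (hasStrictFDerivAt_norm_sq x).hasFDerivAt.rpow_const (p := -lam/2) (Or.inl (by positivity))
  refine h1.congr_fderiv ?_
  ext v
  simp [Kk, inner_smul_left]
  rw [← Real.rpow_natCast ‖x‖ 2, ← Real.rpow_mul (norm_nonneg x)]
  push_cast
  rw [show 2 * (-lam/2 - 1) = -lam - 2 by ring]; ring

lemma rpow_tangent {m s t : ℝ} (hs : 0 < s) (ht : 0 < t) (hm : 0 ≤ m) :
    s ^ (-m) - m * s ^ (-m-1) * (t - s) ≤ t ^ (-m) := by
  have h1 : 1 - m * (t / s - 1) ≤ (t/s) ^ (-m) := by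
    rw [Real.rpow_def_of_pos (by positivity)]
    have h2 := Real.add_one_le_exp (Real.log (t/s) * -m)
    have h3 := Real.log_le_sub_one_of_pos (by positivity : 0 < t / s)
    nlinarith
  have h4 : t ^ (-m) = s ^ (-m) * (t/s) ^ (-m) := by
    rw [← Real.mul_rpow hs.le (by positivity)]; congr 1; field_simp
  rw [h4, Real.rpow_sub_one hs.ne']
  calc _ = s ^ (-m) * (1 - m * (t / s - 1)) := by field_simp
    _ ≤ _ := by gcongr

lemma Kk_diff_aux {d : ℕ} {lam : ℝ} (hl : 0 < lam) {a b : EE d} (hb : b ≠ 0) (hab : ‖b‖ ≤ ‖a‖) :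
    ‖Kk lam a - Kk lam b‖ ≤ lam * (lam + 3) * ‖a - b‖ * (‖a‖ ^ (-(lam+2)) + ‖b‖ ^ (-(lam+2))) := by
  have hb0 : 0 < ‖b‖ := norm_pos_iff.2 hb
  have ha0 : 0 < ‖a‖ := hb0.trans_le hab
  set s := ‖b‖; set t := ‖a‖
  have e : Kk lam a - Kk lam b = (-lam * t ^ (-(lam+2))) • (a - b) + (lam * (s ^ (-(lam+2)) - t ^ (-(lam+2)))) • b := by
    unfold Kk
    rw [show -lam - 2 = -(lam + 2) by ring]
    module
  have h1 := rpow_tangent hb0 ha0 (by linarith : 0 ≤ lam + 2)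
  have h2 : t - s ≤ ‖a - b‖ := norm_sub_norm_le a b
  have h3 : t ^ (-(lam+2)) ≤ s ^ (-(lam+2)) := Real.rpow_le_rpow_of_nonpos hb0 hab (by linarith)
  rw [Real.rpow_sub_one hb0.ne'] at h1
  have hA : 0 < t ^ (-(lam+2)) := by positivity
  have hB : 0 < s ^ (-(lam+2)) := by positivity
  have hn := norm_nonneg (a - b)
  rw [e]
  calc _ ≤ lam * t ^ (-(lam+2)) * ‖a - b‖ + lam * (s ^ (-(lam+2)) - t ^ (-(lam+2))) * s := by
        refine (norm_add_le _ _).trans ?_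
        rw [norm_smul, norm_smul, Real.norm_eq_abs, Real.norm_eq_abs, abs_mul, abs_neg, abs_of_pos hl, abs_of_pos hA, abs_of_nonneg (by nlinarith)]
    _ ≤ lam * t ^ (-(lam+2)) * ‖a - b‖ + lam * ((lam+2) * (s ^ (-(lam+2)) / s) * (t - s)) * s := by
        gcongr; linarith
    _ = lam * t ^ (-(lam+2)) * ‖a - b‖ + lam * ((lam+2) * (s ^ (-(lam+2))) * (t - s)) := by field_simp
    _ ≤ lam * t ^ (-(lam+2)) * ‖a - b‖ + lam * ((lam+2) * (s ^ (-(lam+2))) * ‖a - b‖) := by gcongr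
    _ ≤ _ := by
        have : 0 ≤ lam * ‖a-b‖ * t ^ (-(lam+2)) := by positivity
        have : 0 ≤ lam * ‖a-b‖ * s ^ (-(lam+2)) := by positivity
        nlinarith

lemma Kk_diff {d : ℕ} {lam : ℝ} (hl : 0 < lam) {a b : EE d} (ha : a ≠ 0) (hb : b ≠ 0) :
    ‖Kk lam a - Kk lam b‖ ≤ lam * (lam + 3) * ‖a - b‖ * (‖a‖ ^ (-(lam+2)) + ‖b‖ ^ (-(lam+2))) := by
  rcases le_total ‖b‖ ‖a‖ with h | h
  · exact Kk_diff_aux hl hb h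
  · have := Kk_diff_aux hl ha h
    rw [norm_sub_rev, norm_sub_rev b a, add_comm (‖b‖ ^ _)] at this
    exact this

lemma phi_lower {d : ℕ} {lam : ℝ} (hl : 0 < lam) {a h : EE d} (ha : a ≠ 0) (hah : a + h ≠ 0) :
    ‖a‖ ^ (-lam) + inner ℝ (Kk lam a) h - lam / 2 * ‖h‖^2 * ‖a‖ ^ (-(lam+2)) ≤ ‖a + h‖ ^ (-lam) := by
  have ha0 : 0 < ‖a‖ := norm_pos_iff.2 ha
  have hb0 : 0 < ‖a + h‖ := norm_pos_iff.2 hah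
  have h1 := rpow_tangent (s := ‖a‖^2) (t := ‖a+h‖^2) (by positivity) (by positivity) (by positivity : 0 ≤ lam / 2)
  have e : ∀ (p t : ℝ), 0 < t → (t^2) ^ p = t ^ (2 * p) := by
    intro p t ht
    rw [← Real.rpow_natCast t 2, ← Real.rpow_mul ht.le]; norm_num
  rw [e _ _ ha0, e _ _ ha0, e _ _ hb0, show 2 * -(lam/2) = -lam by ring, show 2 * (-(lam/2) - 1) = -(lam+2) by ring,
    norm_add_sq_real] at h1
  refine le_trans (le_of_eq ?_) h1
  simp only [Kk, inner_smul_left, conj_trivial]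
  rw [show -lam - 2 = -(lam+2) by ring]; ring

lemma phi_taylor {d : ℕ} {lam : ℝ} (hl : 0 < lam) {a h : EE d} (ha : a ≠ 0) (hah : a + h ≠ 0) :
    |‖a + h‖ ^ (-lam) - ‖a‖ ^ (-lam) - inner ℝ (Kk lam a) h| ≤
      lam * (lam + 4) * ‖h‖^2 * (‖a‖ ^ (-(lam+2)) + ‖a + h‖ ^ (-(lam+2))) := by
  have h1 := phi_lower hl ha hah
  have h2 := phi_lower hl (a := a + h) (h := -h) hah (by simpa using ha)
  rw [add_neg_cancel_right, norm_neg, inner_neg_right] at h2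
  have h3 := Kk_diff hl hah ha
  rw [add_sub_cancel_left] at h3
  have h4 : inner ℝ (Kk lam (a+h) - Kk lam a) h ≤ ‖Kk lam (a+h) - Kk lam a‖ * ‖h‖ := real_inner_le_norm _ _
  rw [inner_sub_left] at h4
  have ha0 : 0 < ‖a‖ := norm_pos_iff.2 ha
  have hb0 : 0 < ‖a + h‖ := norm_pos_iff.2 hah
  set A := ‖a‖ ^ (-(lam+2))
  set B := ‖a+h‖ ^ (-(lam+2))
  have hA : 0 < A := by positivity
  have hB : 0 < B := by positivity
  have h5 : ‖Kk lam (a+h) - Kk lam a‖ * ‖h‖ ≤ lam * (lam + 3) * ‖h‖ * (B + A) * ‖h‖ := by gcongr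
  have n1 : 0 ≤ lam * ‖h‖^2 * A := by positivity
  have n2 : 0 ≤ lam * ‖h‖^2 * B := by positivity
  have n3 : 0 ≤ lam * lam * ‖h‖^2 * A := by positivity
  have n4 : 0 ≤ lam * lam * ‖h‖^2 * B := by positivity
  rw [abs_le]
  constructor <;> nlinarith

lemma riesz_real (d : ℕ) (β : ℝ) (hβ : 0 < β) (hβd : β < d) : ∃ C : ℝ, 0 < C ∧
    ∀ (f : EE d → ℝ) (L : ℝ), Integrable f → Measurable f → (∀ y, |f y| ≤ L) →
    ∀ x, Integrable (fun y => ‖x - y‖ ^ (-β) * f y) ∧ ∫ y, ‖x - y‖ ^ (-β) * |f y| ≤ C * ((∫ y, |f y|) + L) := by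
  obtain ⟨C, hC, h⟩ := riesz_1inf d β hβ hβd
  refine ⟨C, hC, fun f L hf hm hL x => ?_⟩
  have hL0 : 0 ≤ L := (abs_nonneg _).trans (hL x)
  have hI0 : 0 ≤ ∫ y, |f y| := integral_nonneg fun y => abs_nonneg _
  have key : ∫⁻ y, ENNReal.ofReal (‖x - y‖ ^ (-β) * |f y|) ≤ ENNReal.ofReal (C * ((∫ y, |f y|) + L)) := by
    have h1 := h (fun y => ENNReal.ofReal |f y|) (ENNReal.ofReal L) (ENNReal.ofReal (∫ y, |f y|)) (by fun_prop)
      (fun y => ENNReal.ofReal_le_ofReal (hL y))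
      (by rw [ofReal_integral_eq_lintegral_ofReal hf.abs (ae_of_all _ fun y => abs_nonneg _)]) x
    rw [← ENNReal.ofReal_add hI0 hL0, ← ENNReal.ofReal_mul hC.le] at h1
    refine le_trans (le_of_eq ?_) h1
    unfold RI; congr 1; funext y
    rw [ENNReal.ofReal_mul (by positivity)]
  have hi : Integrable (fun y => ‖x - y‖ ^ (-β) * |f y|) := by
    refine ⟨by apply Measurable.aestronglyMeasurable; fun_prop, ?_⟩
    rw [hasFiniteIntegral_iff_ofReal (ae_of_all _ fun y => by positivity)]
    exact key.trans_lt ENNReal.ofReal_lt_top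
  constructor
  · refine hi.mono (by apply Measurable.aestronglyMeasurable; fun_prop) (ae_of_all _ fun y => ?_)
    rw [norm_mul, norm_mul, Real.norm_eq_abs |f y|, abs_abs, Real.norm_eq_abs (f y)]
  · rw [← ENNReal.ofReal_le_ofReal_iff (by positivity), ofReal_integral_eq_lintegral_ofReal hi (ae_of_all _ fun y => by positivity)]
    exact key

lemma riesz_Q_real (d : ℕ) (lam : ℝ) (hl : 0 < lam) (hld : lam < d - 2) : ∃ C : ℝ, 0 < C ∧
    ∀ (f : EE d → ℝ) (X S : ℝ), Integrable f → Measurable f → (∀ y, 0 ≤ f y) → 0 ≤ X → 0 < S → ∀ x,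
    (∀ r, 0 < r → gc d r f x ≤ X * (r + S) ^ (-((d - lam)/2))) →
    ∫ y, ‖x - y‖ ^ (-(lam + 1)) * f y ≤ C * X * S ^ (-(1:ℝ)/2) := by
  obtain ⟨C, hC, h⟩ := riesz_Q d lam hl hld
  refine ⟨C, hC, fun f X S hf hm hf0 hX hS x hG => ?_⟩
  have h1 := h (fun y => ENNReal.ofReal (f y)) X S (by fun_prop) hX hS x (by
    intro r hr
    rw [← ofReal_gc hr hf hf0]
    exact ENNReal.ofReal_le_ofReal (hG r hr))
  rw [integral_eq_lintegral_of_nonneg_ae (ae_of_all _ fun y => mul_nonneg (by positivity) (hf0 y)) (by apply Measurable.aestronglyMeasurable; fun_prop)]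
  apply ENNReal.toReal_le_of_le_ofReal (by positivity)
  refine le_trans (le_of_eq ?_) h1
  unfold RI; congr 1; funext y
  rw [ENNReal.ofReal_mul (by positivity)]

def dec {d : ℕ} (x : EE d) : ℝ := (1 + ‖x‖) ^ (-((d:ℝ) + 1))

lemma dec_pos {d : ℕ} (x : EE d) : 0 < dec x := by unfold dec; positivity
lemma dec_le_one {d : ℕ} (x : EE d) : dec x ≤ 1 := by
  unfold dec
  apply Real.rpow_le_one_of_one_le_of_nonpos
  · linarith [norm_nonneg x]
  · have : (0:ℝ) ≤ d := by positivity
    linarith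
lemma dec_continuous {d : ℕ} : Continuous (dec (d := d)) := by
  unfold dec
  refine Continuous.rpow_const (by fun_prop) fun x => Or.inl (by positivity)
lemma dec_integrable {d : ℕ} : Integrable (dec (d := d)) := by
  apply integrable_one_add_norm; simp
lemma dec_shift {d : ℕ} {x x0 : EE d} (h : ‖x - x0‖ ≤ 1) (y : EE d) :
    dec (x - y) ≤ (2:ℝ) ^ ((d:ℝ)+1) * dec (x0 - y) := by
  unfold dec
  have h1 : 1 + ‖x0 - y‖ ≤ 2 * (1 + ‖x - y‖) := by
    have : ‖x0 - y‖ ≤ ‖x - x0‖ + ‖x - y‖ := by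
      rw [norm_sub_rev x x0]
      calc ‖x0 - y‖ = ‖(x0 - x) + (x - y)‖ := by congr 1; abel
        _ ≤ _ := norm_add_le _ _
    linarith [norm_nonneg (x - y)]
  have h2 : (2 * (1 + ‖x - y‖)) ^ (-((d:ℝ) + 1)) ≤ (1 + ‖x0 - y‖) ^ (-((d:ℝ) + 1)) :=
    Real.rpow_le_rpow_of_nonpos (by positivity) h1 (by have : (0:ℝ) ≤ d := by positivity
                                                       linarith)
  rw [Real.mul_rpow (by norm_num) (by positivity), Real.rpow_neg (by norm_num)] at h2
  have h3 : (0:ℝ) < 2 ^ ((d:ℝ)+1) := by positivity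
  rw [inv_mul_le_iff₀ h3] at h2
  exact h2

structure Nice {d : ℕ} (f : EE d → ℝ) : Prop where
  smooth : ContDiff ℝ (⊤ : ℕ∞) f
  decay : ∃ C : ℝ, 0 ≤ C ∧ (∀ x, |f x| ≤ C * dec x) ∧ (∀ x, ‖fderiv ℝ f x‖ ≤ C * dec x)

lemma Nice.continuous {d : ℕ} {f : EE d → ℝ} (hf : Nice f) : Continuous f := hf.smooth.continuous

lemma Nice.integrable {d : ℕ} {f : EE d → ℝ} (hf : Nice f) : Integrable f := by
  obtain ⟨C, hC, h1, -⟩ := hf.decay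
  refine (dec_integrable.const_mul C).mono hf.continuous.aestronglyMeasurable (ae_of_all _ fun x => ?_)
  rw [Real.norm_eq_abs, Real.norm_of_nonneg (by have := dec_pos x; positivity)]
  exact h1 x

lemma Nice.bdd {d : ℕ} {f : EE d → ℝ} (hf : Nice f) : ∃ L : ℝ, 0 ≤ L ∧ ∀ x, |f x| ≤ L := by
  obtain ⟨C, hC, h1, -⟩ := hf.decay
  exact ⟨C, hC, fun x => (h1 x).trans (by have := dec_le_one x; nlinarith)⟩

lemma schwartz_nice {d : ℕ} (S : SchwartzMap (EE d) ℝ) : Nice (fun x => S x) := by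
  refine ⟨S.smooth _, ?_⟩
  have hdec : ∀ (x : EE d), dec x = ((1 + ‖x‖) ^ (d+1))⁻¹ := by
    intro x; unfold dec
    rw [Real.rpow_neg (by positivity)]; congr 1
    rw [← Real.rpow_natCast]; push_cast; rfl
  have h0 := fun x => SchwartzMap.one_add_le_sup_seminorm_apply (𝕜 := ℝ) (m := (d+1, 1)) (k := d+1) (n := 0) le_rfl (by norm_num) S x
  have h1 := fun x => SchwartzMap.one_add_le_sup_seminorm_apply (𝕜 := ℝ) (m := (d+1, 1)) (k := d+1) (n := 1) le_rfl le_rfl S x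
  set C := 2 ^ (d+1) * ((Finset.Iic (d+1, 1)).sup fun m => SchwartzMap.seminorm ℝ m.1 m.2) S with hC
  refine ⟨C, by positivity, fun x => ?_, fun x => ?_⟩
  · have := h0 x
    rw [norm_iteratedFDeriv_zero] at this
    rw [hdec, ← div_eq_mul_inv, le_div_iff₀ (by positivity), mul_comm]
    exact this
  · have := h1 x
    rw [← norm_fderiv_iteratedFDeriv, ] at this
    rw [hdec, ← div_eq_mul_inv, le_div_iff₀ (by positivity), mul_comm]
    refine le_trans (le_of_eq ?_) this
    congr 1
    rw [norm_fderiv_iteratedFDeriv, norm_iteratedFDeriv_one]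

lemma dec_riesz_integrable {d : ℕ} {β : ℝ} (hβ : 0 < β) (hβd : β < d) (x : EE d) :
    Integrable (fun y => ‖y‖ ^ (-β) * dec (x - y)) := by
  obtain ⟨C, -, h⟩ := riesz_real d β hβ hβd
  have := (h (fun y => dec (x - y)) 1 (dec_integrable.comp_sub_left x) (by have := dec_continuous (d := d); fun_prop)
    (fun y => by rw [abs_of_pos (dec_pos _)]; exact dec_le_one _) 0).1
  simpa using this

section conv
variable {d : ℕ} {W W' : Type*} [NormedAddCommGroup W] [NormedSpace ℝ W]
  [NormedAddCommGroup W'] [NormedSpace ℝ W']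

lemma conv_continuous {β : ℝ} (hβ : 0 < β) (hβd : β < d) {C : ℝ}
    (H : EE d → EE d → W') (hm : ∀ x, AEStronglyMeasurable (H x) volume)
    (hc : ∀ y, Continuous (fun x => H x y)) (hC : 0 ≤ C)
    (hb : ∀ x y, ‖H x y‖ ≤ C * (‖y‖ ^ (-β) * dec (x - y))) : Continuous (fun x => ∫ y, H x y) := by
  rw [continuous_iff_continuousAt]
  intro x0
  apply continuousAt_of_dominated (bound := fun y => C * (2:ℝ) ^ ((d:ℝ)+1) * (‖y‖ ^ (-β) * dec (x0 - y)))
  · exact Eventually.of_forall hm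
  · filter_upwards [Metric.closedBall_mem_nhds x0 one_pos] with x hx
    refine ae_of_all _ fun y => (hb x y).trans ?_
    rw [mem_closedBall_iff_norm] at hx
    calc _ ≤ C * (‖y‖ ^ (-β) * ((2:ℝ) ^ ((d:ℝ)+1) * dec (x0 - y))) := by gcongr; exact dec_shift hx y
      _ = _ := by ring
  · exact (dec_riesz_integrable hβ hβd x0).const_mul _
  · exact ae_of_all _ fun y => (hc y).continuousAt
end conv

def bt {d : ℕ} (lam : ℝ) (f : EE d → ℝ) (x : EE d) : EE d := ∫ y, f y • Kk lam (x - y)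

def IR {d : ℕ} (β : ℝ) (f : EE d → ℝ) (x : EE d) : ℝ := ∫ y, ‖x - y‖ ^ (-β) * |f y|

lemma IR_nonneg {d : ℕ} (β : ℝ) (f : EE d → ℝ) (x : EE d) : 0 ≤ IR β f x :=
  integral_nonneg fun y => by positivity

lemma bt_eq {d : ℕ} (lam : ℝ) (f : EE d → ℝ) (x : EE d) : bt lam f x = ∫ y, f (x - y) • Kk lam y := by
  unfold bt
  have := integral_sub_left_eq_self (fun y => f (x - y) • Kk lam y) volume x
  simpa using this

lemma IR_eq {d : ℕ} (β : ℝ) (f : EE d → ℝ) (x : EE d) : IR β f x = ∫ y, ‖y‖ ^ (-β) * |f (x - y)| := by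
  unfold IR
  have := integral_sub_left_eq_self (fun y => ‖y‖ ^ (-β) * |f (x - y)|) volume x
  simpa using this

lemma IR_continuous {d : ℕ} {β : ℝ} (hβ : 0 < β) (hβd : β < d) {f : EE d → ℝ} (hf : Nice f) : Continuous (IR β f) := by
  obtain ⟨C, hC, h1, -⟩ := hf.decay
  have hfc := hf.continuous
  simp only [funext (IR_eq β f)]
  refine conv_continuous hβ hβd (C := C) (H := fun x y => ‖y‖ ^ (-β) * |f (x - y)|) ?_ ?_ hC ?_
  · intro x; apply Measurable.aestronglyMeasurable; fun_prop
  · intro y; fun_prop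
  · intro x y
    rw [norm_mul, Real.norm_of_nonneg (by positivity), Real.norm_eq_abs, abs_abs]
    calc _ ≤ ‖y‖ ^ (-β) * (C * dec (x - y)) := by gcongr; exact h1 _
      _ = _ := by ring

lemma bt_contDiff {d : ℕ} {lam : ℝ} (hl : 0 < lam) (hld : lam + 1 < d) {f : EE d → ℝ} (hf : Nice f) :
    ContDiff ℝ 1 (bt lam f) := by
  obtain ⟨C, hC, h1, h2⟩ := hf.decay
  have hfc := hf.continuous
  have hdf : Continuous (fderiv ℝ f) := hf.smooth.continuous_fderiv (by simp)
  have hKm := Kk_measurable (d := d) lam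
  simp only [funext (bt_eq lam f)]
  have hsm : ∀ x, AEStronglyMeasurable (fun y => (fderiv ℝ f (x - y)).smulRight (Kk lam y)) volume := by
    intro x
    exact (ContinuousLinearMap.smulRightL ℝ (EE d) (EE d)).aestronglyMeasurable_comp₂
      (by apply Continuous.aestronglyMeasurable; fun_prop) hKm.aestronglyMeasurable
  have hbd : ∀ x y, ‖(fderiv ℝ f (x - y)).smulRight (Kk lam y)‖ ≤ (C * lam) * (‖y‖ ^ (-(lam+1)) * dec (x - y)) := by
    intro x y
    rw [ContinuousLinearMap.norm_smulRight_apply, Kk_norm hl]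
    calc _ ≤ (C * dec (x - y)) * (lam * ‖y‖ ^ (-(lam+1))) := by gcongr; exact h2 _
      _ = _ := by ring
  have hder : ∀ x, HasFDerivAt (fun x => ∫ y, f (x - y) • Kk lam y) (∫ y, (fderiv ℝ f (x - y)).smulRight (Kk lam y)) x := by
    intro x0
    apply hasFDerivAt_integral_of_dominated_of_fderiv_le (s := Metric.closedBall x0 1)
      (bound := fun y => (C * lam) * (2:ℝ) ^ ((d:ℝ)+1) * (‖y‖ ^ (-(lam+1)) * dec (x0 - y)))
      (F' := fun x y => (fderiv ℝ f (x - y)).smulRight (Kk lam y))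
    · exact Metric.closedBall_mem_nhds x0 one_pos
    · refine Eventually.of_forall fun x => ?_
      apply Measurable.aestronglyMeasurable; fun_prop
    · refine ((dec_riesz_integrable (by linarith) hld x0).const_mul (C * lam)).mono ?_ (ae_of_all _ fun y => ?_)
      · apply Measurable.aestronglyMeasurable; fun_prop
      · have := dec_pos (x0 - y)
        rw [norm_smul, Kk_norm hl, Real.norm_eq_abs, Real.norm_of_nonneg (by positivity)]
        calc _ ≤ (C * dec (x0 - y)) * (lam * ‖y‖ ^ (-(lam+1))) := by gcongr; exact h1 _
          _ = _ := by ring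
    · exact hsm x0
    · refine ae_of_all _ fun y x hx => (hbd x y).trans ?_
      rw [mem_closedBall_iff_norm] at hx
      calc _ ≤ (C * lam) * (‖y‖ ^ (-(lam+1)) * ((2:ℝ) ^ ((d:ℝ)+1) * dec (x0 - y))) := by gcongr; exact dec_shift hx y
        _ = _ := by ring
    · exact (dec_riesz_integrable (by linarith) hld x0).const_mul _
    · refine ae_of_all _ fun y x hx => ?_
      have h3 : HasFDerivAt (fun x => f (x - y)) (fderiv ℝ f (x - y)) x := by
        have h4 := (hf.smooth.differentiable (by simp) (x - y)).hasFDerivAt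
        exact h4.comp x ((hasFDerivAt_id x).sub_const y)
      have := h3.smul_const (Kk lam y)
      exact this
  rw [contDiff_one_iff_fderiv]
  refine ⟨fun x => (hder x).differentiableAt, ?_⟩
  rw [funext fun x => (hder x).fderiv]
  refine conv_continuous (β := lam + 1) (by linarith) hld (C := C * lam) _ hsm ?_ (by positivity) hbd
  intro y
  have : (fun x => (fderiv ℝ f (x - y)).smulRight (Kk lam y)) = fun x => (ContinuousLinearMap.smulRightL ℝ (EE d) (EE d) (fderiv ℝ f (x - y))) (Kk lam y) := rfl
  rw [this]
  fun_prop

lemma bt_norm_le {d : ℕ} {lam : ℝ} (hl : 0 < lam) (f : EE d → ℝ) (x : EE d) :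
    ‖bt lam f x‖ ≤ lam * IR (lam + 1) f x := by
  unfold bt IR
  refine (norm_integral_le_integral_norm _).trans (le_of_eq ?_)
  rw [← integral_const_mul]
  congr 1; funext y
  rw [norm_smul, Kk_norm hl, Real.norm_eq_abs]; ring

lemma bt_integrable {d : ℕ} {lam : ℝ} (hl : 0 < lam) (hld : lam + 1 < d) {f : EE d → ℝ} (hf : Integrable f)
    (hfc : Continuous f) {L : ℝ} (hL : ∀ y, |f y| ≤ L) (x : EE d) :
    Integrable (fun y => f y • Kk lam (x - y)) := by
  obtain ⟨C, -, h⟩ := riesz_real d (lam + 1) (by linarith) hld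
  have := (h f L hf hfc.measurable hL x).1.const_mul lam
  have hKm := Kk_measurable (d := d) lam
  refine this.mono (by apply Measurable.aestronglyMeasurable; fun_prop) (ae_of_all _ fun y => ?_)
  rw [norm_smul, Kk_norm hl, norm_mul, norm_mul, Real.norm_of_nonneg hl.le, Real.norm_of_nonneg (by positivity : 0 ≤ ‖x-y‖ ^ (-(lam+1)))]
  apply le_of_eq; ring

lemma bt_sub {d : ℕ} {lam : ℝ} (hl : 0 < lam) (hld : lam + 1 < d) {f g : EE d → ℝ} (hf : Nice f) (hg : Nice g) (x : EE d) :
    bt lam f x - bt lam g x = bt lam (fun y => f y - g y) x := by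
  obtain ⟨L, -, hL⟩ := hf.bdd
  obtain ⟨L', -, hL'⟩ := hg.bdd
  unfold bt
  rw [← integral_sub (bt_integrable hl hld hf.integrable hf.continuous hL x) (bt_integrable hl hld hg.integrable hg.continuous hL' x)]
  simp only [sub_smul]

lemma ae_ne {d : ℕ} (hd : 0 < d) (x : EE d) : ∀ᵐ y : EE d, x - y ≠ 0 := by
  have : Nonempty (Fin d) := ⟨⟨0, hd⟩⟩
  have := (Measure.ae_ne volume x : ∀ᵐ y ∂(volume : Measure (EE d)), y ≠ x)
  filter_upwards [this] with y hy
  exact sub_ne_zero.2 hy.symm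

lemma bt_diff {d : ℕ} {lam : ℝ} (hl : 0 < lam) (hld : lam + 2 < d) {f : EE d → ℝ} (hf : Nice f) (x x' : EE d) :
    ‖bt lam f x - bt lam f x'‖ ≤ lam * (lam + 3) * ‖x - x'‖ * (IR (lam+2) f x + IR (lam+2) f x') := by
  obtain ⟨L, -, hL⟩ := hf.bdd
  have hd : 0 < d := by
    have : (0:ℝ) < d := by linarith
    exact_mod_cast this
  obtain ⟨C, -, h⟩ := riesz_real d (lam + 2) (by linarith) hld
  have hi : ∀ x : EE d, Integrable (fun y => ‖x - y‖ ^ (-(lam+2)) * |f y|) := fun x =>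
    (h (fun y => |f y|) L hf.integrable.abs (by have := hf.continuous; fun_prop) (fun y => by rw [abs_abs]; exact hL y) x).1
  unfold bt IR
  rw [← integral_sub (bt_integrable hl (by linarith) hf.integrable hf.continuous hL x) (bt_integrable hl (by linarith) hf.integrable hf.continuous hL x'),
    ← integral_add (hi x) (hi x'), ← integral_const_mul]
  apply norm_integral_le_of_norm_le (((hi x).add (hi x')).const_mul _)
  filter_upwards [ae_ne hd x, ae_ne hd x'] with y h1 h2
  rw [← smul_sub, norm_smul, Real.norm_eq_abs]
  have := Kk_diff hl h1 h2
  rw [sub_sub_sub_cancel_right] at this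
  calc _ ≤ |f y| * (lam * (lam + 3) * ‖x - x'‖ * (‖x - y‖ ^ (-(lam+2)) + ‖x' - y‖ ^ (-(lam+2)))) := by gcongr
    _ = _ := by simp only [Pi.add_apply]; ring

lemma bt_fderiv_le {d : ℕ} {lam : ℝ} (hl : 0 < lam) (hld : lam + 2 < d) {f : EE d → ℝ} (hf : Nice f) (x : EE d) :
    ‖fderiv ℝ (bt lam f) x‖ ≤ 2 * (lam * (lam + 3)) * IR (lam+2) f x := by
  have hdiff : HasFDerivAt (bt lam f) (fderiv ℝ (bt lam f) x) x :=
    ((bt_contDiff hl (by linarith) hf).differentiable (by simp) x).hasFDerivAt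
  have hIc : Continuous (IR (lam+2) f) := IR_continuous (by linarith) hld hf
  have h0 := IR_nonneg (lam+2) f x
  apply le_of_forall_pos_le_add
  intro ε hε
  apply hdiff.le_of_lip' (by positivity)
  have hev : ∀ᶠ y in 𝓝 x, lam * (lam+3) * (IR (lam+2) f y + IR (lam+2) f x) < 2 * (lam * (lam + 3)) * IR (lam+2) f x + ε := by
    have hc : Continuous (fun y => lam * (lam+3) * (IR (lam+2) f y + IR (lam+2) f x)) := by fun_prop
    apply hc.continuousAt.eventually_lt continuousAt_const
    linarith
  filter_upwards [hev] with y hy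
  refine (bt_diff hl hld hf y x).trans ?_
  have := norm_nonneg (y - x)
  nlinarith

lemma avg_contDiff {d : ℕ} (ν : Measure (EE d)) [IsProbabilityMeasure ν] {h : EE d → EE d} (hh : ContDiff ℝ 1 h) {A B : ℝ}
    (hA : ∀ x, ‖h x‖ ≤ A) (hB : ∀ x, ‖fderiv ℝ h x‖ ≤ B) :
    (∀ x, HasFDerivAt (fun x => ∫ z, h (x - z) ∂ν) (∫ z, fderiv ℝ h (x - z) ∂ν) x) ∧
    ContDiff ℝ 1 (fun x => ∫ z, h (x - z) ∂ν) := by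
  have hhc := hh.continuous
  have hdc : Continuous (fderiv ℝ h) := hh.continuous_fderiv (by simp)
  have h1 : ∀ x, HasFDerivAt (fun x => ∫ z, h (x - z) ∂ν) (∫ z, fderiv ℝ h (x - z) ∂ν) x := by
    intro x0
    apply hasFDerivAt_integral_of_dominated_of_fderiv_le (s := univ) (bound := fun _ => B)
      (F' := fun x z => fderiv ℝ h (x - z))
    · exact univ_mem
    · refine Eventually.of_forall fun x => ?_
      apply Continuous.aestronglyMeasurable; fun_prop
    · apply Integrable.of_bound (C := A)
      · apply Continuous.aestronglyMeasurable; fun_prop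
      · exact ae_of_all _ fun z => hA _
    · apply Continuous.aestronglyMeasurable; fun_prop
    · exact ae_of_all _ fun z x _ => hB _
    · exact integrable_const _
    · refine ae_of_all _ fun z x _ => ?_
      have h4 := (hh.differentiable (by simp) (x - z)).hasFDerivAt
      exact h4.comp x ((hasFDerivAt_id x).sub_const z)
  refine ⟨h1, ?_⟩
  rw [contDiff_one_iff_fderiv]
  refine ⟨fun x => (h1 x).differentiableAt, ?_⟩
  rw [funext fun x => (h1 x).fderiv]
  apply continuous_of_dominated (bound := fun _ => B)
  · intro x; apply Continuous.aestronglyMeasurable; fun_prop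
  · intro x; exact ae_of_all _ fun z => hB _
  · exact integrable_const _
  · refine ae_of_all _ fun z => by fun_prop

def bn {d : ℕ} (ν : Measure (EE d)) (lam : ℝ) (f : EE d → ℝ) (x : EE d) : EE d := ∫ z, bt lam f (x - z) ∂ν

lemma IR_bdd {d : ℕ} {β : ℝ} (hβ : 0 < β) (hβd : β < d) : ∃ C : ℝ, 0 < C ∧ ∀ (f : EE d → ℝ) (L : ℝ),
    Nice f → (∀ y, |f y| ≤ L) → ∀ x, IR β f x ≤ C * ((∫ y, |f y|) + L) := by
  obtain ⟨C, hC, h⟩ := riesz_real d β hβ hβd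
  exact ⟨C, hC, fun f L hf hL x => (h f L hf.integrable hf.continuous.measurable hL x).2⟩

lemma bt_bdds {d : ℕ} {lam : ℝ} (hl : 0 < lam) (hld : lam + 2 < d) {f : EE d → ℝ} (hf : Nice f) :
    (∃ A, ∀ x, ‖bt lam f x‖ ≤ A) ∧ (∃ B, ∀ x, ‖fderiv ℝ (bt lam f) x‖ ≤ B) := by
  obtain ⟨L, -, hL⟩ := hf.bdd
  obtain ⟨C1, -, h1⟩ := IR_bdd (d := d) (β := lam + 1) (by linarith) (by linarith)
  obtain ⟨C2, -, h2⟩ := IR_bdd (d := d) (β := lam + 2) (by linarith) (by linarith)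
  constructor
  · exact ⟨_, fun x => (bt_norm_le hl f x).trans (mul_le_mul_of_nonneg_left (h1 f L hf hL x) hl.le)⟩
  · exact ⟨_, fun x => (bt_fderiv_le hl hld hf x).trans (mul_le_mul_of_nonneg_left (h2 f L hf hL x) (by positivity))⟩

lemma bn_contDiff {d : ℕ} (ν : Measure (EE d)) [IsProbabilityMeasure ν] {lam : ℝ} (hl : 0 < lam) (hld : lam + 2 < d) {f : EE d → ℝ} (hf : Nice f) :
    ContDiff ℝ 1 (bn ν lam f) := by
  obtain ⟨⟨A, hA⟩, ⟨B, hB⟩⟩ := bt_bdds hl hld hf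
  exact (avg_contDiff ν (bt_contDiff hl (by linarith) hf) hA hB).2

lemma bn_fderiv_le {d : ℕ} (ν : Measure (EE d)) [IsProbabilityMeasure ν] {lam : ℝ} (hl : 0 < lam) (hld : lam + 2 < d) {f : EE d → ℝ} (hf : Nice f) (x : EE d) :
    ‖fderiv ℝ (bn ν lam f) x‖ ≤ 2 * (lam * (lam + 3)) * ∫ z, IR (lam+2) f (x - z) ∂ν := by
  obtain ⟨⟨A, hA⟩, ⟨B, hB⟩⟩ := bt_bdds hl hld hf
  have := (avg_contDiff ν (bt_contDiff hl (by linarith) hf) hA hB).1 x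
  unfold bn
  rw [this.fderiv, ← integral_const_mul]
  apply norm_integral_le_of_norm_le
  · obtain ⟨L, -, hL⟩ := hf.bdd
    obtain ⟨C2, -, h2⟩ := IR_bdd (d := d) (β := lam + 2) (by linarith) (by linarith)
    have hIc : Continuous (IR (lam+2) f) := IR_continuous (by linarith) hld hf
    apply Integrable.const_mul
    apply Integrable.of_bound (C := C2 * ((∫ y, |f y|) + L))
    · apply Continuous.aestronglyMeasurable; fun_prop
    · refine ae_of_all _ fun z => ?_
      rw [Real.norm_of_nonneg (IR_nonneg _ _ _)]
      exact h2 f L hf hL _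
  · exact ae_of_all _ fun z => bt_fderiv_le hl hld hf _

lemma bn_norm_le {d : ℕ} (ν : Measure (EE d)) [IsProbabilityMeasure ν] {lam : ℝ} {f : EE d → ℝ} {B : ℝ}
    (hB : ∀ x, ‖bt lam f x‖ ≤ B) (x : EE d) : ‖bn ν lam f x‖ ≤ B := by
  unfold bn
  have := norm_integral_le_of_norm_le_const (μ := ν) (f := fun z => bt lam f (x - z)) (ae_of_all _ fun z => hB (x - z))
  simpa using this

lemma diverg_le {d : ℕ} {F : EE d → EE d} {x : EE d} (hF : DifferentiableAt ℝ F x) :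
    |diverg F x| ≤ d * ‖fderiv ℝ F x‖ := by
  unfold diverg
  refine (Finset.abs_sum_le_sum_abs _ _).trans ?_
  have : ∀ i ∈ Finset.univ, |fderiv ℝ (fun y => F y i) x (EuclideanSpace.single i 1)| ≤ ‖fderiv ℝ F x‖ := by
    intro i _
    have h1 : HasFDerivAt (fun y => F y i) ((EuclideanSpace.proj i : EE d →L[ℝ] ℝ).comp (fderiv ℝ F x)) x :=
      (EuclideanSpace.proj i : EE d →L[ℝ] ℝ).hasFDerivAt.comp x hF.hasFDerivAt
    rw [h1.fderiv]
    rw [← Real.norm_eq_abs]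
    change ‖(fderiv ℝ F x (EuclideanSpace.single i 1)) i‖ ≤ _
    refine (PiLp.norm_apply_le _ i).trans ?_
    refine (ContinuousLinearMap.le_opNorm _ _).trans ?_
    simp
  refine (Finset.sum_le_card_nsmul _ _ _ this).trans ?_
  simp


lemma Veta_gradient {d : ℕ} {lam : ℝ} (hl : 0 < lam) (hld : lam + 2 < d) {g : EE d → ℝ} (hg : Continuous g)
    (hgi : Integrable g) {L : ℝ} (hL : ∀ y, |g y| ≤ L) (z : EE d) :
    HasGradientAt (fun z => ∫ y, g (z - y) * ‖y‖ ^ (-lam)) (∫ y, g y • Kk lam (z - y)) z := by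
  have hd : 0 < d := by
    have : (0:ℝ) < d := by linarith
    exact_mod_cast this
  have e : (fun z => ∫ y, g (z - y) * ‖y‖ ^ (-lam)) = fun z => ∫ y, ‖z - y‖ ^ (-lam) * g y := by
    funext z
    have := integral_sub_left_eq_self (fun y => ‖z - y‖ ^ (-lam) * g y) volume z
    simp only [sub_sub_cancel] at this
    rw [← this]; congr 1; funext y; ring
  rw [e, hasGradientAt_iff_hasFDerivAt, hasFDerivAt_iff_isLittleO_nhds_zero]
  obtain ⟨C0, hC0, h0⟩ := riesz_real d lam hl (by linarith)
  obtain ⟨C2, hC2, h2⟩ := riesz_real d (lam+2) (by linarith) hld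
  have hL0 : 0 ≤ L := (abs_nonneg _).trans (hL z)
  set D := lam * (lam + 4) * (2 * (C2 * ((∫ y, |g y|) + L))) with hD
  have hi : ∀ x : EE d, Integrable (fun y => ‖x - y‖ ^ (-(lam+2)) * |g y|) := fun x =>
    (h2 (fun y => |g y|) L hgi.abs (by fun_prop) (fun y => by rw [abs_abs]; exact hL y) x).1
  have hKi := bt_integrable hl (by linarith) hgi hg hL z
  have hbound : ∀ h : EE d, ‖(∫ y, ‖z + h - y‖ ^ (-lam) * g y) - (∫ y, ‖z - y‖ ^ (-lam) * g y) -
      ((InnerProductSpace.toDual ℝ (EE d)) (∫ y, g y • Kk lam (z - y))) h‖ ≤ D * ‖h‖^2 := by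
    intro h
    have e1 : ((InnerProductSpace.toDual ℝ (EE d)) (∫ y, g y • Kk lam (z - y))) h = ∫ y, inner ℝ h (g y • Kk lam (z - y)) := by
      rw [InnerProductSpace.toDual_apply_apply, real_inner_comm, integral_inner hKi]
    have hKi2 : Integrable (fun y => inner ℝ h (g y • Kk lam (z - y))) := hKi.const_inner h
    have i1 := (h0 g L hgi hg.measurable hL (z+h)).1
    have i2 := (h0 g L hgi hg.measurable hL z).1
    rw [e1, ← integral_sub i1 i2, ← integral_sub (f := fun y => ‖z + h - y‖ ^ (-lam) * g y - ‖z - y‖ ^ (-lam) * g y) (i1.sub i2) hKi2]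
    calc _ ≤ ∫ y, lam * (lam+4) * ‖h‖^2 * (‖z - y‖ ^ (-(lam+2)) * |g y| + ‖z + h - y‖ ^ (-(lam+2)) * |g y|) := by
          apply norm_integral_le_of_norm_le (((hi z).add (hi (z+h))).const_mul _)
          filter_upwards [ae_ne hd z, ae_ne hd (z+h)] with y h1 h2
          have h3 := phi_taylor hl (a := z - y) (h := h) h1 (by rwa [sub_add_eq_add_sub])
          rw [sub_add_eq_add_sub] at h3
          rw [inner_smul_right, real_inner_comm]
          rw [show ‖z + h - y‖ ^ (-lam) * g y - ‖z - y‖ ^ (-lam) * g y - g y * inner ℝ (Kk lam (z - y)) h =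
            g y * (‖z + h - y‖ ^ (-lam) - ‖z - y‖ ^ (-lam) - inner ℝ (Kk lam (z - y)) h) by ring]
          rw [norm_mul, Real.norm_eq_abs, Real.norm_eq_abs]
          calc _ ≤ |g y| * (lam * (lam + 4) * ‖h‖ ^ 2 * (‖z - y‖ ^ (-(lam + 2)) + ‖z + h - y‖ ^ (-(lam + 2)))) := by gcongr
            _ = _ := by simp only [Pi.add_apply]; ring
      _ = lam * (lam+4) * ‖h‖^2 * ((∫ y, ‖z - y‖ ^ (-(lam+2)) * |g y|) + ∫ y, ‖z + h - y‖ ^ (-(lam+2)) * |g y|) := by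
          rw [integral_const_mul, integral_add (hi z) (hi (z+h))]
      _ ≤ lam * (lam+4) * ‖h‖^2 * (C2 * ((∫ y, |g y|) + L) + C2 * ((∫ y, |g y|) + L)) := by
          gcongr
          · exact (h2 g L hgi hg.measurable hL _).2
          · exact (h2 g L hgi hg.measurable hL _).2
      _ = _ := by rw [hD]; ring
  have hO : (fun h : EE d => (∫ y, ‖z + h - y‖ ^ (-lam) * g y) - (∫ y, ‖z - y‖ ^ (-lam) * g y) -
      ((InnerProductSpace.toDual ℝ (EE d)) (∫ y, g y • Kk lam (z - y))) h) =O[𝓝 0] fun h => ‖h‖^2 := by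
    apply Asymptotics.IsBigO.of_bound D
    refine Eventually.of_forall fun h => ?_
    rw [Real.norm_of_nonneg (by positivity : 0 ≤ ‖h‖^2)]
    exact hbound h
  refine hO.trans_isLittleO ?_
  exact Asymptotics.isLittleO_norm_pow_id one_lt_two

structure Sol {d : ℕ} (ν : Measure (EE d)) (lam σ κ T : ℝ) (u : ℝ → EE d → ℝ) : Prop where
  smooth : ContDiffOn ℝ (⊤ : ℕ∞) (fun p : ℝ × EE d => u p.1 p.2) (Icc 0 T ×ˢ univ)
  nice : ∀ t ∈ Icc (0:ℝ) T, Nice (u t)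
  nonneg : ∀ t ∈ Icc (0:ℝ) T, ∀ x, 0 ≤ u t x
  mass : ∀ t ∈ Icc (0:ℝ) T, (∫ x, u t x) = 1
  eqn : ∀ t ∈ Ioo (0:ℝ) T, ∀ x, HasDerivAt (fun s => u s x)
    (σ * lapl (u t) x - κ * diverg (fun z => u t z • bn ν lam (u t) z) x) t

lemma sol_of {d : ℕ} {ν : Measure (EE d)} {lam σ κ T : ℝ} {u : ℝ → EE d → ℝ} {K : EE d → EE d}
    (h : IsAggregationSolution σ κ T K u)
    (hK : ∀ f : EE d → ℝ, Nice f → ∀ z, ∫ y, f y • K (z - y) = bn ν lam f z) : Sol ν lam σ κ T u := by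
  obtain ⟨h1, h2, h3, h4, h5⟩ := h
  have hn : ∀ t ∈ Icc (0:ℝ) T, Nice (u t) := by
    intro t ht
    obtain ⟨S, hS⟩ := h2 t ht
    rw [funext hS]; exact schwartz_nice S
  refine ⟨h1, hn, h3, h4, fun t ht x => ?_⟩
  have ht' : t ∈ Icc 0 T := Ioo_subset_Icc_self ht
  have := (h5 t ht' x).hasDerivAt (Icc_mem_nhds ht.1 ht.2)
  simpa only [hK (u t) (hn t ht')] using this

lemma kernel_limit {d : ℕ} (hd : 0 < d) {lam : ℝ} (f : EE d → ℝ) (z : EE d) :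
    ∫ y, f y • gradient (fun x : EE d => ‖x‖ ^ (-lam)) (z - y) = bn (Measure.dirac 0) lam f z := by
  unfold bn
  rw [integral_dirac, sub_zero]
  unfold bt
  apply integral_congr_ae
  filter_upwards [ae_ne hd z] with y hy
  rw [(phi_hasGradientAt lam hy).gradient]

def chie {d : ℕ} (χ : EE d → ℝ) (η : ℝ) (z : EE d) : ℝ := η ^ (-(d : ℝ)) * χ (η⁻¹ • z)

def nue {d : ℕ} (χ : EE d → ℝ) (η : ℝ) : Measure (EE d) := volume.withDensity (fun z => ENNReal.ofReal (chie χ η z))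

section chi
variable {d : ℕ} {χ : EE d → ℝ} {η : ℝ}

lemma chie_nonneg (h0 : ∀ x, 0 ≤ χ x) (hη : 0 < η) (z : EE d) : 0 ≤ chie χ η z := by
  unfold chie; have := h0 (η⁻¹ • z); positivity

lemma chie_continuous (hc : Continuous χ) : Continuous (chie χ η) := by unfold chie; fun_prop

lemma chie_compact (hc : HasCompactSupport χ) (hη : 0 < η) : HasCompactSupport (chie χ η) := by
  have : HasCompactSupport (fun z => χ (η⁻¹ • z)) := hc.comp_smul (inv_ne_zero hη.ne')
  exact this.mul_left

lemma chie_integral (hη : 0 < η) (h1 : (∫ x, χ x) = 1) : ∫ z, chie χ η z = 1 := by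
  unfold chie
  rw [integral_const_mul, Measure.integral_comp_smul, h1, finrank_euclideanSpace_fin, abs_of_pos (by positivity)]
  rw [Real.rpow_neg hη.le, Real.rpow_natCast]
  simp
  field_simp

lemma nue_prob (hc : Continuous χ) (hcs : HasCompactSupport χ) (h0 : ∀ x, 0 ≤ χ x) (hη : 0 < η) (h1 : (∫ x, χ x) = 1) :
    IsProbabilityMeasure (nue χ η) := by
  constructor
  unfold nue
  rw [withDensity_apply _ MeasurableSet.univ, Measure.restrict_univ, ← ofReal_integral_eq_lintegral_ofReal
    ((chie_continuous hc).integrable_of_hasCompactSupport (chie_compact hcs hη)) (ae_of_all _ (chie_nonneg h0 hη)), chie_integral hη h1]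
  simp

lemma nue_integral (hc : Continuous χ) (h0 : ∀ x, 0 ≤ χ x) (hη : 0 < η) {W : Type*} [NormedAddCommGroup W] [NormedSpace ℝ W]
    (g : EE d → W) : ∫ z, g z ∂(nue χ η) = ∫ z, chie χ η z • g z := by
  unfold nue
  have hcc := chie_continuous (η := η) hc
  rw [integral_withDensity_eq_integral_toReal_smul (by fun_prop) (ae_of_all _ fun z => ENNReal.ofReal_lt_top)]
  congr 1; funext z
  rw [ENNReal.toReal_ofReal (chie_nonneg h0 hη z)]

lemma nue_supp (hcs : HasCompactSupport χ) (hc : Continuous χ) : ∃ R : ℝ, 0 < R ∧ ∀ η : ℝ, 0 < η → ∀ᵐ z ∂(nue χ η), ‖z‖ ≤ R * η := by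
  obtain ⟨R, hR⟩ := hcs.isCompact.isBounded.exists_norm_le
  refine ⟨max R 1, by positivity, fun η hη => ?_⟩
  unfold nue
  have hcc := chie_continuous (η := η) hc
  rw [ae_withDensity_iff (by fun_prop)]
  refine ae_of_all _ fun z hz => ?_
  have : χ (η⁻¹ • z) ≠ 0 := by
    intro h
    apply hz
    unfold chie; rw [h]; simp
  have h2 := hR _ (subset_tsupport χ this)
  rw [norm_smul, norm_inv, Real.norm_of_nonneg hη.le, inv_mul_le_iff₀ hη] at h2
  have := le_max_left R 1
  nlinarith

lemma kernel_eta {lam : ℝ} (hl : 0 < lam) (hld : lam + 2 < d) (hc : Continuous χ) (hcs : HasCompactSupport χ)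
    (h0 : ∀ x, 0 ≤ χ x) (hη : 0 < η) (f : EE d → ℝ) (hf : Nice f) (z : EE d) :
    ∫ y, f y • gradient (Veta lam χ η) (z - y) = bn (nue χ η) lam f z := by
  have hcc := chie_continuous (η := η) hc
  have hci := hcc.integrable_of_hasCompactSupport (μ := volume) (chie_compact hcs hη)
  obtain ⟨L, hL⟩ := (chie_compact hcs hη).exists_bound_of_continuous hcc
  obtain ⟨Lf, -, hLf⟩ := hf.bdd
  have hKm := Kk_measurable (d := d) lam
  have hfc := hf.continuous
  have hgrad : ∀ z, gradient (Veta lam χ η) z = ∫ y, chie χ η y • Kk lam (z - y) := fun z =>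
    (Veta_gradient hl hld hcc hci (fun y => hL y) z).gradient
  simp only [hgrad]
  unfold bn bt
  rw [nue_integral hc h0 hη]
  simp only [← integral_smul]
  have hcl : ∀ (c e : ℝ) (k : EE d), c • e • k = e • c • k := fun c e k => smul_comm _ _ _
  rw [integral_integral_swap]
  · congr 1; funext y; congr 1; funext w
    rw [hcl]; congr 3; abel
  · -- integrability
    have hmeas : Measurable (fun p : EE d × EE d => f p.1 • chie χ η p.2 • Kk lam (z - p.1 - p.2)) := by fun_prop
    change Integrable (fun p : EE d × EE d => f p.1 • chie χ η p.2 • Kk lam (z - p.1 - p.2)) (volume.prod volume)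
    rw [integrable_prod_iff hmeas.aestronglyMeasurable]
    constructor
    · refine ae_of_all _ fun y => ?_
      exact (bt_integrable hl (by linarith) hci hcc (fun y => hL y) (z - y)).smul (f y)
    · obtain ⟨C, hC, hR⟩ := riesz_real d (lam+1) (by linarith) (by linarith)
      refine (hf.integrable.abs.const_mul (lam * (C * ((∫ y, |chie χ η y|) + L)))).mono ?_ (ae_of_all _ fun y => ?_)
      · exact (hmeas.norm.stronglyMeasurable.integral_prod_right').aestronglyMeasurable
      · rw [Real.norm_of_nonneg (integral_nonneg fun _ => norm_nonneg _)]
        refine le_trans ?_ (le_abs_self _)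
        have : ∀ w, ‖f y • chie χ η w • Kk lam (z - y - w)‖ = |f y| * lam * (‖z - y - w‖ ^ (-(lam+1)) * |chie χ η w|) := by
          intro w
          rw [norm_smul, norm_smul, Kk_norm hl, Real.norm_eq_abs, Real.norm_eq_abs]; ring
        simp only [this]
        rw [integral_const_mul]
        have h2 := (hR _ L hci hcc.measurable (fun y => hL y) (z - y)).2
        calc _ ≤ |f y| * lam * (C * ((∫ y, |chie χ η y|) + L)) := by gcongr
          _ = _ := by ring
end chi

lemma two_le_top' : (2 : WithTop ℕ∞) ≤ ((⊤:ℕ∞) : WithTop ℕ∞) := by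
  exact WithTop.coe_le_coe.2 (le_top : (2:ℕ∞) ≤ ⊤)

lemma lapl_continuous {d : ℕ} {f : EE d → ℝ} (hf : ContDiff ℝ 2 f) : Continuous (lapl f) := by
  unfold lapl
  refine continuous_finsetSum _ fun i _ => ?_
  have h1 : ContDiff ℝ 1 (fun y => fderiv ℝ f y (EuclideanSpace.single i 1)) :=
    (hf.fderiv_right (m := 1) (by norm_num)).clm_apply contDiff_const
  exact (h1.continuous_fderiv (by simp)).clm_apply continuous_const

lemma diverg_continuous {d : ℕ} {F : EE d → EE d} (hF : ContDiff ℝ 1 F) : Continuous (diverg F) := by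
  unfold diverg
  refine continuous_finsetSum _ fun i _ => ?_
  have h1 : ContDiff ℝ 1 (fun y => F y i) := by fun_prop
  exact (h1.continuous_fderiv (by simp)).clm_apply continuous_const

lemma cutoff (d : ℕ) : ∃ C : ℝ, 0 < C ∧ ∀ R : ℝ, 1 ≤ R → ∃ φ : EE d → ℝ, ContDiff ℝ (⊤:ℕ∞) φ ∧ HasCompactSupport φ ∧
    (∀ x, 0 ≤ φ x) ∧ (∀ x, φ x ≤ 1) ∧ (∀ x, ‖x‖ ≤ R → φ x = 1) ∧ (∀ x, ‖fderiv ℝ φ x‖ ≤ C / R) ∧ (∀ x, |lapl φ x| ≤ C / R) := by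
  let f : ContDiffBump (0 : EE d) := ⟨1, 2, by norm_num, by norm_num⟩
  have hf : ContDiff ℝ (⊤:ℕ∞) (f : EE d → ℝ) := f.contDiff
  have hc : HasCompactSupport (f : EE d → ℝ) := f.hasCompactSupport
  obtain ⟨C1, h1⟩ := (hf.continuous_fderiv (by simp)).bounded_above_of_compact_support (hc.fderiv (𝕜 := ℝ))
  have hlc : HasCompactSupport (lapl (f : EE d → ℝ)) := by
    refine HasCompactSupport.of_support_subset_isCompact hc.isCompact ?_
    intro x hx
    by_contra hxs
    apply hx
    unfold lapl
    refine Finset.sum_eq_zero fun i _ => ?_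
    have : (fun y => fderiv ℝ (f : EE d → ℝ) y (EuclideanSpace.single i 1)) =ᶠ[𝓝 x] fun _ => 0 := by
      filter_upwards [(isClosed_tsupport (f : EE d → ℝ)).isOpen_compl.mem_nhds hxs] with y hy
      have : fderiv ℝ (f : EE d → ℝ) y = 0 := by
        by_contra h
        exact hy (support_fderiv_subset ℝ h)
      simp [this]
    rw [this.fderiv_eq]; simp
  obtain ⟨C2, h2⟩ := (lapl_continuous (hf.of_le two_le_top')).bounded_above_of_compact_support hlc
  refine ⟨max (max C1 C2) 1, by positivity, fun R hR => ⟨fun x => f (R⁻¹ • x), ?_, ?_, ?_, ?_, ?_, ?_, ?_⟩⟩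
  · fun_prop
  · exact hc.comp_smul (by positivity)
  · intro x; exact f.nonneg
  · intro x; exact f.le_one
  · intro x hx
    apply f.one_of_mem_closedBall
    simp only [mem_closedBall_zero_iff, norm_smul, norm_inv, Real.norm_eq_abs, abs_of_pos (lt_of_lt_of_le one_pos hR)]
    change R⁻¹ * ‖x‖ ≤ 1
    rw [inv_mul_le_iff₀ (by positivity)]; linarith
  · intro x
    rw [fderiv_comp_smul, norm_smul, norm_inv, Real.norm_eq_abs, abs_of_pos (by positivity), div_eq_inv_mul]
    gcongr
    exact (h1 _).trans ((le_max_left _ _).trans (le_max_left _ _))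
  · intro x
    have : lapl (fun x => f (R⁻¹ • x)) x = R⁻¹ * (R⁻¹ * lapl (f : EE d → ℝ) (R⁻¹ • x)) := by
      unfold lapl
      rw [Finset.mul_sum, Finset.mul_sum]
      refine Finset.sum_congr rfl fun i _ => ?_
      have e : (fun y => fderiv ℝ (fun x => f (R⁻¹ • x)) y (EuclideanSpace.single i 1)) =
          fun y => R⁻¹ * (fun z => fderiv ℝ (f : EE d → ℝ) z (EuclideanSpace.single i 1)) (R⁻¹ • y) := by
        funext y
        rw [fderiv_comp_smul]; rfl
      rw [e, fderiv_const_mul, fderiv_comp_smul (f := fun z => fderiv ℝ (f : EE d → ℝ) z (EuclideanSpace.single i 1))]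
      · rfl
      · have : ContDiff ℝ 1 (fun y => fderiv ℝ (f : EE d → ℝ) y (EuclideanSpace.single i 1)) :=
          ((hf.of_le two_le_top').fderiv_right (m := 1) (by norm_num)).clm_apply contDiff_const
        have h3 := this.differentiable (by simp)
        exact (h3.comp (g := (fun y => fderiv ℝ (f : EE d → ℝ) y (EuclideanSpace.single i 1))) (f := fun y : EE d => R⁻¹ • y) (by fun_prop)) x
    rw [this, abs_mul, abs_mul, abs_of_pos (by positivity : 0 < R⁻¹), div_eq_inv_mul]
    gcongr
    have hR1 : R⁻¹ ≤ 1 := inv_le_one_of_one_le₀ hR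
    have h3 := h2 (R⁻¹ • x)
    rw [Real.norm_eq_abs] at h3
    calc R⁻¹ * |lapl (f : EE d → ℝ) (R⁻¹ • x)| ≤ 1 * |lapl (f : EE d → ℝ) (R⁻¹ • x)| := by gcongr
      _ ≤ _ := by rw [one_mul]; exact h3.trans ((le_max_right _ _).trans (le_max_left _ _))

lemma td {d : ℕ} {G G' : ℝ → EE d → ℝ} {a b : ℝ} {Kc : Set (EE d)} (hK : IsCompact Kc)
    (hG : ContinuousOn (fun p : ℝ × EE d => G p.1 p.2) (Ioo a b ×ˢ univ))
    (hG' : ContinuousOn (fun p : ℝ × EE d => G' p.1 p.2) (Ioo a b ×ˢ univ))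
    (h0 : ∀ t ∈ Ioo a b, ∀ x, x ∉ Kc → G t x = 0) (h0' : ∀ t ∈ Ioo a b, ∀ x, x ∉ Kc → G' t x = 0)
    (hd : ∀ t ∈ Ioo a b, ∀ x, HasDerivAt (fun s => G s x) (G' t x) t) :
    ∀ t ∈ Ioo a b, HasDerivAt (fun t => ∫ x, G t x) (∫ x, G' t x) t := by
  intro t ht
  have sl : ∀ {H : ℝ → EE d → ℝ}, ContinuousOn (fun p : ℝ × EE d => H p.1 p.2) (Ioo a b ×ˢ univ) → ∀ s ∈ Ioo a b, Continuous (H s) := by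
    intro H hH s hs
    rw [← continuousOn_univ]
    exact hH.comp (f := fun x : EE d => (s, x)) (by fun_prop) (fun x _ => ⟨hs, mem_univ x⟩)
  obtain ⟨ε, hε, hsub⟩ : ∃ ε > 0, Icc (t - ε) (t + ε) ⊆ Ioo a b := by
    refine ⟨min (t - a) (b - t) / 2, ?_, ?_⟩
    · have := ht.1; have := ht.2
      have : 0 < min (t - a) (b - t) := lt_min (by linarith) (by linarith)
      linarith
    · intro s hs
      have := ht.1; have := ht.2
      have h3 : 0 < min (t - a) (b - t) := lt_min (by linarith) (by linarith)
      have h1 := min_le_left (t - a) (b - t)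
      have h2 := min_le_right (t - a) (b - t)
      constructor <;> linarith [hs.1, hs.2]
  obtain ⟨C, hC⟩ := ((isCompact_Icc (a := t - ε) (b := t + ε)).prod hK).exists_bound_of_continuousOn
    (hG'.mono (prod_mono hsub (subset_univ _)))
  have hC' : ∀ s ∈ Icc (t - ε) (t + ε), ∀ x, ‖G' s x‖ ≤ Kc.indicator (fun _ => C) x := by
    intro s hs x
    by_cases hx : x ∈ Kc
    · rw [indicator_of_mem hx]; exact hC (s, x) ⟨hs, hx⟩
    · rw [indicator_of_notMem hx, h0' s (hsub hs) x hx]; simp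
  have hnhd : Icc (t - ε) (t + ε) ∈ 𝓝 t := Icc_mem_nhds (by linarith) (by linarith)
  refine (hasDerivAt_integral_of_dominated_loc_of_deriv_le (bound := Kc.indicator (fun _ => C)) hnhd ?_ ?_ ?_ ?_ ?_ ?_).2
  · filter_upwards [hnhd] with s hs
    exact (sl hG s (hsub hs)).aestronglyMeasurable
  · exact (sl hG t ht).integrable_of_hasCompactSupport (HasCompactSupport.intro hK (h0 t ht))
  · exact (sl hG' t ht).aestronglyMeasurable
  · exact ae_of_all _ fun x s hs => hC' s hs x
  · exact (integrable_indicator_iff hK.measurableSet).2 (integrableOn_const hK.measure_lt_top.ne)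
  · exact ae_of_all _ fun x s hs => hd s (hsub hs) x

lemma ibp {d : ℕ} {g Θ : EE d → ℝ} (hg : ContDiff ℝ 1 g) (hΘ : ContDiff ℝ 1 Θ) (hc : HasCompactSupport Θ) (v : EE d) :
    Integrable (fun x => fderiv ℝ g x v * Θ x) ∧ Integrable (fun x => g x * fderiv ℝ Θ x v) ∧
    ∫ x, fderiv ℝ g x v * Θ x = - ∫ x, g x * fderiv ℝ Θ x v := by
  have h1 : Continuous fun x => fderiv ℝ g x v := (hg.continuous_fderiv (by simp)).clm_apply continuous_const
  have h2 : Continuous fun x => fderiv ℝ Θ x v := (hΘ.continuous_fderiv (by simp)).clm_apply continuous_const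
  have h2c : HasCompactSupport fun x => fderiv ℝ Θ x v := hc.fderiv_apply (𝕜 := ℝ) v
  have i1 : Integrable (fun x => fderiv ℝ g x v * Θ x) := (h1.mul hΘ.continuous).integrable_of_hasCompactSupport hc.mul_left
  have i2 : Integrable (fun x => g x * fderiv ℝ Θ x v) := (hg.continuous.mul h2).integrable_of_hasCompactSupport h2c.mul_left
  have i3 : Integrable (fun x => g x * Θ x) := (hg.continuous.mul hΘ.continuous).integrable_of_hasCompactSupport hc.mul_left
  refine ⟨i1, i2, ?_⟩
  have := integral_mul_fderiv_eq_neg_fderiv_mul_of_integrable (μ := volume) (v := v) i1 i2 i3 (fun x _ => hg.differentiable (by simp) x) (fun x _ => hΘ.differentiable (by simp) x)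
  linarith

lemma weak {d : ℕ} {g Θ : EE d → ℝ} {F : EE d → EE d} (σ κ : ℝ) (hg : ContDiff ℝ 2 g) (hF : ContDiff ℝ 1 F) (hΘ : ContDiff ℝ 2 Θ)
    (hc : HasCompactSupport Θ) :
    ∫ x, (σ * lapl g x - κ * diverg F x) * Θ x = ∫ x, (σ * (g x * lapl Θ x) + κ * fderiv ℝ Θ x (F x)) := by
  have e0 : ∀ i : Fin d, ContDiff ℝ 1 (fun y => fderiv ℝ g y (EuclideanSpace.single i 1)) := fun i =>
    (hg.fderiv_right (m := 1) (by norm_num)).clm_apply contDiff_const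
  have e0' : ∀ i : Fin d, ContDiff ℝ 1 (fun y => fderiv ℝ Θ y (EuclideanSpace.single i 1)) := fun i =>
    (hΘ.fderiv_right (m := 1) (by norm_num)).clm_apply contDiff_const
  have hΘ1 : ContDiff ℝ 1 Θ := hΘ.of_le (by norm_num)
  have hg1 : ContDiff ℝ 1 g := hg.of_le (by norm_num)
  have hc' : ∀ i : Fin d, HasCompactSupport (fun y => fderiv ℝ Θ y (EuclideanSpace.single i 1)) := fun i => hc.fderiv_apply (𝕜 := ℝ) _
  have A := fun i : Fin d => ibp (e0 i) hΘ1 hc (EuclideanSpace.single i 1)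
  have B := fun i : Fin d => ibp hg1 (e0' i) (hc' i) (EuclideanSpace.single i 1)
  have hFi : ∀ i : Fin d, ContDiff ℝ 1 (fun y => F y i) := fun i => by fun_prop
  have D := fun i : Fin d => ibp (hFi i) hΘ1 hc (EuclideanSpace.single i 1)
  have l1 : ∀ x, (σ * lapl g x - κ * diverg F x) * Θ x = ∑ i : Fin d,
      (σ * (fderiv ℝ (fun y => fderiv ℝ g y (EuclideanSpace.single i 1)) x (EuclideanSpace.single i 1) * Θ x) -
       κ * (fderiv ℝ (fun y => F y i) x (EuclideanSpace.single i 1) * Θ x)) := by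
    intro x; unfold lapl diverg
    rw [Finset.sum_sub_distrib, sub_mul, ← Finset.mul_sum, ← Finset.mul_sum, ← Finset.sum_mul, ← Finset.sum_mul]
    ring
  have l2 : ∀ x, σ * (g x * lapl Θ x) + κ * fderiv ℝ Θ x (F x) = ∑ i : Fin d,
      (σ * (g x * fderiv ℝ (fun y => fderiv ℝ Θ y (EuclideanSpace.single i 1)) x (EuclideanSpace.single i 1)) +
       κ * (F x i * fderiv ℝ Θ x (EuclideanSpace.single i 1))) := by
    intro x; unfold lapl
    rw [Finset.sum_add_distrib, ← Finset.mul_sum, ← Finset.mul_sum, ← Finset.mul_sum]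
    congr 2
    have : F x = ∑ i : Fin d, F x i • EuclideanSpace.single i (1:ℝ) := by
      ext j; simp [Finset.sum_apply, Pi.single_apply]
    conv_lhs => rw [this]
    simp [map_sum]
  simp_rw [l1, l2]
  rw [integral_finsetSum _ (fun i _ => by exact ((A i).1.const_mul σ).sub ((D i).1.const_mul κ)),
    integral_finsetSum _ (fun i _ => by exact ((B i).2.1.const_mul σ).add ((D i).2.1.const_mul κ))]
  refine Finset.sum_congr rfl fun i _ => ?_
  rw [integral_sub ((A i).1.const_mul σ) ((D i).1.const_mul κ), integral_add ((B i).2.1.const_mul σ) ((D i).2.1.const_mul κ),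
    integral_const_mul, integral_const_mul, integral_const_mul, integral_const_mul, (A i).2.2, (D i).2.2, ← neg_eq_iff_eq_neg.2 (B i).2.2]
  ring

lemma lapl_mul {d : ℕ} {f g : EE d → ℝ} (hf : ContDiff ℝ 2 f) (hg : ContDiff ℝ 2 g) (x : EE d) :
    |lapl (fun y => f y * g y) x - lapl f x * g x| ≤ |f x| * |lapl g x| + 2 * d * (‖fderiv ℝ f x‖ * ‖fderiv ℝ g x‖) := by
  have df : ∀ y, DifferentiableAt ℝ f y := hf.differentiable (by simp)
  have dg : ∀ y, DifferentiableAt ℝ g y := hg.differentiable (by simp)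
  have e0 : ∀ i : Fin d, Differentiable ℝ (fun y => fderiv ℝ f y (EuclideanSpace.single i 1)) := fun i =>
    ((hf.fderiv_right (m := 1) (by norm_num)).clm_apply contDiff_const).differentiable (by simp)
  have e1 : ∀ i : Fin d, Differentiable ℝ (fun y => fderiv ℝ g y (EuclideanSpace.single i 1)) := fun i =>
    ((hg.fderiv_right (m := 1) (by norm_num)).clm_apply contDiff_const).differentiable (by simp)
  have key : lapl (fun y => f y * g y) x = lapl f x * g x + f x * lapl g x +
      ∑ i : Fin d, 2 * (fderiv ℝ f x (EuclideanSpace.single i 1) * fderiv ℝ g x (EuclideanSpace.single i 1)) := by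
    unfold lapl
    rw [Finset.sum_mul, Finset.mul_sum, ← Finset.sum_add_distrib, ← Finset.sum_add_distrib]
    refine Finset.sum_congr rfl fun i _ => ?_
    have : (fun y => fderiv ℝ (fun y => f y * g y) y (EuclideanSpace.single i 1)) =
      fun y => f y * fderiv ℝ g y (EuclideanSpace.single i 1) + g y * fderiv ℝ f y (EuclideanSpace.single i 1) := by
      funext y
      rw [fderiv_fun_mul (df y) (dg y)]; simp
    rw [this, fderiv_fun_add ((df x).fun_mul (e1 i x)) ((dg x).fun_mul (e0 i x)), fderiv_fun_mul (df x) (e1 i x), fderiv_fun_mul (dg x) (e0 i x)]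
    simp; ring
  rw [key]
  have hs : |∑ i : Fin d, 2 * (fderiv ℝ f x (EuclideanSpace.single i 1) * fderiv ℝ g x (EuclideanSpace.single i 1))| ≤
      2 * d * (‖fderiv ℝ f x‖ * ‖fderiv ℝ g x‖) := by
    refine (Finset.abs_sum_le_sum_abs _ _).trans ?_
    calc _ ≤ ∑ i : Fin d, 2 * (‖fderiv ℝ f x‖ * ‖fderiv ℝ g x‖) := by
          refine Finset.sum_le_sum fun i _ => ?_
          rw [abs_mul, abs_mul, abs_two]
          have a1 := (fderiv ℝ f x).le_opNorm (EuclideanSpace.single i 1)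
          have a2 := (fderiv ℝ g x).le_opNorm (EuclideanSpace.single i 1)
          simp at a1 a2
          gcongr
      _ = _ := by simp; ring
  rw [show lapl f x * g x + f x * lapl g x + ∑ i : Fin d, 2 * (fderiv ℝ f x (EuclideanSpace.single i 1) * fderiv ℝ g x (EuclideanSpace.single i 1)) - lapl f x * g x
    = f x * lapl g x + ∑ i : Fin d, 2 * (fderiv ℝ f x (EuclideanSpace.single i 1) * fderiv ℝ g x (EuclideanSpace.single i 1)) by ring]
  refine (abs_add_le _ _).trans ?_
  rw [abs_mul]
  gcongr

lemma lapl_shift {d : ℕ} (f : EE d → ℝ) (a x : EE d) : lapl (fun y => f (y - a)) x = lapl f (x - a) := by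
  unfold lapl
  refine Finset.sum_congr rfl fun i _ => ?_
  simp only [fderiv_comp_sub]
  rw [fderiv_comp_sub (f := fun y => fderiv ℝ f y (EuclideanSpace.single i 1))]

lemma gk_le' {d : ℕ} {r s : ℝ} (hr : 0 < r) (hs : r ≤ s) (x : EE d) : gk d s x ≤ (4 * Real.pi * r) ^ (-(d : ℝ) / 2) := by
  refine (gk_le (hr.trans_le hs) x).trans ?_
  refine Real.rpow_le_rpow_of_nonpos (by positivity) (by gcongr) ?_
  have : (0:ℝ) ≤ d := by positivity
  linarith

lemma gk_fderiv_le' {d : ℕ} {r s : ℝ} (hr : 0 < r) (hs : r ≤ s) (x : EE d) :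
    ‖fderiv ℝ (gk d s) x‖ ≤ (2:ℝ) ^ ((d : ℝ) / 2) * r ^ (-(1:ℝ)/2) * (4 * Real.pi * r) ^ (-(d : ℝ) / 2) := by
  refine (gk_fderiv_le (hr.trans_le hs) x).trans ?_
  have := gk_pos (d := d) (by linarith : 0 < 2 * s) x
  gcongr ?_ * ?_ * ?_
  · exact Real.rpow_le_rpow_of_nonpos hr hs (by norm_num)
  · exact gk_le' hr (by linarith) x

lemma mild_space {d : ℕ} {σ κ r τ c C R : ℝ} (hσ : 0 < σ) (hκ : |κ| = 1) (hr : 0 < r) (hτ : r ≤ τ) (hR : 1 ≤ R) (hC : 0 < C)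
    {f : EE d → ℝ} {F : EE d → EE d} {φ : EE d → ℝ} (hf2 : ContDiff ℝ 2 f) (hF1 : ContDiff ℝ 1 F)
    (hfi : Integrable f) (hfm : ∫ y, |f y| ≤ c) (hFi : Integrable (fun y => ‖F y‖)) (hFm : ∫ y, ‖F y‖ ≤ c)
    (hφ : ContDiff ℝ (⊤:ℕ∞) φ) (hφc : HasCompactSupport φ) (h0 : ∀ x, 0 ≤ φ x) (h1 : ∀ x, φ x ≤ 1)
    (hφ1 : ∀ x, ‖fderiv ℝ φ x‖ ≤ C / R) (hφ2 : ∀ x, |lapl φ x| ≤ C / R) (x : EE d) :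
    |∫ y, ((σ * lapl f y - κ * diverg F y) * (gk d τ (y - x) * φ y) + f y * (-σ * lapl (gk d τ) (y - x) * φ y))| ≤
      (c * C * (σ * ((4 * Real.pi * r) ^ (-(d : ℝ) / 2) + 2 * d * ((2:ℝ) ^ ((d : ℝ) / 2) * r ^ (-(1:ℝ)/2) * (4 * Real.pi * r) ^ (-(d : ℝ) / 2))) + (4 * Real.pi * r) ^ (-(d : ℝ) / 2))) / R
      + (2:ℝ) ^ ((d : ℝ) / 2) * τ ^ (-(1:ℝ)/2) * ∫ y, ‖F y‖ * gk d (2 * τ) (x - y) := by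
  have hτ0 : 0 < τ := hr.trans_le hτ
  set g0 := (4 * Real.pi * r) ^ (-(d : ℝ) / 2) with hg0
  set g1 := (2:ℝ) ^ ((d : ℝ) / 2) * r ^ (-(1:ℝ)/2) * g0 with hg1
  have g0p : 0 < g0 := by positivity
  have g1p : 0 < g1 := by positivity
  have hΘ0 : ContDiff ℝ 2 (fun y => gk d τ (y - x)) := ((gk_contDiff (d := d) τ).of_le two_le_top').comp (by fun_prop)
  have hφ' : ContDiff ℝ 2 φ := hφ.of_le two_le_top'
  have hΘ : ContDiff ℝ 2 (fun y => gk d τ (y - x) * φ y) := hΘ0.mul hφ'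
  have hΘc : HasCompactSupport (fun y => gk d τ (y - x) * φ y) := hφc.mul_left
  have cl : Continuous (lapl (gk d τ)) := lapl_continuous ((gk_contDiff (d := d) τ).of_le two_le_top')
  have i1 : Integrable (fun y => (σ * lapl f y - κ * diverg F y) * (gk d τ (y - x) * φ y)) := by
    refine Continuous.integrable_of_hasCompactSupport ?_ hΘc.mul_left
    have := lapl_continuous hf2
    have := diverg_continuous hF1
    have := hΘ.continuous
    fun_prop
  have i2 : Integrable (fun y => f y * (-σ * lapl (gk d τ) (y - x) * φ y)) := by
    refine Continuous.integrable_of_hasCompactSupport ?_ (HasCompactSupport.mul_left (hφc.mul_left))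
    have := hf2.continuous
    have := hφ.continuous
    fun_prop
  have dΘc : Continuous (fun y => fderiv ℝ (fun y => gk d τ (y - x) * φ y) y (F y)) :=
    (hΘ.continuous_fderiv (by simp)).clm_apply hF1.continuous
  have i3 : Integrable (fun y => (σ * (f y * lapl (fun y => gk d τ (y - x) * φ y) y) + κ * fderiv ℝ (fun y => gk d τ (y - x) * φ y) y (F y))) := by
    refine Continuous.integrable_of_hasCompactSupport ?_ ?_
    · have := lapl_continuous hΘ
      have := hf2.continuous
      fun_prop
    · refine HasCompactSupport.intro hΘc ?_
      intro y hy
      have ev : (fun y => gk d τ (y - x) * φ y) =ᶠ[𝓝 y] fun _ => 0 := by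
        filter_upwards [(isClosed_tsupport _).isOpen_compl.mem_nhds hy] with z hz
        exact image_eq_zero_of_notMem_tsupport (f := fun y => gk d τ (y - x) * φ y) hz
      have e2 : lapl (fun y => gk d τ (y - x) * φ y) y = 0 := by
        unfold lapl
        refine Finset.sum_eq_zero fun i _ => ?_
        have : (fun y => fderiv ℝ (fun y => gk d τ (y - x) * φ y) y (EuclideanSpace.single i 1)) =ᶠ[𝓝 y] fun _ => 0 := by
          filter_upwards [ev.eventuallyEq_nhds] with z hz
          rw [hz.fderiv_eq]; simp
        rw [this.fderiv_eq]; simp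
      rw [e2, ev.fderiv_eq]; simp
  rw [integral_add i1 i2, weak σ κ hf2 hF1 hΘ hΘc, ← integral_add i3 i2]
  have i4 : Integrable (fun y => ‖F y‖ * gk d (2 * τ) (x - y)) := by
    have := gc_integrable (by linarith : 0 < 2 * τ) hFi x
    simpa only [mul_comm] using this
  have i5 : Integrable (fun y => |f y|) := hfi.abs
  have hb : ∀ y, |σ * (f y * lapl (fun y => gk d τ (y - x) * φ y) y) + κ * fderiv ℝ (fun y => gk d τ (y - x) * φ y) y (F y) + f y * (-σ * lapl (gk d τ) (y - x) * φ y)| ≤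
      σ * (g0 + 2 * d * g1) * (C / R) * |f y| + g0 * (C / R) * ‖F y‖ + (2:ℝ) ^ ((d : ℝ) / 2) * τ ^ (-(1:ℝ)/2) * (‖F y‖ * gk d (2 * τ) (x - y)) := by
    intro y
    have q0 : gk d τ (y - x) ≤ g0 := gk_le' hr hτ _
    have q0' := (gk_pos hτ0 (y - x))
    have q1 : ‖fderiv ℝ (gk d τ) (y - x)‖ ≤ g1 := gk_fderiv_le' hr hτ _
    have q2 := gk_fderiv_le hτ0 (y - x)
    rw [gk_sub_comm] at q2
    have lm := lapl_mul hΘ0 hφ' y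
    rw [lapl_shift, fderiv_comp_sub] at lm
    have lm' : |lapl (fun y => gk d τ (y - x) * φ y) y - lapl (gk d τ) (y - x) * φ y| ≤ (g0 + 2 * d * g1) * (C / R) := by
      refine lm.trans ?_
      rw [abs_of_pos q0', add_mul, mul_assoc (2 * (d:ℝ))]
      gcongr
      · exact hφ2 y
      · exact hφ1 y
    have df : fderiv ℝ (fun y => gk d τ (y - x) * φ y) y = gk d τ (y - x) • fderiv ℝ φ y + φ y • fderiv ℝ (gk d τ) (y - x) := by
      rw [fderiv_fun_mul (hΘ0.differentiable (by simp) y) (hφ'.differentiable (by simp) y), fderiv_comp_sub]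
    have e1 : |fderiv ℝ (fun y => gk d τ (y - x) * φ y) y (F y)| ≤ (g0 * (C / R) + (2:ℝ) ^ ((d : ℝ) / 2) * τ ^ (-(1:ℝ)/2) * gk d (2 * τ) (x - y)) * ‖F y‖ := by
      rw [← Real.norm_eq_abs]
      refine (ContinuousLinearMap.le_opNorm _ _).trans ?_
      gcongr
      rw [df]
      refine (norm_add_le _ _).trans ?_
      rw [norm_smul, norm_smul, Real.norm_of_nonneg q0'.le, Real.norm_of_nonneg (h0 y)]
      refine add_le_add (mul_le_mul q0 (hφ1 y) (norm_nonneg _) g0p.le) ?_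
      calc φ y * ‖fderiv ℝ (gk d τ) (y - x)‖ ≤ 1 * ‖fderiv ℝ (gk d τ) (y - x)‖ := by gcongr; exact h1 y
        _ ≤ _ := by rw [one_mul]; exact q2
    have e2 : σ * (f y * lapl (fun y => gk d τ (y - x) * φ y) y) + κ * fderiv ℝ (fun y => gk d τ (y - x) * φ y) y (F y) + f y * (-σ * lapl (gk d τ) (y - x) * φ y) =
      σ * (f y * (lapl (fun y => gk d τ (y - x) * φ y) y - lapl (gk d τ) (y - x) * φ y)) + κ * fderiv ℝ (fun y => gk d τ (y - x) * φ y) y (F y) := by ring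
    rw [e2]
    refine (abs_add_le _ _).trans ?_
    rw [abs_mul, abs_mul, abs_mul κ, hκ, one_mul, abs_of_pos hσ]
    have := mul_le_mul_of_nonneg_left lm' (abs_nonneg (f y))
    have := mul_le_mul_of_nonneg_left this hσ.le
    linarith
  rw [← Real.norm_eq_abs]
  refine (norm_integral_le_of_norm_le (g := fun y => σ * (g0 + 2 * d * g1) * (C / R) * |f y| + g0 * (C / R) * ‖F y‖ + (2:ℝ) ^ ((d : ℝ) / 2) * τ ^ (-(1:ℝ)/2) * (‖F y‖ * gk d (2 * τ) (x - y)))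
     (((i5.const_mul _).add (hFi.const_mul _)).add (i4.const_mul _)) (ae_of_all _ hb)).trans ?_
  rw [integral_add (f := fun y => σ * (g0 + 2 * d * g1) * (C / R) * |f y| + g0 * (C / R) * ‖F y‖) ((i5.const_mul _).add (hFi.const_mul _)) (i4.const_mul _), integral_add (i5.const_mul _) (hFi.const_mul _), integral_const_mul, integral_const_mul, integral_const_mul]
  have hR0 : 0 < R := by linarith
  have a1 := mul_le_mul_of_nonneg_left hfm (by positivity : 0 ≤ σ * (g0 + 2 * d * g1) * (C / R))
  have a2 := mul_le_mul_of_nonneg_left hFm (by positivity : 0 ≤ g0 * (C / R))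
  have : (c * C * (σ * (g0 + 2 * d * g1) + g0)) / R = σ * (g0 + 2 * d * g1) * (C / R) * c + g0 * (C / R) * c := by
    field_simp
  rw [this]; linarith

lemma deriv_cont {d : ℕ} {T : ℝ} {u D : ℝ → EE d → ℝ}
    (hs : ContDiffOn ℝ (⊤ : ℕ∞) (fun p : ℝ × EE d => u p.1 p.2) (Icc 0 T ×ˢ univ))
    (hD : ∀ t ∈ Ioo (0:ℝ) T, ∀ x, HasDerivAt (fun s => u s x) (D t x) t) :
    ContinuousOn (fun p : ℝ × EE d => D p.1 p.2) (Ioo 0 T ×ˢ univ) := by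
  have ho : IsOpen (Ioo (0:ℝ) T ×ˢ (univ : Set (EE d))) := isOpen_Ioo.prod isOpen_univ
  have hs' := hs.mono (prod_mono (Ioo_subset_Icc_self) (subset_univ univ))
  have hc := hs'.continuousOn_fderiv_of_isOpen ho (by simp)
  have hc2 : ContinuousOn (fun p : ℝ × EE d => fderiv ℝ (fun p : ℝ × EE d => u p.1 p.2) p ((1:ℝ), (0 : EE d))) (Ioo 0 T ×ˢ univ) :=
    hc.clm_apply continuousOn_const
  refine hc2.congr ?_
  rintro ⟨t, x⟩ hp
  have h1 : HasFDerivAt (fun p : ℝ × EE d => u p.1 p.2) (fderiv ℝ (fun p : ℝ × EE d => u p.1 p.2) (t, x)) (t, x) :=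
    ((hs'.contDiffAt (ho.mem_nhds hp)).differentiableAt (by simp)).hasFDerivAt
  have h2 : HasDerivAt (fun s : ℝ => (s, x)) ((1:ℝ), (0 : EE d)) t := (hasDerivAt_id t).prodMk (hasDerivAt_const t x)
  have h3 := h1.comp_hasDerivAt t h2
  exact (hD t hp.1 x).unique h3

lemma mild {d : ℕ} {σ κ r c t0 t : ℝ} (hσ : 0 < σ) (hκ : |κ| = 1) (hr : 0 < r) (ht : t0 ≤ t)
    {f : ℝ → EE d → ℝ} {F : ℝ → EE d → EE d}
    (hfc : ContinuousOn (fun p : ℝ × EE d => f p.1 p.2) (Icc t0 t ×ˢ univ))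
    (hf2 : ∀ s ∈ Ioo t0 t, ContDiff ℝ 2 (f s)) (hF1 : ∀ s ∈ Ioo t0 t, ContDiff ℝ 1 (F s))
    (heq : ∀ s ∈ Ioo t0 t, ∀ x, HasDerivAt (fun s => f s x) (σ * lapl (f s) x - κ * diverg (F s) x) s)
    (hDc : ContinuousOn (fun p : ℝ × EE d => σ * lapl (f p.1) p.2 - κ * diverg (F p.1) p.2) (Ioo t0 t ×ˢ univ))
    (hfi : ∀ s ∈ Icc t0 t, Integrable (f s)) (hfm : ∀ s ∈ Icc t0 t, ∫ y, |f s y| ≤ c)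
    (hFi : ∀ s ∈ Ioo t0 t, Integrable (fun y => ‖F s y‖)) (hFm : ∀ s ∈ Ioo t0 t, ∫ y, ‖F s y‖ ≤ c)
    {H h : ℝ → ℝ} (hHc : ContinuousOn H (Icc t0 t)) (hH : ∀ s ∈ Ioo t0 t, HasDerivAt H (h s) s) (x : EE d)
    (hh : ∀ s ∈ Ioo t0 t, (2:ℝ) ^ ((d : ℝ) / 2) * (r + σ * (t - s)) ^ (-(1:ℝ)/2) * ∫ y, ‖F s y‖ * gk d (2 * (r + σ * (t - s))) (x - y) ≤ h s) :
    |gc d r (f t) x - gc d (r + σ * (t - t0)) (f t0) x| ≤ H t - H t0 := by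
  obtain ⟨C, hC, hcut⟩ := cutoff d
  set K := c * C * (σ * ((4 * Real.pi * r) ^ (-(d : ℝ) / 2) + 2 * d * ((2:ℝ) ^ ((d : ℝ) / 2) * r ^ (-(1:ℝ)/2) * (4 * Real.pi * r) ^ (-(d : ℝ) / 2))) + (4 * Real.pi * r) ^ (-(d : ℝ) / 2)) with hK
  have hR1 : ∀ n : ℕ, (1:ℝ) ≤ (n:ℝ) + 1 := fun n => by have : (0:ℝ) ≤ n := by positivity
                                                       linarith
  choose φ p1 p2 p3 p4 p5 p6 p7 using fun n : ℕ => hcut (n + 1) (hR1 n)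
  have hτ : ∀ s ∈ Icc t0 t, r ≤ r + σ * (t - s) := fun s hs => by nlinarith [hs.2]
  have hmap : MapsTo (fun p : ℝ × EE d => (r + σ * (t - p.1), p.2 - x)) (Icc t0 t ×ˢ univ) (Ioi 0 ×ˢ univ) := by
    rintro ⟨s, y⟩ hp
    exact ⟨hr.trans_le (hτ s hp.1), mem_univ _⟩
  have hgc : ContinuousOn (fun p : ℝ × EE d => gk d (r + σ * (t - p.1)) (p.2 - x)) (Icc t0 t ×ˢ univ) :=
    gk_joint_continuousOn.comp (f := fun p : ℝ × EE d => (r + σ * (t - p.1), p.2 - x)) (by fun_prop) hmap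
  have hlc : ContinuousOn (fun p : ℝ × EE d => lapl (gk d (r + σ * (t - p.1))) (p.2 - x)) (Icc t0 t ×ˢ univ) := by
    have : ContinuousOn (fun p : ℝ × EE d => gk d (r + σ * (t - p.1)) (p.2 - x) * (‖p.2 - x‖ ^ 2 / (4 * (r + σ * (t - p.1)) ^ 2) - d / (2 * (r + σ * (t - p.1))))) (Icc t0 t ×ˢ univ) := by
      refine hgc.mul (ContinuousOn.sub (ContinuousOn.div (by fun_prop) (by fun_prop) ?_) (ContinuousOn.div (by fun_prop) (by fun_prop) ?_))
      · intro p hp; have := hr.trans_le (hτ p.1 hp.1); positivity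
      · intro p hp; have := hr.trans_le (hτ p.1 hp.1); positivity
    refine this.congr fun p hp => ?_
    exact gk_lapl (hr.trans_le (hτ p.1 hp.1)) _
  have step : ∀ n : ℕ, |(∫ y, f t y * (gk d r (y - x) * φ n y)) - ∫ y, f t0 y * (gk d (r + σ * (t - t0)) (y - x) * φ n y)| ≤ H t - H t0 + K / (n + 1) * (t - t0) := by
    intro n
    have hφc := (p1 n).continuous
    let A : ℝ → ℝ := fun s => ∫ y, f s y * (gk d (r + σ * (t - s)) (y - x) * φ n y)
    let A' : ℝ → ℝ := fun s => ∫ y, ((σ * lapl (f s) y - κ * diverg (F s) y) * (gk d (r + σ * (t - s)) (y - x) * φ n y) + f s y * (-σ * lapl (gk d (r + σ * (t - s))) (y - x) * φ n y))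
    have hGc : ContinuousOn (fun p : ℝ × EE d => f p.1 p.2 * (gk d (r + σ * (t - p.1)) (p.2 - x) * φ n p.2)) (Icc t0 t ×ˢ univ) :=
      hfc.mul (hgc.mul (by fun_prop))
    have hAc : ContinuousOn A (Icc t0 t) := by
      refine continuousOn_integral_of_compact_support (k := tsupport (φ n)) (p2 n) ?_ ?_
      · exact hGc
      · intro s y _ hy
        simp [image_eq_zero_of_notMem_tsupport hy]
    have hsub : Ioo t0 t ×ˢ (univ : Set (EE d)) ⊆ Icc t0 t ×ˢ univ := prod_mono Ioo_subset_Icc_self subset_rfl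
    have hAd : ∀ s ∈ Ioo t0 t, HasDerivAt A (A' s) s := by
      refine td (G := fun s y => f s y * (gk d (r + σ * (t - s)) (y - x) * φ n y))
        (G' := fun s y => (σ * lapl (f s) y - κ * diverg (F s) y) * (gk d (r + σ * (t - s)) (y - x) * φ n y) + f s y * (-σ * lapl (gk d (r + σ * (t - s))) (y - x) * φ n y))
        (p2 n) ?_ ?_ ?_ ?_ ?_
      · exact hGc.mono hsub
      · exact (hDc.mul ((hgc.mono hsub).mul (by fun_prop))).add ((hfc.mono hsub).mul ((continuousOn_const.mul (hlc.mono hsub)).mul (by fun_prop)))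
      · intro s _ y hy
        simp [image_eq_zero_of_notMem_tsupport hy]
      · intro s _ y hy
        simp [image_eq_zero_of_notMem_tsupport hy]
      · intro s hs y
        have h1 : HasDerivAt (fun s => r + σ * (t - s)) (-σ) s := by
          have := (((hasDerivAt_const s t).sub (hasDerivAt_id s)).const_mul σ).const_add r
          refine this.congr_deriv ?_
          simp
        have h2 := (gk_hasDerivAt (hr.trans_le (hτ s (Ioo_subset_Icc_self hs))) (y - x)).comp s h1
        have h3 := (heq s hs y).fun_mul (h2.mul_const (φ n y))
        refine h3.congr_deriv ?_
        simp only [Function.comp]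
        ring
    have hb : ∀ s ∈ Ioo t0 t, |A' s| ≤ h s + K / (n + 1) := by
      intro s hs
      have hs' := Ioo_subset_Icc_self hs
      have := mild_space hσ hκ hr (hτ s hs') (hR1 n) hC (hf2 s hs) (hF1 s hs) (hfi s hs') (hfm s hs') (hFi s hs) (hFm s hs)
        (p1 n) (p2 n) (p3 n) (p4 n) (p6 n) (p7 n) x
      exact this.trans (by rw [add_comm]; exact add_le_add_left (hh s hs) _)
    have hA0 : A t = ∫ y, f t y * (gk d r (y - x) * φ n y) := by simp [A]
    rw [← hA0]
    change |A t - A t0| ≤ _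
    have hLc : ContinuousOn (fun s => H s + K / (n + 1) * s) (Icc t0 t) := hHc.add (by fun_prop)
    have hLd : ∀ s ∈ Ioo t0 t, HasDerivAt (fun s => H s + K / (n + 1) * s) (h s + K / (n + 1)) s := by
      intro s hs
      refine ((hH s hs).add ((hasDerivAt_id s).const_mul (K / (n + 1)))).congr_deriv (by simp)
    have m1 : MonotoneOn (fun s => (H s + K / (n + 1) * s) - A s) (Icc t0 t) := by
      refine monotoneOn_of_deriv_nonneg (convex_Icc _ _) (hLc.sub hAc) ?_ ?_
      · rw [interior_Icc]; intro s hs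
        exact ((hLd s hs).sub (hAd s hs)).differentiableAt.differentiableWithinAt
      · rw [interior_Icc]; intro s hs
        rw [((hLd s hs).fun_sub (hAd s hs)).deriv]
        linarith [(abs_le.1 (hb s hs)).2]
    have m2 : MonotoneOn (fun s => (H s + K / (n + 1) * s) + A s) (Icc t0 t) := by
      refine monotoneOn_of_deriv_nonneg (convex_Icc _ _) (hLc.add hAc) ?_ ?_
      · rw [interior_Icc]; intro s hs
        exact ((hLd s hs).add (hAd s hs)).differentiableAt.differentiableWithinAt
      · rw [interior_Icc]; intro s hs
        rw [((hLd s hs).fun_add (hAd s hs)).deriv]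
        linarith [(abs_le.1 (hb s hs)).1]
    have n1 := m1 (left_mem_Icc.2 ht) (right_mem_Icc.2 ht) ht
    have n2 := m2 (left_mem_Icc.2 ht) (right_mem_Icc.2 ht) ht
    simp only at n1 n2
    rw [abs_le]; constructor <;> linarith
  have lim : ∀ s ∈ Icc t0 t, Tendsto (fun n : ℕ => ∫ y, f s y * (gk d (r + σ * (t - s)) (y - x) * φ n y)) atTop (𝓝 (gc d (r + σ * (t - s)) (f s) x)) := by
    intro s hs
    unfold gc
    have hτ0 := hr.trans_le (hτ s hs)
    have hgkc := gk_continuous (d := d) (r + σ * (t - s))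
    refine tendsto_integral_of_dominated_convergence (fun y => |f s y| * gk d (r + σ * (t - s)) (x - y)) ?_ ?_ ?_ ?_
    · intro n
      have := (p1 n).continuous
      exact (hfi s hs).aestronglyMeasurable.mul (by fun_prop : Continuous fun y => gk d (r + σ * (t - s)) (y - x) * φ n y).aestronglyMeasurable
    · have := gc_integrable hτ0 (hfi s hs).abs x
      simpa only [mul_comm] using this
    · intro n
      refine ae_of_all _ fun y => ?_
      rw [norm_mul, Real.norm_eq_abs, gk_sub_comm, norm_mul, Real.norm_of_nonneg (gk_pos hτ0 _).le, Real.norm_of_nonneg (p3 n y)]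
      have := gk_pos hτ0 (x - y)
      gcongr
      exact mul_le_of_le_one_right this.le (p4 n y)
    · refine ae_of_all _ fun y => ?_
      refine tendsto_const_nhds.congr' ?_
      obtain ⟨N, hN⟩ := exists_nat_ge ‖y‖
      filter_upwards [eventually_ge_atTop N] with n hn
      rw [p5 n y (by have : (N:ℝ) ≤ n := by exact_mod_cast hn
                     linarith), mul_one, gk_sub_comm, mul_comm]
  have l1 := lim t (right_mem_Icc.2 ht)
  simp only [sub_self, mul_zero, add_zero] at l1
  have l2 := lim t0 (left_mem_Icc.2 ht)
  have l3 : Tendsto (fun n : ℕ => H t - H t0 + K / ((n:ℝ) + 1) * (t - t0)) atTop (𝓝 (H t - H t0 + 0 * (t - t0))) :=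
    tendsto_const_nhds.add ((tendsto_const_div_atTop_nhds_zero_nat K |>.comp (tendsto_add_atTop_nat 1) |>.congr (fun n => by simp)).mul_const _)
  have := le_of_tendsto_of_tendsto' (l1.sub l2).abs l3 step
  simpa using this

def st (s : ℝ) : ℝ := Real.smoothTransition s
def jf (s : ℝ) : ℝ := ∫ x in (0:ℝ)..s, st x

lemma st_contDiff {n : ℕ∞} : ContDiff ℝ n st := Real.smoothTransition.contDiff
lemma st_continuous : Continuous st := Real.smoothTransition.continuous
lemma st_nonneg (s : ℝ) : 0 ≤ st s := Real.smoothTransition.nonneg s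
lemma st_le_one (s : ℝ) : st s ≤ 1 := Real.smoothTransition.le_one s
lemma st_zero {s : ℝ} (h : s ≤ 0) : st s = 0 := Real.smoothTransition.zero_of_nonpos h
lemma st_one {s : ℝ} (h : 1 ≤ s) : st s = 1 := Real.smoothTransition.one_of_one_le h
lemma st_mono : Monotone st := Real.smoothTransition.monotone

lemma jf_deriv (s : ℝ) : HasDerivAt jf (st s) s :=
  intervalIntegral.integral_hasDerivAt_right (st_continuous.intervalIntegrable _ _)
    (st_continuous.stronglyMeasurableAtFilter _ _) st_continuous.continuousAt

lemma jf_contDiff : ContDiff ℝ (⊤:ℕ∞) jf := by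
  rw [contDiff_infty_iff_deriv]
  refine ⟨fun s => (jf_deriv s).differentiableAt, ?_⟩
  rw [funext fun s => (jf_deriv s).deriv]
  exact st_contDiff

lemma jf_zero {s : ℝ} (h : s ≤ 0) : jf s = 0 := by
  unfold jf
  rw [intervalIntegral.integral_zero_ae]
  refine ae_of_all _ fun x hx => st_zero ?_
  rw [uIoc_of_ge h] at hx
  exact hx.2

lemma jf_mono : Monotone jf := monotone_of_deriv_nonneg (fun s => (jf_deriv s).differentiableAt)
  (fun s => by rw [(jf_deriv s).deriv]; exact st_nonneg s)

lemma jf_nonneg (s : ℝ) : 0 ≤ jf s := by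
  rcases le_total s 0 with h | h
  · rw [jf_zero h]
  · rw [← jf_zero le_rfl]; exact jf_mono h

lemma jf_lip {s t : ℝ} (h : s ≤ t) : jf t - jf s ≤ t - s := by
  have : Monotone (fun s => s - jf s) := monotone_of_deriv_nonneg (fun s => differentiableAt_id.sub (jf_deriv s).differentiableAt)
    (fun s => by rw [((hasDerivAt_id' s).fun_sub (jf_deriv s)).deriv]; linarith [st_le_one s])
  have := this h
  simp only at this; linarith

lemma jf_lip' (s t : ℝ) : |jf t - jf s| ≤ |t - s| := by
  rcases le_total s t with h | h
  · rw [abs_of_nonneg (sub_nonneg.2 (jf_mono h)), abs_of_nonneg (sub_nonneg.2 h)]; exact jf_lip h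
  · rw [abs_sub_comm, abs_sub_comm t, abs_of_nonneg (sub_nonneg.2 (jf_mono h)), abs_of_nonneg (sub_nonneg.2 h)]; exact jf_lip h

lemma jf_ge (s : ℝ) : s - 1 ≤ jf s := by
  rcases le_total s 1 with h | h
  · linarith [jf_nonneg s]
  · have hc : MonotoneOn (fun s => jf s - s) (Ici 1) := by
      refine monotoneOn_of_deriv_nonneg (convex_Ici _) (fun s _ => ((jf_deriv s).sub (hasDerivAt_id s)).continuousAt.continuousWithinAt)
        (fun s _ => ((jf_deriv s).sub (hasDerivAt_id s)).differentiableAt.differentiableWithinAt) ?_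
      intro s hs
      rw [interior_Ici] at hs
      rw [((jf_deriv s).fun_sub (hasDerivAt_id' s)).deriv, st_one (le_of_lt hs)]; simp
    have := hc (mem_Ici.2 le_rfl) (mem_Ici.2 h) h
    simp only at this
    linarith [jf_nonneg 1]

lemma jf_le_mul (s : ℝ) : jf s ≤ st s * s := by
  rcases le_total s 0 with h | h
  · rw [jf_zero h, st_zero h]; simp
  · unfold jf
    calc ∫ x in (0:ℝ)..s, st x ≤ ∫ x in (0:ℝ)..s, st s := by
          refine intervalIntegral.integral_mono_on h (st_continuous.intervalIntegrable _ _) (by simp) fun x hx => st_mono hx.2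
      _ = _ := by simp [mul_comm]

lemma jf_mul_le (s : ℝ) : st s * s - jf s ≤ st s := by
  rcases le_total s 0 with h | h
  · rw [jf_zero h, st_zero h]; simp
  · rcases le_total s 1 with h1 | h1
    · nlinarith [jf_nonneg s, st_nonneg s]
    · rw [st_one h1]; linarith [jf_ge s]

lemma jf_le_max {u k : ℝ} (hu : 0 ≤ u) (hk : 0 ≤ k) : jf (u - k) ≤ u := by
  have h1 := jf_le_mul (u - k)
  rcases le_total (u - k) 0 with h | h
  · rw [jf_zero h]; exact hu
  · have := st_le_one (u - k); have := st_nonneg (u - k); nlinarith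

lemma st_le {u k : ℝ} (hu : 0 ≤ u) (hk : 1 ≤ k) : st (u - k) ≤ u := by
  rcases le_total (u - k) 0 with h | h
  · rw [st_zero h]; exact hu
  · linarith [st_le_one (u - k)]

lemma Nice.trunc {d : ℕ} {u : EE d → ℝ} (hu : Nice u) (h0 : ∀ x, 0 ≤ u x) {k : ℝ} (hk : 0 ≤ k) : Nice (fun x => jf (u x - k)) := by
  obtain ⟨C, hC, h1, h2⟩ := hu.decay
  refine ⟨jf_contDiff.comp (hu.smooth.sub contDiff_const), C, hC, ?_, ?_⟩
  · intro x
    rw [abs_of_nonneg (jf_nonneg _)]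
    exact (jf_le_max (h0 x) hk).trans ((le_abs_self _).trans (h1 x))
  · intro x
    have hd : HasFDerivAt (fun x => u x - k) (fderiv ℝ u x) x := ((hu.smooth.differentiable (by simp)) x).hasFDerivAt.sub_const k
    have := (jf_deriv (u x - k)).comp_hasFDerivAt x hd
    have e : fderiv ℝ (fun x => jf (u x - k)) x = st (u x - k) • fderiv ℝ u x := this.fderiv
    rw [e, norm_smul, Real.norm_of_nonneg (st_nonneg _)]
    exact (mul_le_of_le_one_left (norm_nonneg _) (st_le_one _)).trans (h2 x)

lemma Nice.sub {d : ℕ} {u v : EE d → ℝ} (hu : Nice u) (hv : Nice v) : Nice (fun x => u x - v x) := by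
  obtain ⟨C, hC, h1, h2⟩ := hu.decay
  obtain ⟨C', hC', h1', h2'⟩ := hv.decay
  refine ⟨hu.smooth.sub hv.smooth, C + C', by positivity, ?_, ?_⟩
  · intro x
    have := abs_sub (u x) (v x)
    linarith [h1 x, h1' x]
  · intro x
    rw [fderiv_fun_sub (hu.smooth.differentiable (by simp) x) (hv.smooth.differentiable (by simp) x)]
    have := norm_sub_le (fderiv ℝ u x) (fderiv ℝ v x)
    linarith [h2 x, h2' x]

lemma trunc_pt {d : ℕ} {u : EE d → ℝ} {b : EE d → EE d} {σ κ k L : ℝ} (hσ : 0 < σ) (hκ : |κ| = 1) (hk : 0 ≤ k) (hu : ContDiff ℝ (⊤:ℕ∞) u)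
    (hb : ContDiff ℝ 1 b) (h0 : ∀ x, 0 ≤ u x) (x : EE d) :
    st (u x - k) * (σ * lapl u x - κ * diverg (fun z => u z • b z) x - L) ≤
     (σ * lapl (fun z => jf (u z - k)) x - κ * diverg (fun z => jf (u z - k) • b z) x) + st (u x - k) * ((k + 1) * |diverg b x| - L) := by
  have hd : ∀ x, HasFDerivAt (fun x => u x - k) (fderiv ℝ u x) x := fun x => ((hu.differentiable (by simp)) x).hasFDerivAt.sub_const k
  have hg : ∀ x, HasFDerivAt (fun x => jf (u x - k)) (st (u x - k) • fderiv ℝ u x) x := fun x => by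
    have := (jf_deriv (u x - k)).comp_hasFDerivAt x (hd x); exact this
  have hst : ∀ x, HasFDerivAt (fun x => st (u x - k)) (deriv st (u x - k) • fderiv ℝ u x) x := fun x => by
    have := (((st_contDiff (n := 1)).differentiable (by simp)) (u x - k)).hasDerivAt.comp_hasFDerivAt x (hd x)
    exact this
  have hst0 : 0 ≤ deriv st (u x - k) := st_mono.deriv_nonneg
  have hbi : ∀ i : Fin d, DifferentiableAt ℝ (fun y => b y i) x := fun i => by
    have : ContDiff ℝ 1 (fun y => b y i) := by fun_prop
    exact this.differentiable (by simp) x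
  have e1 : lapl (fun z => jf (u z - k)) x = st (u x - k) * lapl u x + ∑ i : Fin d, deriv st (u x - k) * (fderiv ℝ u x (EuclideanSpace.single i 1)) ^ 2 := by
    unfold lapl
    rw [Finset.mul_sum, ← Finset.sum_add_distrib]
    refine Finset.sum_congr rfl fun i _ => ?_
    have : (fun y => fderiv ℝ (fun z => jf (u z - k)) y (EuclideanSpace.single i 1)) = fun y => st (u y - k) * fderiv ℝ u y (EuclideanSpace.single i 1) := by
      funext y; rw [(hg y).fderiv]; rfl
    have h2 : DifferentiableAt ℝ (fun y => fderiv ℝ u y (EuclideanSpace.single i 1)) x :=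
      (((hu.of_le two_le_top').fderiv_right (m := 1) (by norm_num)).clm_apply contDiff_const).differentiable (by simp) x
    rw [this, fderiv_fun_mul (hst x).differentiableAt h2, (hst x).fderiv]
    simp; ring
  have dv : ∀ (f : EE d → ℝ) (f' : EE d →L[ℝ] ℝ), HasFDerivAt f f' x → diverg (fun z => f z • b z) x = f x * diverg b x + ∑ i : Fin d, b x i * f' (EuclideanSpace.single i 1) := by
    intro f f' hf
    unfold diverg
    rw [Finset.mul_sum, ← Finset.sum_add_distrib]
    refine Finset.sum_congr rfl fun i _ => ?_
    have : (fun y => (f y • b y) i) = fun y => f y * b y i := by funext y; simp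
    rw [this, fderiv_fun_mul hf.differentiableAt (hbi i), hf.fderiv]
    simp
  rw [e1, dv _ _ (hg x), dv u _ ((hu.differentiable (by simp)) x).hasFDerivAt]
  have s1 : ∑ i : Fin d, b x i * (st (u x - k) • fderiv ℝ u x) (EuclideanSpace.single i 1) = st (u x - k) * ∑ i : Fin d, b x i * fderiv ℝ u x (EuclideanSpace.single i 1) := by
    rw [Finset.mul_sum]; refine Finset.sum_congr rfl fun i _ => ?_
    simp; ring
  rw [s1]
  have s2 : 0 ≤ ∑ i : Fin d, deriv st (u x - k) * (fderiv ℝ u x (EuclideanSpace.single i 1)) ^ 2 := Finset.sum_nonneg fun i _ => by positivity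
  have a1 := jf_mul_le (u x - k)
  have a2 := jf_le_mul (u x - k)
  have a3 := st_nonneg (u x - k)
  have key : -κ * ((st (u x - k) * u x - jf (u x - k)) * diverg b x) ≤ st (u x - k) * ((k + 1) * |diverg b x|) := by
    refine (le_abs_self _).trans ?_
    rw [abs_mul, abs_neg, hκ, one_mul, abs_mul, ← mul_assoc]
    gcongr
    rw [abs_le]; constructor <;> nlinarith
  have := mul_nonneg hσ.le s2
  linarith

lemma pair {d : ℕ} {β : ℝ} (hβ : 0 < β) (hβd : β < d) : ∃ C : ℝ, 0 < C ∧ ∀ (ν : Measure (EE d)) [IsProbabilityMeasure ν] (A q : EE d → ℝ),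
    Continuous A → (∀ x, 0 ≤ A x) → (∀ x, A x ≤ 1) → Integrable A → (∫ x, A x) ≤ 1 → Nice q → (∀ x, 0 ≤ q x) →
    ∫ x, A x * ∫ z, IR β q (x - z) ∂ν ≤ C * ∫ x, q x := by
  obtain ⟨C, hC, h⟩ := riesz_1inf d β hβ hβd
  refine ⟨2 * C, by positivity, fun ν _ A q hAc hA0 hA1 hAi hAm hq hq0 => ?_⟩
  have hqc := hq.continuous
  have hIc := IR_continuous hβ hβd hq
  have hIn := IR_nonneg β q
  have hn : ∀ x, 0 ≤ A x * ∫ z, IR β q (x - z) ∂ν := fun x => mul_nonneg (hA0 x) (integral_nonneg fun z => hIn _)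
  have hmeas : AEStronglyMeasurable (fun x => A x * ∫ z, IR β q (x - z) ∂ν) volume := by
    refine hAc.aestronglyMeasurable.mul ?_
    exact (StronglyMeasurable.integral_prod_right' (f := fun p : EE d × EE d => IR β q (p.1 - p.2)) (by
      have : Continuous fun p : EE d × EE d => IR β q (p.1 - p.2) := by fun_prop
      exact this.stronglyMeasurable)).aestronglyMeasurable
  rw [integral_eq_lintegral_of_nonneg_ae (ae_of_all _ hn) hmeas]
  have hq1 : 0 ≤ ∫ x, q x := integral_nonneg hq0
  refine ENNReal.toReal_le_of_le_ofReal (by positivity) ?_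
  have toI : ∀ {α : Type} [MeasurableSpace α] (μ : Measure α) (f : α → ℝ), (∀ a, 0 ≤ f a) → ENNReal.ofReal (∫ a, f a ∂μ) ≤ ∫⁻ a, ENNReal.ofReal (f a) ∂μ := by
    intro α _ μ f hf
    by_cases hi : Integrable f μ
    · rw [ofReal_integral_eq_lintegral_ofReal hi (ae_of_all _ hf)]
    · rw [integral_undef hi]; simp
  have b1 : ∀ x, ENNReal.ofReal (A x * ∫ z, IR β q (x - z) ∂ν) ≤ ∫⁻ z, (∫⁻ y, ENNReal.ofReal (A x) * (ENNReal.ofReal (‖(x - z) - y‖ ^ (-β)) * ENNReal.ofReal (q y))) ∂ν := by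
    intro x
    rw [ENNReal.ofReal_mul (hA0 x)]
    have : ∀ z, ∫⁻ y, ENNReal.ofReal (A x) * (ENNReal.ofReal (‖(x - z) - y‖ ^ (-β)) * ENNReal.ofReal (q y)) = ENNReal.ofReal (A x) * ∫⁻ y, (ENNReal.ofReal (‖(x - z) - y‖ ^ (-β)) * ENNReal.ofReal (q y)) := by
      intro z; rw [lintegral_const_mul _ (by fun_prop)]
    simp_rw [this]
    rw [lintegral_const_mul' _ _ ENNReal.ofReal_ne_top]
    gcongr
    refine (toI ν _ (fun z => hIn _)).trans ?_
    refine lintegral_mono fun z => ?_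
    unfold IR
    refine (toI volume _ (fun y => by positivity)).trans (le_of_eq ?_)
    refine lintegral_congr fun y => ?_
    rw [abs_of_nonneg (hq0 y), ENNReal.ofReal_mul (by positivity)]
  refine (lintegral_mono b1).trans ?_
  rw [lintegral_lintegral_swap (by
    refine Measurable.aemeasurable ?_
    refine Measurable.lintegral_prod_right' (f := fun p : (EE d × EE d) × EE d => ENNReal.ofReal (A p.1.1) * (ENNReal.ofReal (‖(p.1.1 - p.1.2) - p.2‖ ^ (-β)) * ENNReal.ofReal (q p.2))) ?_
    fun_prop)]
  have b2 : ∀ z, ∫⁻ x, ∫⁻ y, ENNReal.ofReal (A x) * (ENNReal.ofReal (‖(x - z) - y‖ ^ (-β)) * ENNReal.ofReal (q y)) ≤ ENNReal.ofReal (2 * C * ∫ x, q x) := by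
    intro z
    rw [lintegral_lintegral_swap (by
      refine Measurable.aemeasurable ?_
      unfold Function.uncurry; fun_prop)]
    have hy : ∀ y, ∫⁻ x, ENNReal.ofReal (A x) * (ENNReal.ofReal (‖(x - z) - y‖ ^ (-β)) * ENNReal.ofReal (q y)) ≤ ENNReal.ofReal (2 * C) * ENNReal.ofReal (q y) := by
      intro y
      have := h (fun x => ENNReal.ofReal (A x)) 1 1 (by fun_prop) (fun x => by rw [← ENNReal.ofReal_one]; exact ENNReal.ofReal_le_ofReal (hA1 x))
        (by rw [← ofReal_integral_eq_lintegral_ofReal hAi (ae_of_all _ hA0), ← ENNReal.ofReal_one]; exact ENNReal.ofReal_le_ofReal hAm) (z + y)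
      have e : ∫⁻ x, ENNReal.ofReal (A x) * (ENNReal.ofReal (‖(x - z) - y‖ ^ (-β)) * ENNReal.ofReal (q y)) = RI d β (fun x => ENNReal.ofReal (A x)) (z + y) * ENNReal.ofReal (q y) := by
        unfold RI
        rw [← lintegral_mul_const _ (by fun_prop)]
        refine lintegral_congr fun x => ?_
        rw [show x - z - y = -(z + y - x) by abel, norm_neg]; ring
      rw [e]
      gcongr
      refine this.trans (le_of_eq ?_)
      rw [show (1:ENNReal) + 1 = ENNReal.ofReal 2 by norm_num, ← ENNReal.ofReal_mul hC.le, mul_comm]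
    refine (lintegral_mono hy).trans (le_of_eq ?_)
    rw [lintegral_const_mul _ (by fun_prop), ← ofReal_integral_eq_lintegral_ofReal hq.integrable (ae_of_all _ hq0), ← ENNReal.ofReal_mul (by positivity)]
  refine (lintegral_mono b2).trans (le_of_eq ?_)
  simp

lemma IR_split {d : ℕ} {β : ℝ} (hβ : 0 < β) (hβd : β < d) {f g : EE d → ℝ} (hf : Nice f) (hg : Nice g) (x : EE d) :
    IR β f x ≤ IR β (fun y => f y - g y) x + IR β g x := by
  obtain ⟨C, hC, h⟩ := riesz_real d β hβ hβd
  have hi : ∀ {q : EE d → ℝ}, Nice q → Integrable (fun y => ‖x - y‖ ^ (-β) * |q y|) := by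
    intro q hq
    obtain ⟨L, -, hL⟩ := hq.bdd
    have := (h q L hq.integrable hq.continuous.measurable hL x).1.abs
    refine this.congr (ae_of_all _ fun y => ?_)
    simp only [Pi.abs_apply, abs_mul]
    rw [abs_of_nonneg (a := ‖x - y‖ ^ (-β)) (by positivity)]
  unfold IR
  rw [← integral_add (by exact hi (hf.sub hg)) (by exact hi hg)]
  refine integral_mono (hi hf) ((hi (hf.sub hg)).add (hi hg)) fun y => ?_
  simp only [Pi.add_apply]
  rw [← mul_add]
  gcongr
  have := abs_add_le (f y - g y) (g y)
  simpa using this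

lemma IR_avg_int {d : ℕ} {β : ℝ} (hβ : 0 < β) (hβd : β < d) {f : EE d → ℝ} (hf : Nice f) (ν : Measure (EE d)) [IsProbabilityMeasure ν] :
    (∀ x, Integrable (fun z => IR β f (x - z)) ν) ∧ ∃ B, ∀ x, |∫ z, IR β f (x - z) ∂ν| ≤ B := by
  obtain ⟨L, -, hL⟩ := hf.bdd
  obtain ⟨C1, -, h1⟩ := IR_bdd (d := d) hβ hβd
  have hc := IR_continuous hβ hβd hf
  have hb : ∀ x, ‖IR β f x‖ ≤ C1 * ((∫ y, |f y|) + L) := fun x => by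
    rw [Real.norm_of_nonneg (IR_nonneg β f x)]; exact h1 f L hf hL x
  refine ⟨fun x => ?_, C1 * ((∫ y, |f y|) + L), fun x => ?_⟩
  · refine Integrable.of_bound (C := C1 * ((∫ y, |f y|) + L)) ?_ (ae_of_all _ fun z => hb _)
    exact (hc.comp (continuous_const.sub continuous_id)).aestronglyMeasurable
  · have := norm_integral_le_of_norm_le_const (μ := ν) (f := fun z => IR β f (x - z)) (ae_of_all _ fun z => hb (x - z))
    simpa using this

lemma trunc_space {d : ℕ} {lam : ℝ} (hl : 0 < lam) (hld : lam + 2 < d) : ∃ D : ℝ, 0 < D ∧ ∀ (ν : Measure (EE d)) [IsProbabilityMeasure ν]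
    (k L σ κ δ B : ℝ) (u φ : EE d → ℝ), 1 ≤ k → D * (k + 1) * (k + 2) ≤ L → 0 < σ → |κ| = 1 → 0 ≤ δ → Nice u → (∀ x, 0 ≤ u x) → (∫ x, u x) = 1 →
    ContDiff ℝ (⊤:ℕ∞) φ → HasCompactSupport φ → (∀ x, 0 ≤ φ x) → (∀ x, φ x ≤ 1) → (∀ x, ‖fderiv ℝ φ x‖ ≤ δ) → (∀ x, |lapl φ x| ≤ δ) →
    (∀ x, ‖bn ν lam u x‖ ≤ B) →
    ∫ x, st (u x - k) * (σ * lapl u x - κ * diverg (fun z => u z • bn ν lam u z) x - L) * φ x ≤ δ * (σ + B) + (k + 1) * D * ∫ x, jf (u x - k) := by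
  have hm : 0 < lam + 2 := by linarith
  obtain ⟨CI, hCI, hI⟩ := IR_bdd (d := d) (β := lam + 2) hm hld
  obtain ⟨Cp, hCp, hP⟩ := pair (d := d) (β := lam + 2) hm hld
  set c1 : ℝ := d * (2 * (lam * (lam + 3))) with hc1
  have hd : (0:ℝ) < d := by linarith
  have hc1p : 0 < c1 := by positivity
  refine ⟨c1 * (CI + Cp), by positivity, ?_⟩
  intro ν _ k L σ κ δ B u φ hk hL hσ hκ hδ hu h0 hmass hφ hφc hφ0 hφ1 hφd hφl hB
  set b := bn ν lam u with hbdef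
  set g : EE d → ℝ := fun x => jf (u x - k) with hg
  have hgN : Nice g := hu.trunc h0 (by linarith)
  have hg0 : ∀ x, 0 ≤ g x := fun x => jf_nonneg _
  have hgu : ∀ x, g x ≤ u x := fun x => jf_le_max (h0 x) (by linarith)
  have hgm : ∫ x, g x ≤ 1 := by rw [← hmass]; exact integral_mono hgN.integrable hu.integrable hgu
  have hbC : ContDiff ℝ 1 b := bn_contDiff ν hl hld hu
  have hgint : 0 ≤ ∫ x, g x := integral_nonneg hg0
  have hB0 : 0 ≤ B := (norm_nonneg _).trans (hB 0)
  set J : EE d → ℝ := fun x => ∫ z, IR (lam+2) g (x - z) ∂ν with hJ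
  have hdiv : ∀ x, |diverg b x| ≤ c1 * (CI * (k + 2) + J x) := by
    intro x
    refine (diverg_le (hbC.differentiable (by simp) x)).trans ?_
    have h2 : ∫ z, IR (lam+2) u (x - z) ∂ν ≤ CI * (k + 2) + J x := by
      have : ∀ y, IR (lam+2) u y ≤ CI * (k + 2) + IR (lam + 2) g y := by
        intro y
        refine (IR_split hm hld hu hgN y).trans ?_
        have hug : ∀ y, |u y - g y| ≤ k + 1 := fun y => by
          rw [abs_of_nonneg (sub_nonneg.2 (hgu y))]
          have := jf_ge (u y - k); simp only [hg]; linarith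
        have h3 := hI (fun y => u y - g y) (k + 1) (hu.sub hgN) hug y
        have h4 : ∫ y, |u y - g y| ≤ 1 := by
          rw [← hmass]
          refine integral_mono (hu.integrable.sub hgN.integrable).abs hu.integrable fun y => ?_
          simp only [Pi.sub_apply]
          rw [abs_of_nonneg (sub_nonneg.2 (hgu y))]; linarith [hg0 y]
        have : CI * ((∫ y, |u y - g y|) + (k + 1)) ≤ CI * (k + 2) := mul_le_mul_of_nonneg_left (by linarith) hCI.le
        linarith
      calc _ ≤ ∫ z, (CI * (k + 2) + IR (lam+2) g (x - z)) ∂ν := integral_mono ((IR_avg_int hm hld hu ν).1 x)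
              ((integrable_const _).add ((IR_avg_int hm hld hgN ν).1 x)) fun z => this _
        _ = _ := by rw [integral_add (integrable_const _) ((IR_avg_int hm hld hgN ν).1 x)]; simp [hJ]
    calc (d:ℝ) * ‖fderiv ℝ b x‖ ≤ d * (2 * (lam * (lam + 3)) * ∫ z, IR (lam+2) u (x - z) ∂ν) := by
          gcongr; exact bn_fderiv_le ν hl hld hu x
      _ = c1 * ∫ z, IR (lam+2) u (x - z) ∂ν := by rw [hc1]; ring
      _ ≤ _ := by gcongr
  set A : EE d → ℝ := fun x => st (u x - k) * φ x with hA
  have huc := hu.continuous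
  have hstc := st_continuous
  have hφcont := hφ.continuous
  have hAc : Continuous A := by fun_prop
  have hAi : Integrable A := hAc.integrable_of_hasCompactSupport hφc.mul_left
  have hA0 : ∀ x, 0 ≤ A x := fun x => mul_nonneg (st_nonneg _) (hφ0 x)
  have hA1 : ∀ x, A x ≤ 1 := fun x => mul_le_one₀ (st_le_one _) (hφ0 x) (hφ1 x)
  have hAm : ∫ x, A x ≤ 1 := by
    rw [← hmass]
    refine integral_mono hAi hu.integrable fun x => ?_
    have := st_le (h0 x) hk
    have := st_nonneg (u x - k)
    have := hφ1 x
    simp only [hA]; nlinarith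
  have hpair := hP ν A g hAc hA0 hA1 hAi hAm hgN hg0
  have hubC : ContDiff ℝ 1 (fun z => u z • b z) := (hu.smooth.of_le (by exact_mod_cast le_top)).smul hbC
  have hgbC : ContDiff ℝ 1 (fun z => g z • b z) := (hgN.smooth.of_le (by exact_mod_cast le_top)).smul hbC
  have hlu := lapl_continuous (hu.smooth.of_le two_le_top')
  have hlg := lapl_continuous (hgN.smooth.of_le two_le_top')
  have hdu := diverg_continuous hubC
  have hdg := diverg_continuous hgbC
  have hi1 : Integrable (fun x => st (u x - k) * (σ * lapl u x - κ * diverg (fun z => u z • b z) x - L) * φ x) := by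
    refine Continuous.integrable_of_hasCompactSupport (by fun_prop) hφc.mul_left
  have hi2 : Integrable (fun x => (σ * lapl g x - κ * diverg (fun z => g z • b z) x) * φ x) := by
    refine Continuous.integrable_of_hasCompactSupport (by fun_prop) hφc.mul_left
  have hi3 : Integrable (fun x => A x * J x) := by
    obtain ⟨BB, hBB⟩ := (IR_avg_int hm hld hgN ν).2
    refine hAi.mul_bdd (c := BB) ?_ (ae_of_all _ fun x => hBB x)
    exact (StronglyMeasurable.integral_prod_right' (f := fun p : EE d × EE d => IR (lam+2) g (p.1 - p.2)) (by
      have := IR_continuous hm hld hgN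
      have : Continuous fun p : EE d × EE d => IR (lam+2) g (p.1 - p.2) := by fun_prop
      exact this.stronglyMeasurable)).aestronglyMeasurable
  have hpt : ∀ x, st (u x - k) * (σ * lapl u x - κ * diverg (fun z => u z • b z) x - L) * φ x ≤
      (σ * lapl g x - κ * diverg (fun z => g z • b z) x) * φ x + (k + 1) * c1 * (A x * J x) := by
    intro x
    have h1 := trunc_pt (L := L) hσ hκ (by linarith : (0:ℝ) ≤ k) hu.smooth hbC h0 x
    have h2 : st (u x - k) * ((k + 1) * |diverg b x| - L) ≤ st (u x - k) * ((k + 1) * (c1 * J x)) := by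
      have := st_nonneg (u x - k)
      gcongr
      have h3 := mul_le_mul_of_nonneg_left (hdiv x) (by linarith : (0:ℝ) ≤ k + 1)
      have : 0 ≤ c1 * Cp * (k + 1) * (k + 2) := by
        have : 0 ≤ k + 1 := by linarith
        have : 0 ≤ k + 2 := by linarith
        positivity
      nlinarith
    have h3 := mul_le_mul_of_nonneg_right (h1.trans (add_le_add_right h2 _)) (hφ0 x)
    refine h3.trans (le_of_eq ?_)
    simp only [hA, hg]; ring
  have hw : ∫ x, (σ * lapl g x - κ * diverg (fun z => g z • b z) x) * φ x ≤ δ * (σ + B) := by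
    rw [weak σ κ (hgN.smooth.of_le two_le_top') hgbC (hφ.of_le two_le_top') hφc]
    calc _ ≤ ∫ x, δ * (σ + B) * g x := by
          refine (le_abs_self _).trans ?_
          rw [← Real.norm_eq_abs]
          refine norm_integral_le_of_norm_le (hgN.integrable.const_mul _) (ae_of_all _ fun x => ?_)
          have q1 : |σ * (g x * lapl φ x)| ≤ σ * (g x * δ) := by
            rw [abs_mul, abs_mul, abs_of_pos hσ, abs_of_nonneg (hg0 x)]
            have := hg0 x
            gcongr; exact hφl x
          have q2 : |κ * fderiv ℝ φ x (g x • b x)| ≤ δ * (g x * B) := by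
            rw [abs_mul, hκ, one_mul, ← Real.norm_eq_abs]
            refine ((fderiv ℝ φ x).le_opNorm _).trans ?_
            rw [norm_smul, Real.norm_of_nonneg (hg0 x)]
            have := hg0 x
            gcongr
            · exact hφd x
            · exact hB x
          rw [Real.norm_eq_abs]
          refine (abs_add_le _ _).trans ?_
          linarith
      _ ≤ _ := by
          rw [integral_const_mul]
          exact mul_le_of_le_one_right (by positivity) hgm
  calc _ ≤ ∫ x, ((σ * lapl g x - κ * diverg (fun z => g z • b z) x) * φ x + (k + 1) * c1 * (A x * J x)) :=
        integral_mono hi1 (hi2.add (hi3.const_mul _)) hpt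
    _ = (∫ x, (σ * lapl g x - κ * diverg (fun z => g z • b z) x) * φ x) + (k + 1) * c1 * ∫ x, A x * J x := by
        rw [integral_add hi2 (hi3.const_mul _), integral_const_mul]
    _ ≤ δ * (σ + B) + (k + 1) * c1 * (Cp * ∫ x, g x) := by
        have : 0 ≤ k + 1 := by linarith
        gcongr
    _ ≤ _ := by
        have : 0 ≤ (k + 1) * c1 * CI * ∫ x, g x := by
          have : 0 ≤ k + 1 := by linarith
          positivity
        linarith

lemma Sol.cont_t {d : ℕ} {ν : Measure (EE d)} {lam σ κ T : ℝ} {u : ℝ → EE d → ℝ} (h : Sol ν lam σ κ T u) (x : EE d) :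
    ContinuousOn (fun t => u t x) (Icc 0 T) :=
  h.smooth.continuousOn.comp (f := fun t : ℝ => (t, x)) (by fun_prop) (fun t ht => ⟨ht, mem_univ x⟩)

lemma Sol.L1cont {d : ℕ} {ν : Measure (EE d)} {lam σ κ T : ℝ} {u : ℝ → EE d → ℝ} (h : Sol ν lam σ κ T u) {s : ℝ} (hs : s ∈ Icc 0 T) :
    Tendsto (fun t => ∫ x, |u t x - u s x|) (𝓝[Icc 0 T] s) (𝓝 0) := by
  have e : ∀ t ∈ Icc 0 T, ∫ x, |u t x - u s x| = 2 * ∫ x, max (u s x - u t x) 0 := by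
    intro t ht
    have h1 := (h.nice t ht).integrable
    have h2 := (h.nice s hs).integrable
    have : ∀ x, |u t x - u s x| = 2 * max (u s x - u t x) 0 + (u t x - u s x) := by
      intro x
      rcases le_total (u s x - u t x) 0 with h | h
      · rw [max_eq_right h, abs_of_nonneg (by linarith)]; ring
      · rw [max_eq_left h, abs_of_nonpos (by linarith)]; ring
    simp_rw [this]
    have h3 : Integrable (fun x => max (u s x - u t x) 0) := (h2.sub h1).pos_part
    rw [integral_add (h3.const_mul 2) (by exact h1.sub h2), integral_sub h1 h2, h.mass t ht, h.mass s hs, integral_const_mul]; ring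
  have : Tendsto (fun t => 2 * ∫ x, max (u s x - u t x) 0) (𝓝[Icc 0 T] s) (𝓝 (2 * ∫ x : EE d, 0)) := by
    refine Tendsto.const_mul 2 ?_
    refine tendsto_integral_filter_of_dominated_convergence (fun x => u s x) ?_ ?_ (h.nice s hs).integrable ?_
    · filter_upwards [self_mem_nhdsWithin] with t ht
      have := (h.nice t ht).continuous
      have := (h.nice s hs).continuous
      exact (by fun_prop : Continuous fun x => max (u s x - u t x) 0).aestronglyMeasurable
    · filter_upwards [self_mem_nhdsWithin] with t ht
      refine ae_of_all _ fun x => ?_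
      rw [Real.norm_of_nonneg (le_max_right _ _)]
      exact max_le (by linarith [h.nonneg t ht x]) (h.nonneg s hs x)
    · refine ae_of_all _ fun x => ?_
      have h1 : Tendsto (fun t => u t x) (𝓝[Icc 0 T] s) (𝓝 (u s x)) := h.cont_t x s hs
      have := (tendsto_const_nhds (x := u s x) |>.sub h1).max (tendsto_const_nhds (x := (0:ℝ)))
      simpa using this
  simp only [integral_zero, mul_zero] at this
  refine this.congr' ?_
  filter_upwards [self_mem_nhdsWithin] with t ht
  rw [e t ht]

def vt {d : ℕ} (u : ℝ → EE d → ℝ) (k0 L c τ : ℝ) : ℝ := ∫ x, jf (u τ x - (k0 + L * (τ - c)))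

lemma Sol.vt_cont {d : ℕ} {ν : Measure (EE d)} {lam σ κ T : ℝ} {u : ℝ → EE d → ℝ} (h : Sol ν lam σ κ T u) {k0 L c : ℝ} (hk : 0 ≤ k0) (hL : 0 ≤ L) (hc : 0 ≤ c) :
    ContinuousOn (vt u k0 L c) (Icc c T) := by
  intro s hs
  have hs' : s ∈ Icc 0 T := ⟨hc.trans hs.1, hs.2⟩
  have hjc : Continuous jf := jf_contDiff.continuous
  have hmono : 𝓝[Icc c T] s ≤ 𝓝[Icc 0 T] s := nhdsWithin_mono _ (Icc_subset_Icc_left hc)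
  have A := (h.L1cont hs').mono_left hmono
  have B : Tendsto (fun τ => ∫ x, jf (u s x - (k0 + L * (τ - c)))) (𝓝[Icc c T] s) (𝓝 (∫ x, jf (u s x - (k0 + L * (s - c))))) := by
    have hus := (h.nice s hs').continuous
    refine tendsto_integral_filter_of_dominated_convergence (fun x => u s x) ?_ ?_ (h.nice s hs').integrable ?_
    · refine Eventually.of_forall fun τ => ?_
      exact (by fun_prop : Continuous fun x => jf (u s x - (k0 + L * (τ - c)))).aestronglyMeasurable
    · filter_upwards [self_mem_nhdsWithin] with t ht
      refine ae_of_all _ fun x => ?_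
      rw [Real.norm_of_nonneg (jf_nonneg _)]
      exact jf_le_max (h.nonneg s hs' x) (by have := ht.1; have : 0 ≤ t - c := by linarith
                                             positivity)
    · refine ae_of_all _ fun x => ?_
      exact ((by fun_prop : Continuous fun τ => jf (u s x - (k0 + L * (τ - c)))).tendsto s).mono_left nhdsWithin_le_nhds
  have Cc : Tendsto (fun τ => vt u k0 L c τ - ∫ x, jf (u s x - (k0 + L * (τ - c)))) (𝓝[Icc c T] s) (𝓝 0) := by
    refine squeeze_zero_norm' ?_ A
    filter_upwards [self_mem_nhdsWithin] with t ht
    have ht' : t ∈ Icc 0 T := ⟨hc.trans ht.1, ht.2⟩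
    have hk' : 0 ≤ k0 + L * (t - c) := by
      have := ht.1; have : 0 ≤ t - c := by linarith
      positivity
    unfold vt
    have i1 := ((h.nice t ht').trunc (h.nonneg t ht') hk').integrable
    have i2 := ((h.nice s hs').trunc (h.nonneg s hs') hk').integrable
    rw [← integral_sub i1 i2]
    refine norm_integral_le_of_norm_le ((h.nice t ht').integrable.sub (h.nice s hs').integrable).abs (ae_of_all _ fun x => ?_)
    rw [Real.norm_eq_abs]
    refine (jf_lip' _ _).trans (le_of_eq ?_)
    simp
  have := Cc.add B
  simp only [sub_add_cancel, zero_add] at this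
  exact this

lemma Sol.b_bdd {d : ℕ} {lam : ℝ} (hl : 0 < lam) (hld : lam + 2 < d) : ∃ C : ℝ, 0 < C ∧ ∀ (ν : Measure (EE d)) [IsProbabilityMeasure ν] (f : EE d → ℝ) (Λ : ℝ),
    Nice f → (∀ x, |f x| ≤ Λ) → ∀ x, ‖bn ν lam f x‖ ≤ C * ((∫ x, |f x|) + Λ) := by
  obtain ⟨C1, hC1, h1⟩ := IR_bdd (d := d) (β := lam + 1) (by linarith) (by linarith)
  refine ⟨lam * C1, by positivity, fun ν _ f Λ hf hL x => bn_norm_le ν (fun x => ?_) x⟩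
  rw [mul_assoc]
  exact (bt_norm_le hl f x).trans (mul_le_mul_of_nonneg_left (h1 f Λ hf hL x) hl.le)

lemma trunc_step {d : ℕ} {lam : ℝ} (hl : 0 < lam) (hld : lam + 2 < d) : ∃ D : ℝ, 0 < D ∧ ∀ (ν : Measure (EE d)) [IsProbabilityMeasure ν]
    (σ κ T : ℝ) (u : ℝ → EE d → ℝ), 0 < σ → |κ| = 1 → Sol ν lam σ κ T u →
    ∀ (k0 L c s t Λ r : ℝ), 1 ≤ k0 → D * (k0 + 2) * (k0 + 3) ≤ L → 0 ≤ c → c ≤ s → 0 < s → s ≤ t → t < T → L * (t - c) ≤ 1 →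
    (∀ τ ∈ Icc s t, ∀ x, u τ x ≤ Λ) → (∀ τ ∈ Icc s t, (k0 + 2) * D * vt u k0 L c τ ≤ r) →
    vt u k0 L c t - vt u k0 L c s ≤ r * (t - s) := by
  obtain ⟨D, hD, H⟩ := trunc_space (d := d) hl hld
  obtain ⟨Cb, hCb, hb⟩ := Sol.b_bdd (d := d) hl hld
  obtain ⟨C, hC, hcut⟩ := cutoff d
  refine ⟨D, hD, ?_⟩
  intro ν _ σ κ T u hσ hκ h k0 L c s t Λ r hk0 hL hc hcs hs0 hst htT hLt hΛ hr
  have hLp : 0 < L := lt_of_lt_of_le (by positivity) hL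
  set k : ℝ → ℝ := fun τ => k0 + L * (τ - c) with hk
  set E : ℝ → EE d → ℝ := fun τ x => σ * lapl (u τ) x - κ * diverg (fun z => u τ z • bn ν lam (u τ) z) x with hE
  have hEc := deriv_cont h.smooth h.eqn
  have huc : ContinuousOn (fun p : ℝ × EE d => u p.1 p.2) (Ioo 0 T ×ˢ univ) := h.smooth.continuousOn.mono (prod_mono Ioo_subset_Icc_self subset_rfl)
  have hjc : Continuous jf := jf_contDiff.continuous
  have hstc := st_continuous
  have hsub : Icc s t ⊆ Ioo 0 T := fun τ hτ => ⟨hs0.trans_le hτ.1, hτ.2.trans_lt htT⟩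
  have hkτ : ∀ τ ∈ Icc s t, k0 ≤ k τ ∧ k τ ≤ k0 + 1 := by
    intro τ hτ
    have h1 : 0 ≤ τ - c := by linarith [hτ.1]
    have h2 : L * (τ - c) ≤ L * (t - c) := by gcongr; exact hτ.2
    have : 0 ≤ L * (τ - c) := by positivity
    simp only [hk]; constructor <;> linarith
  have step : ∀ R : ℝ, 1 ≤ R → ∀ φ : EE d → ℝ, ContDiff ℝ (⊤:ℕ∞) φ → HasCompactSupport φ →
    (∀ x, 0 ≤ φ x) → (∀ x, φ x ≤ 1) → (∀ x, ‖fderiv ℝ φ x‖ ≤ C / R) → (∀ x, |lapl φ x| ≤ C / R) →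
    (∫ x, jf (u t x - k t) * φ x) - (∫ x, jf (u s x - k s) * φ x) ≤ (C / R * (σ + Cb * (1 + Λ)) + r) * (t - s) := by
    intro R hR φ hφ hφc hφ0 hφ1 hφd hφl
    have hφcont := hφ.continuous
    have htd := td (G := fun τ x => jf (u τ x - k τ) * φ x) (G' := fun τ x => st (u τ x - k τ) * (E τ x - L) * φ x) (a := 0) (b := T) hφc.isCompact
      (by fun_prop) (by fun_prop)
      (fun τ _ x hx => by simp only [image_eq_zero_of_notMem_tsupport (f := φ) hx, mul_zero])
      (fun τ _ x hx => by simp only [image_eq_zero_of_notMem_tsupport (f := φ) hx, mul_zero])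
      (fun τ hτ x => by
        have h1 : HasDerivAt (fun τ => u τ x - k τ) (E τ x - L) τ := by
          refine (h.eqn τ hτ x).fun_sub ?_
          have := (((hasDerivAt_id' τ).sub_const c).const_mul L).const_add k0
          have e : HasDerivAt k (L * 1) τ := this
          rwa [mul_one] at e
        have := (jf_deriv (u τ x - k τ)).comp τ h1
        exact this.mul_const (φ x))
    refine (convex_Icc s t).image_sub_le_mul_sub_of_deriv_le (f := fun τ => ∫ x, jf (u τ x - k τ) * φ x)
      (fun τ hτ => (htd τ (hsub hτ)).continuousAt.continuousWithinAt)
      (fun τ hτ => (htd τ (hsub (interior_subset hτ))).differentiableAt.differentiableWithinAt)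
      ?_ s (left_mem_Icc.2 hst) t (right_mem_Icc.2 hst) hst
    intro τ hτ
    have hτ := interior_subset hτ
    have hτT : τ ∈ Icc 0 T := Ioo_subset_Icc_self (hsub hτ)
    rw [(htd τ (hsub hτ)).deriv]
    obtain ⟨hk1, hk2⟩ := hkτ τ hτ
    have habs : ∀ x, |u τ x| = u τ x := fun x => abs_of_nonneg (h.nonneg τ hτT x)
    have hbb : ∀ x, ‖bn ν lam (u τ) x‖ ≤ Cb * (1 + Λ) := by
      intro x
      have := hb ν (u τ) Λ (h.nice τ hτT) (fun x => by rw [habs]; exact hΛ τ hτ x) x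
      simp_rw [habs] at this
      rwa [h.mass τ hτT] at this
    have h1 : D * (k τ + 1) * (k τ + 2) ≤ L := by
      refine le_trans ?_ hL
      have : 0 ≤ k τ + 2 := by linarith
      refine mul_le_mul ?_ (by linarith) this (by positivity)
      exact mul_le_mul_of_nonneg_left (by linarith) hD.le
    refine (H ν (k τ) L σ κ (C / R) (Cb * (1 + Λ)) (u τ) φ (by linarith) h1 hσ hκ (by positivity) (h.nice τ hτT) (h.nonneg τ hτT) (h.mass τ hτT)
      hφ hφc hφ0 hφ1 hφd hφl hbb).trans ?_
    have h2 := hr τ hτ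
    have h3 : (k τ + 1) * D * ∫ x, jf (u τ x - k τ) ≤ (k0 + 2) * D * ∫ x, jf (u τ x - k τ) := by
      have : 0 ≤ ∫ x, jf (u τ x - k τ) := integral_nonneg fun x => jf_nonneg _
      gcongr ?_ * D * _
      linarith
    unfold vt at h2
    linarith
  choose φ hφ hφc hφ0 hφ1 hφe hφd hφl using fun n : ℕ => hcut (n + 1) (by have := n.cast_nonneg (α := ℝ); linarith)
  have lim : ∀ τ ∈ Icc s t, Tendsto (fun n => ∫ x, jf (u τ x - k τ) * φ n x) atTop (𝓝 (vt u k0 L c τ)) := by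
    intro τ hτ
    have hτT : τ ∈ Icc 0 T := Ioo_subset_Icc_self (hsub hτ)
    have hN := (h.nice τ hτT).trunc (h.nonneg τ hτT) (k := k τ) (by linarith [(hkτ τ hτ).1])
    refine tendsto_integral_of_dominated_convergence (fun x => jf (u τ x - k τ)) ?_ hN.integrable ?_ ?_
    · intro n
      exact (hN.continuous.mul (hφ n).continuous).aestronglyMeasurable
    · intro n
      refine ae_of_all _ fun x => ?_
      rw [Real.norm_of_nonneg (mul_nonneg (jf_nonneg _) (hφ0 n x))]
      exact mul_le_of_le_one_right (jf_nonneg _) (hφ1 n x)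
    · refine ae_of_all _ fun x => ?_
      refine tendsto_const_nhds.congr' ?_
      filter_upwards [eventually_ge_atTop (Nat.ceil ‖x‖)] with n hn
      have : ‖x‖ ≤ n + 1 := by
        have h1 := Nat.le_ceil ‖x‖
        have h2 : ((Nat.ceil ‖x‖ : ℕ) : ℝ) ≤ n := by exact_mod_cast hn
        linarith
      rw [hφe n x this, mul_one]
  have l1 := (lim t (right_mem_Icc.2 hst)).sub (lim s (left_mem_Icc.2 hst))
  have l2 : Tendsto (fun n : ℕ => (C / ((n:ℝ) + 1) * (σ + Cb * (1 + Λ)) + r) * (t - s)) atTop (𝓝 ((0 * (σ + Cb * (1 + Λ)) + r) * (t - s))) := by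
    refine Tendsto.mul_const _ (Tendsto.add_const _ (Tendsto.mul_const _ ?_))
    have := (tendsto_one_div_add_atTop_nhds_zero_nat (𝕜 := ℝ)).const_mul C
    simpa [div_eq_mul_inv] using this
  have := le_of_tendsto_of_tendsto' l1 l2 (fun n => step (n + 1) (by have := n.cast_nonneg (α := ℝ); linarith) (φ n) (hφ n) (hφc n) (hφ0 n) (hφ1 n) (hφd n) (hφl n))
  simpa using this

def RG {d : ℕ} (T : ℝ) (u : ℝ → EE d → ℝ) (τ : ℝ) : Prop := ∃ δ > 0, ∃ Λ : ℝ, ∀ s ∈ Ico τ (τ + δ), s < T → ∀ x, u s x ≤ Λ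

lemma trunc_concl {d : ℕ} {lam : ℝ} (hl : 0 < lam) (hld : lam + 2 < d) (N : ℝ) : ∃ K h : ℝ, 0 < h ∧ ∀ (ν : Measure (EE d)) [IsProbabilityMeasure ν]
    (σ κ T : ℝ) (u : ℝ → EE d → ℝ), 0 < σ → |κ| = 1 → Sol ν lam σ κ T u →
    ∀ c t : ℝ, 0 ≤ c → c ≤ t → t < T → t ≤ c + h → (∀ x, u c x ≤ N) → (∀ τ ∈ Ioc c t, RG T u τ) → ∀ x, u t x ≤ K := by
  obtain ⟨D, hD, H⟩ := trunc_step (d := d) hl hld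
  set k0 := max N 1 with hk0d
  have hk0 : 1 ≤ k0 := le_max_right _ _
  set L := D * (k0 + 2) * (k0 + 3) with hLd
  have hL : 0 < L := by positivity
  refine ⟨k0 + 2, 1 / L, by positivity, ?_⟩
  intro ν _ σ κ T u hσ hκ h c t hc hct htT hth hN hgood x
  rcases hct.eq_or_lt with rfl | hct'
  · exact (hN x).trans (by have := le_max_left N 1; linarith)
  have hLt : L * (t - c) ≤ 1 := by
    calc L * (t - c) ≤ L * (1 / L) := by gcongr; linarith
      _ = 1 := by field_simp
  set v := vt u k0 L c with hv
  have hvc : ContinuousOn v (Icc c T) := h.vt_cont (by linarith) hL.le hc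
  have hv0 : ∀ τ, 0 ≤ v τ := fun τ => integral_nonneg fun x => jf_nonneg _
  set K := (k0 + 2) * D with hK
  have hKp : 0 < K := by positivity
  have hvcc : v c = 0 := by
    simp only [hv, vt, sub_self, mul_zero, add_zero]
    rw [← integral_zero (EE d) ℝ (μ := volume)]
    congr 1; funext y
    exact jf_zero (by have := le_max_left N 1; linarith [hN y])
  have gr : ∀ s ∈ Ioo c t, v t ≤ v s * Real.exp (K * (t - c)) := by
    intro s hs
    have h1 := le_gronwallBound_of_liminf_deriv_right_le (f := v) (f' := fun τ => K * v τ) (δ := v s) (K := K) (ε := 0) (a := s) (b := t)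
      (hvc.mono (Icc_subset_Icc hs.1.le htT.le)) ?_ le_rfl (fun τ _ => by simp) t (right_mem_Icc.2 hs.2.le)
    · rw [gronwallBound_ε0] at h1
      refine h1.trans ?_
      gcongr
      · exact hv0 s
      · exact hs.1.le
    · intro τ hτ r hr
      refine Eventually.frequently ?_
      obtain ⟨δ, hδ, Λ, hΛ⟩ := hgood τ ⟨hs.1.trans_le hτ.1, hτ.2.le⟩
      have hcw : ContinuousWithinAt (fun z => K * v z) (Ici τ) τ := by
        have h3 : ContinuousWithinAt v (Icc c T) τ := hvc τ ⟨by linarith [hs.1, hτ.1], by linarith [hτ.2]⟩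
        have h4 : ContinuousWithinAt v (Icc τ T) τ := h3.mono (Icc_subset_Icc_left (by linarith [hs.1, hτ.1]))
        have h5 : ContinuousWithinAt v (Ici τ) τ := (continuousWithinAt_Icc_iff_Ici (by linarith [hτ.2])).1 h4
        exact h5.const_mul K
      obtain ⟨r1, hr1, hr2⟩ := exists_between hr
      have ev := hcw.eventually (gt_mem_nhds hr1)
      obtain ⟨b, hb, hbs⟩ := (mem_nhdsGE_iff_exists_Ico_subset (a := τ)).1 ev
      have hb : τ < b := hb
      have hm : min (min b (τ + δ)) t ∈ Ioi τ := lt_min (lt_min hb (by linarith)) hτ.2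
      filter_upwards [Ioo_mem_nhdsGT hm] with z hz
      have hz1 : z < b := hz.2.trans_le ((min_le_left _ _).trans (min_le_left _ _))
      have hz2 : z < τ + δ := hz.2.trans_le ((min_le_left _ _).trans (min_le_right _ _))
      have hz3 : z < t := hz.2.trans_le (min_le_right _ _)
      have := H ν σ κ T u hσ hκ h k0 L c τ z Λ r1 hk0 le_rfl hc (by linarith [hs.1, hτ.1]) (by linarith [hs.1, hτ.1]) hz.1.le (by linarith)
        (by refine le_trans ?_ hLt; gcongr) (fun q hq => hΛ q ⟨hq.1, hq.2.trans_lt hz2⟩ (by linarith [hq.2]))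
        (fun q hq => (hbs ⟨hq.1, hq.2.trans_lt hz1⟩ : K * v q < r1).le)
      have hzp : 0 < z - τ := by linarith [hz.1]
      calc (z - τ)⁻¹ * (v z - v τ) ≤ (z - τ)⁻¹ * (r1 * (z - τ)) := by gcongr
        _ = r1 := by field_simp
        _ < r := hr2
  have hvt : v t ≤ 0 := by
    have h1 : Tendsto (fun s => v s * Real.exp (K * (t - c))) (𝓝[>] c) (𝓝 (v c * Real.exp (K * (t - c)))) := by
      refine Tendsto.mul_const _ ?_
      have h3 : ContinuousWithinAt v (Icc c T) c := hvc c ⟨le_rfl, by linarith⟩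
      have h5 : ContinuousWithinAt v (Ici c) c := (continuousWithinAt_Icc_iff_Ici (by linarith)).1 h3
      exact h5.tendsto.mono_left (nhdsWithin_mono _ Ioi_subset_Ici_self)
    rw [hvcc, zero_mul] at h1
    refine ge_of_tendsto h1 ?_
    filter_upwards [Ioo_mem_nhdsGT hct'] with s hs using gr s hs
  have htI : t ∈ Icc 0 T := ⟨by linarith, htT.le⟩
  have hN' := (h.nice t htI).trunc (h.nonneg t htI) (k := k0 + L * (t - c)) (by
    have : 0 ≤ t - c := by linarith
    positivity)
  have e0 : v t = 0 := le_antisymm hvt (hv0 t)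
  have e1 := (integral_eq_zero_iff_of_nonneg (fun x => jf_nonneg _) hN'.integrable).1 e0
  have e2 := (hN'.continuous.ae_eq_iff_eq volume continuous_const).1 (show _ =ᵐ[volume] (fun _ => (0:ℝ)) from e1)
  have e3 := congrFun e2 x
  have e4 := jf_ge (u t x - (k0 + L * (t - c)))
  linarith

lemma right_good {d : ℕ} {lam : ℝ} (hl : 0 < lam) (hld : lam + 2 < d) {ν : Measure (EE d)} [IsProbabilityMeasure ν]
    {σ κ T : ℝ} {u : ℝ → EE d → ℝ} (hσ : 0 < σ) (hκ : |κ| = 1) (h : Sol ν lam σ κ T u) :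
    ∀ a ∈ Ico 0 T, RG T u a := by
  have key : ∀ a ∈ Ico 0 T, ¬ RG T u a → ∀ N δ : ℝ, 0 < δ → ∃ c ∈ Ioo a (a + δ), c < T ∧ ¬ RG T u c ∧ ∃ x, N < u c x := by
    intro a ha hbad N0 δ hδ
    by_contra hcon
    push Not at hcon
    apply hbad
    obtain ⟨Na, -, hNa⟩ := (h.nice a ⟨ha.1, ha.2.le⟩).bdd
    set N := max N0 Na with hNd
    obtain ⟨K, hh, hhp, HK⟩ := trunc_concl (d := d) hl hld N
    refine ⟨min δ hh, lt_min hδ hhp, max N K, ?_⟩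
    intro t ht htT x
    have ht1 : t < a + δ := ht.2.trans_le (by gcongr; exact min_le_left _ _)
    have ht2 : t < a + hh := ht.2.trans_le (by gcongr; exact min_le_right _ _)
    have hbadN : ∀ c ∈ Icc a t, ¬ RG T u c → ∀ y, u c y ≤ N := by
      intro c hc hcb y
      rcases hc.1.eq_or_lt with rfl | hac
      · exact (le_abs_self _).trans ((hNa y).trans (le_max_right _ _))
      · exact (hcon c ⟨hac, hc.2.trans_lt ht1⟩ (hc.2.trans_lt htT) hcb y).trans (le_max_left _ _)
    set S := {c | c ∈ Icc a t ∧ ¬ RG T u c} with hS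
    have hSne : S.Nonempty := ⟨a, ⟨le_rfl, ht.1⟩, hbad⟩
    have hSb : BddAbove S := ⟨t, fun c hc => hc.1.2⟩
    set c := sSup S with hcd
    have hca : a ≤ c := le_csSup hSb ⟨⟨le_rfl, ht.1⟩, hbad⟩
    have hct : c ≤ t := csSup_le hSne fun c hc => hc.1.2
    have hcN : ∀ y, u c y ≤ N := by
      intro y
      have hcl := csSup_mem_closure hSne hSb
      have hcont : ContinuousWithinAt (fun s => u s y) S c :=
        ((h.cont_t y) c ⟨ha.1.trans hca, by linarith⟩).mono (fun s hs => ⟨ha.1.trans hs.1.1, by linarith [hs.1.2]⟩)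
      haveI : (𝓝[S] c).NeBot := mem_closure_iff_nhdsWithin_neBot.1 hcl
      refine le_of_tendsto hcont.tendsto ?_
      filter_upwards [self_mem_nhdsWithin] with s hs using hbadN s hs.1 hs.2 y
    refine (HK ν σ κ T u hσ hκ h c t (ha.1.trans hca) hct htT (by linarith) hcN ?_ x).trans (le_max_right _ _)
    intro τ hτ
    by_contra hb
    have : τ ≤ c := le_csSup hSb ⟨⟨hca.trans hτ.1.le, hτ.2⟩, hb⟩
    linarith [hτ.1]
  by_contra hcon
  push Not at hcon
  obtain ⟨a, ha, hbad⟩ := hcon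
  have step : ∀ p : {p : ℝ × ℝ // 0 ≤ p.1 ∧ p.1 < p.2 ∧ p.2 ≤ T ∧ ¬ RG T u p.1}, ∀ n : ℕ,
      ∃ q : {p : ℝ × ℝ // 0 ≤ p.1 ∧ p.1 < p.2 ∧ p.2 ≤ T ∧ ¬ RG T u p.1},
        p.1.1 ≤ q.1.1 ∧ q.1.2 ≤ p.1.2 ∧ ∃ x, ∀ s ∈ Icc q.1.1 q.1.2, (n:ℝ) < u s x := by
    rintro ⟨⟨p1, p2⟩, hp0, hp12, hpT, hpb⟩ n
    simp only at hp0 hp12 hpT hpb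
    obtain ⟨c, hc, hcT, hcb, x, hx⟩ := key p1 ⟨hp0, hp12.trans_le hpT⟩ hpb n (p2 - p1) (by linarith)
    have hc2 : c < p2 := by linarith [hc.2]
    have hcw : ContinuousWithinAt (fun s => u s x) (Ici c) c := by
      have h4 : ContinuousWithinAt (fun s => u s x) (Icc c T) c := (h.cont_t x c ⟨by linarith [hc.1], hcT.le⟩).mono (Icc_subset_Icc_left (by linarith [hc.1]))
      exact (continuousWithinAt_Icc_iff_Ici hcT).1 h4
    have ev := hcw.eventually (lt_mem_nhds hx)
    obtain ⟨b, hb, hbs⟩ := (mem_nhdsGE_iff_exists_Icc_subset (a := c)).1 ev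
    have hb : c < b := hb
    refine ⟨⟨(c, min b p2), by linarith [hc.1], lt_min hb hc2, (min_le_right _ _).trans hpT, hcb⟩, hc.1.le, min_le_right _ _, x, ?_⟩
    intro s hs
    exact hbs ⟨hs.1, hs.2.trans (min_le_left _ _)⟩
  choose f hf1 hf2 hf3 using step
  let seq : ℕ → {p : ℝ × ℝ // 0 ≤ p.1 ∧ p.1 < p.2 ∧ p.2 ≤ T ∧ ¬ RG T u p.1} := fun n =>
    Nat.rec ⟨(a, T), ha.1, ha.2, le_rfl, hbad⟩ (fun n p => f p n) n
  have hs : ∀ n, seq (n+1) = f (seq n) n := fun n => rfl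
  have hmon : Monotone (fun n => (seq n).1.1) := monotone_nat_of_le_succ fun n => by rw [hs]; exact hf1 _ _
  have hanti : Antitone (fun n => (seq n).1.2) := antitone_nat_of_succ_le fun n => by rw [hs]; exact hf2 _ _
  have hmem : ∀ n, (⨆ n, (seq n).1.1) ∈ Icc (seq n).1.1 (seq n).1.2 := by
    have := Monotone.ciSup_mem_iInter_Icc_of_antitone hmon hanti (fun n => (seq n).2.2.1.le)
    exact fun n => mem_iInter.1 this n
  set t := ⨆ n, (seq n).1.1 with ht
  have htI : t ∈ Icc 0 T := ⟨(seq 0).2.1.trans (hmem 0).1, (hmem 0).2.trans (seq 0).2.2.2.1⟩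
  obtain ⟨Λ, -, hΛ⟩ := (h.nice t htI).bdd
  obtain ⟨n, hn⟩ := exists_nat_gt Λ
  obtain ⟨x, hx⟩ := hf3 (seq n) n
  have := hx t (hmem (n+1))
  have := (le_abs_self _).trans (hΛ x)
  linarith

lemma rpow_neg_half {A : ℝ} (hA : 0 < A) : A ^ (-(1:ℝ)/2) = (√A)⁻¹ := by
  rw [neg_div, Real.rpow_neg hA.le, Real.sqrt_eq_rpow]

lemma sol_mild {d : ℕ} {lam : ℝ} (hl : 0 < lam) (hld : lam + 2 < d) {ν : Measure (EE d)} [IsProbabilityMeasure ν]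
    {σ κ T : ℝ} {u : ℝ → EE d → ℝ} (hσ : 0 < σ) (hκ : |κ| = 1) (h : Sol ν lam σ κ T u) {r t0 t Bm : ℝ} (hr : 0 < r) (h0 : 0 ≤ t0) (ht : t0 ≤ t) (htT : t ≤ T)
    {B : ℝ → ℝ} (hB : ∀ s ∈ Ioo t0 t, ∀ x, ‖bn ν lam (u s) x‖ ≤ B s) (hBm : ∀ s ∈ Ioo t0 t, B s ≤ Bm)
    {H hd : ℝ → ℝ} (hHc : ContinuousOn H (Icc t0 t)) (hH : ∀ s ∈ Ioo t0 t, HasDerivAt H (hd s) s) (x : EE d)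
    (hh : ∀ s ∈ Ioo t0 t, (2:ℝ) ^ ((d : ℝ) / 2) * (r + σ * (t - s)) ^ (-(1:ℝ)/2) * (B s * gc d (2 * (r + σ * (t - s))) (u s) x) ≤ hd s) :
    |gc d r (u t) x - gc d (r + σ * (t - t0)) (u t0) x| ≤ H t - H t0 := by
  have hsub : Icc t0 t ⊆ Icc 0 T := Icc_subset_Icc h0 htT
  have hsub' : Ioo t0 t ⊆ Ioo 0 T := Ioo_subset_Ioo h0 htT
  have hin : ∀ s ∈ Ioo t0 t, s ∈ Icc 0 T := fun s hs => hsub (Ioo_subset_Icc_self hs)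
  have hF1 : ∀ s ∈ Ioo t0 t, ContDiff ℝ 1 (fun z => u s z • bn ν lam (u s) z) := fun s hs =>
    ((h.nice s (hin s hs)).smooth.of_le (by exact_mod_cast le_top)).smul (bn_contDiff ν hl hld (h.nice s (hin s hs)))
  have hFn : ∀ s ∈ Ioo t0 t, ∀ y, ‖u s y • bn ν lam (u s) y‖ ≤ B s * u s y := by
    intro s hs y
    rw [norm_smul, Real.norm_of_nonneg (h.nonneg s (hin s hs) y), mul_comm]
    exact mul_le_mul_of_nonneg_right (hB s hs y) (h.nonneg s (hin s hs) y)
  have hFi : ∀ s ∈ Ioo t0 t, Integrable (fun y => ‖u s y • bn ν lam (u s) y‖) := by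
    intro s hs
    refine ((h.nice s (hin s hs)).integrable.const_mul (B s)).mono' (hF1 s hs).continuous.norm.aestronglyMeasurable (ae_of_all _ fun y => ?_)
    rw [norm_norm]; exact hFn s hs y
  refine mild (c := max 1 Bm) hσ hκ hr ht (F := fun s z => u s z • bn ν lam (u s) z) (h.smooth.continuousOn.mono (prod_mono hsub subset_rfl))
    (fun s hs => (h.nice s (hin s hs)).smooth.of_le two_le_top') hF1 (fun s hs => h.eqn s (hsub' hs))
    ((deriv_cont h.smooth h.eqn).mono (prod_mono hsub' subset_rfl)) (fun s hs => (h.nice s (hsub hs)).integrable) ?_ hFi ?_ hHc hH x ?_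
  · intro s hs
    rw [integral_congr_ae (ae_of_all _ fun y => abs_of_nonneg (h.nonneg s (hsub hs) y)), h.mass s (hsub hs)]
    exact le_max_left _ _
  · intro s hs
    calc _ ≤ ∫ y, B s * u s y := integral_mono (hFi s hs) ((h.nice s (hin s hs)).integrable.const_mul _) (hFn s hs)
      _ = B s := by rw [integral_const_mul, h.mass s (hin s hs), mul_one]
      _ ≤ _ := (hBm s hs).trans (le_max_right _ _)
  · intro s hs
    have hA : 0 < r + σ * (t - s) := by have : 0 < t - s := by linarith [hs.2]
                                        positivity
    refine le_trans ?_ (hh s hs)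
    gcongr
    unfold gc
    rw [← integral_const_mul]
    have hg := gc_integrable (d := d) (r := 2 * (r + σ * (t - s))) (by positivity) (h.nice s (hin s hs)).integrable x
    refine integral_mono_of_nonneg (ae_of_all _ fun y => ?_) (hg.const_mul _) (ae_of_all _ fun y => ?_)
    · exact mul_nonneg (norm_nonneg _) (gk_pos (by positivity) _).le
    · have := mul_le_mul_of_nonneg_right (hFn s hs y) (gk_pos (d := d) (s := 2 * (r + σ * (t - s))) (by positivity) (x - y)).le
      refine this.trans (le_of_eq ?_)
      ring

def PX {d : ℕ} (X a σ ρ : ℝ) (u : ℝ → EE d → ℝ) (s : ℝ) : Prop := ∀ r, 0 < r → ∀ x, gc d r (u s) x ≤ X * (r + (σ * s + ρ)) ^ (-a)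

lemma PX.le {d : ℕ} {X a σ ρ s : ℝ} {u : ℝ → EE d → ℝ} (ha : 0 < a) (hX : 0 ≤ X) (hS : 0 < σ * s + ρ) (h : PX X a σ ρ u s) (hu : Nice (u s)) (x : EE d) :
    u s x ≤ X * (σ * s + ρ) ^ (-a) := by
  obtain ⟨L, -, hL⟩ := hu.bdd
  refine le_of_tendsto' (gc_tendsto hu.continuous hL x) fun n => ?_
  have hn : 0 < (1 / ((n:ℝ) + 1)) ^ 2 := by positivity
  refine (h _ hn x).trans ?_
  gcongr ?_ * ?_
  exact Real.rpow_le_rpow_of_nonpos hS (by linarith) (by linarith)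

lemma improve {d : ℕ} {lam : ℝ} (hl : 0 < lam) (hld : lam + 2 < d) (σ : ℝ) (hσ : 0 < σ) : ∃ c : ℝ, 0 < c ∧ ∀ (ν : Measure (EE d)) [IsProbabilityMeasure ν]
    (κ T : ℝ) (u : ℝ → EE d → ℝ), |κ| = 1 → Sol ν lam σ κ T u → ∀ X ρ : ℝ, 0 < X → 0 < ρ → ∀ t : ℝ, 0 ≤ t → t ≤ T →
    (∀ s ∈ Ioo 0 t, PX X (((d:ℝ) - lam)/2) σ ρ u s) → ∀ r, 0 < r → ∀ x, gc d r (u t) x ≤ gc d (r + σ * t) (u 0) x + c * X ^ 2 * (r + (σ * t + ρ)) ^ (-(((d:ℝ) - lam)/2)) := by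
  obtain ⟨Cb, hCb, hQ⟩ := riesz_Q_real d lam hl (by linarith)
  set a := ((d:ℝ) - lam)/2 with ha
  have hap : 0 < a := by rw [ha]; linarith
  refine ⟨(2:ℝ) ^ ((d : ℝ) / 2) * (lam * Cb) * (4 / σ), by positivity, ?_⟩
  intro ν _ κ T u hκ h X ρ hX hρ t h0 htT hP r hr x
  have hin : ∀ s ∈ Ioo 0 t, s ∈ Icc 0 T := fun s hs => ⟨hs.1.le, hs.2.le.trans htT⟩
  have hb : ∀ s ∈ Ioo 0 t, ∀ y, ‖bn ν lam (u s) y‖ ≤ lam * Cb * X * (√(σ * s + ρ))⁻¹ := by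
    intro s hs y
    have hS : 0 < σ * s + ρ := by have := hs.1; positivity
    refine bn_norm_le ν (fun y => (bt_norm_le hl (u s) y).trans ?_) y
    have := hQ (u s) X (σ * s + ρ) (h.nice s (hin s hs)).integrable (h.nice s (hin s hs)).continuous.measurable (h.nonneg s (hin s hs)) hX.le hS y
      (fun r hr => hP s hs r hr y)
    rw [rpow_neg_half hS] at this
    have e : IR (lam + 1) (u s) y = ∫ z, ‖y - z‖ ^ (-(lam + 1)) * u s z := by
      unfold IR; congr 1; funext z; rw [abs_of_nonneg (h.nonneg s (hin s hs) z)]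
    rw [e]
    calc lam * _ ≤ lam * (Cb * X * (√(σ * s + ρ))⁻¹) := by gcongr
      _ = _ := by ring
  set Kc := r + (σ * t + ρ) with hKc
  have hKp : 0 < Kc := by positivity
  set W := (2:ℝ) ^ ((d : ℝ) / 2) * (lam * Cb) * X ^ 2 * Kc ^ (-a) * (√Kc)⁻¹ with hW
  have hWp : 0 < W := by positivity
  have main := sol_mild (Bm := lam * Cb * X * (√ρ)⁻¹) hl hld hσ hκ h hr le_rfl h0 htT hb ?_
    (H := fun s => W * (2 / σ) * (√(σ * s + ρ) - √(r + σ * (t - s)))) (hd := fun s => W * ((√(σ * s + ρ))⁻¹ + (√(r + σ * (t - s)))⁻¹)) (by fun_prop) ?_ x ?_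
  · have h1 := (abs_le.1 main).2
    simp only [sub_zero, sub_self, mul_zero, add_zero, zero_add] at h1
    have h2 : W * (2 / σ) * (√(σ * t + ρ) - √r) - W * (2 / σ) * (√ρ - √(r + σ * t)) ≤ W * (2 / σ) * (2 * √Kc) := by
      rw [← mul_sub]
      gcongr
      have q1 : √(σ * t + ρ) ≤ √Kc := Real.sqrt_le_sqrt (by rw [hKc]; linarith)
      have q2 : √(r + σ * t) ≤ √Kc := Real.sqrt_le_sqrt (by rw [hKc]; linarith)
      linarith [Real.sqrt_nonneg r, Real.sqrt_nonneg ρ]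
    have h3 : W * (2 / σ) * (2 * √Kc) = (2:ℝ) ^ ((d : ℝ) / 2) * (lam * Cb) * (4 / σ) * X ^ 2 * Kc ^ (-a) := by
      have : √Kc ≠ 0 := by positivity
      rw [hW]; field_simp; ring
    linarith
  · intro s hs
    gcongr
    have := mul_pos hσ hs.1; linarith
  · intro s hs
    have hS : 0 < σ * s + ρ := by have := hs.1; positivity
    have hA : 0 < r + σ * (t - s) := by have : 0 < t - s := by linarith [hs.2]
                                        positivity
    have d1 : HasDerivAt (fun s => √(σ * s + ρ)) (σ / (2 * √(σ * s + ρ))) s := by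
      refine HasDerivAt.sqrt ?_ hS.ne'
      have := ((hasDerivAt_id' s).const_mul σ).add_const ρ
      simpa using this
    have d2 : HasDerivAt (fun s => √(r + σ * (t - s))) (-σ / (2 * √(r + σ * (t - s)))) s := by
      refine HasDerivAt.sqrt ?_ hA.ne'
      have := (((hasDerivAt_id' s).const_sub t).const_mul σ).const_add r
      simpa using this
    refine ((d1.fun_sub d2).const_mul (W * (2 / σ))).congr_deriv ?_
    field_simp
    ring
  · intro s hs
    have hS : 0 < σ * s + ρ := by have := hs.1; positivity
    have hA : 0 < r + σ * (t - s) := by have : 0 < t - s := by linarith [hs.2]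
                                        positivity
    rw [rpow_neg_half hA]
    have hg : gc d (2 * (r + σ * (t - s))) (u s) x ≤ X * Kc ^ (-a) := by
      refine (hP s hs _ (by positivity) x).trans ?_
      gcongr ?_ * ?_
      refine Real.rpow_le_rpow_of_nonpos hKp ?_ (by linarith)
      rw [hKc]; linarith
    have hq : (√(r + σ * (t - s)))⁻¹ * (√(σ * s + ρ))⁻¹ ≤ (√Kc)⁻¹ * ((√(σ * s + ρ))⁻¹ + (√(r + σ * (t - s)))⁻¹) := by
      set p := √(r + σ * (t - s))
      set q := √(σ * s + ρ)
      have hp : 0 < p := Real.sqrt_pos.2 hA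
      have hq : 0 < q := Real.sqrt_pos.2 hS
      have hk : √Kc ≤ p + q := by
        refine Real.sqrt_le_iff.2 ⟨by positivity, ?_⟩
        have e1 : p ^ 2 = r + σ * (t - s) := Real.sq_sqrt hA.le
        have e2 : q ^ 2 = σ * s + ρ := Real.sq_sqrt hS.le
        have := mul_pos hp hq
        rw [hKc]; nlinarith
      have hKq : 0 < √Kc := Real.sqrt_pos.2 hKp
      rw [show (√Kc)⁻¹ * (q⁻¹ + p⁻¹) = (p + q) * (√Kc)⁻¹ * (p⁻¹ * q⁻¹) by field_simp]
      refine le_mul_of_one_le_left (by positivity) ?_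
      rw [← div_eq_mul_inv, one_le_div hKq]; exact hk
    calc _ ≤ (2:ℝ) ^ ((d : ℝ) / 2) * (√(r + σ * (t - s)))⁻¹ * (lam * Cb * X * (√(σ * s + ρ))⁻¹ * (X * Kc ^ (-a))) := by gcongr
      _ = (2:ℝ) ^ ((d : ℝ) / 2) * (lam * Cb) * X ^ 2 * Kc ^ (-a) * ((√(r + σ * (t - s)))⁻¹ * (√(σ * s + ρ))⁻¹) := by ring
      _ ≤ (2:ℝ) ^ ((d : ℝ) / 2) * (lam * Cb) * X ^ 2 * Kc ^ (-a) * ((√Kc)⁻¹ * ((√(σ * s + ρ))⁻¹ + (√(r + σ * (t - s)))⁻¹)) := by gcongr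
      _ = _ := by rw [hW]; ring

lemma large_r {d : ℕ} {lam X S : ℝ} (hl : 0 < lam) (hld : lam + 2 < d) (hX : 0 < X) (hS : 0 < S) :
    ∃ R0 : ℝ, 0 < R0 ∧ ∀ r, R0 ≤ r → (4 * Real.pi * r) ^ (-(d:ℝ)/2) ≤ X * (r + S) ^ (-(((d:ℝ) - lam)/2)) := by
  set a := ((d:ℝ) - lam)/2 with ha
  have hap : 0 < a := by rw [ha]; linarith
  have t1 : Tendsto (fun r : ℝ => r ^ (-(lam/2))) atTop (𝓝 0) := tendsto_rpow_neg_atTop (by positivity)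
  have hc : 0 < X * 2 ^ (-a) / (4 * Real.pi) ^ (-(d:ℝ)/2) := by positivity
  have ev := (t1.eventually (gt_mem_nhds hc)).and (eventually_ge_atTop S)
  obtain ⟨R, hR⟩ := eventually_atTop.1 ev
  refine ⟨max R 1, by positivity, fun r hr => ?_⟩
  have hrp : 0 < r := lt_of_lt_of_le (by positivity) hr
  obtain ⟨h1, h2⟩ := hR r ((le_max_left _ _).trans hr)
  rw [lt_div_iff₀ (by positivity)] at h1
  calc (4 * Real.pi * r) ^ (-(d:ℝ)/2) = r ^ (-(lam/2)) * (4 * Real.pi) ^ (-(d:ℝ)/2) * r ^ (-a) := by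
        rw [Real.mul_rpow (by positivity) hrp.le, mul_right_comm, ← Real.rpow_add hrp, mul_comm]
        congr 2; rw [ha]; ring
    _ ≤ X * 2 ^ (-a) * r ^ (-a) := by gcongr
    _ = X * (2 * r) ^ (-a) := by rw [Real.mul_rpow (by norm_num) hrp.le]; ring
    _ ≤ _ := by
        gcongr ?_ * ?_
        exact Real.rpow_le_rpow_of_nonpos (by positivity) (by linarith) (by linarith)

lemma extend {d : ℕ} {lam : ℝ} (hl : 0 < lam) (hld : lam + 2 < d) {ν : Measure (EE d)} [IsProbabilityMeasure ν]
    {σ κ T : ℝ} {u : ℝ → EE d → ℝ} (hσ : 0 < σ) (hκ : |κ| = 1) (h : Sol ν lam σ κ T u) {X ρ ts : ℝ} (hX : 0 < X) (hρ : 0 < ρ) (hts : ts ∈ Ico 0 T)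
    (hP : PX (3/4 * X) (((d:ℝ) - lam)/2) σ ρ u ts) : ∃ δ > 0, ∀ t ∈ Ico ts (ts + δ), t < T → PX X (((d:ℝ) - lam)/2) σ ρ u t := by
  set a := ((d:ℝ) - lam)/2 with ha
  have hap : 0 < a := by rw [ha]; linarith
  have hT0 : 0 < T := hts.1.trans_lt hts.2
  obtain ⟨δ0, hδ0, Λ0, hΛ0⟩ := right_good hl hld hσ hκ h ts hts
  set Λ := max Λ0 0 with hΛd
  have hΛ : ∀ s ∈ Ico ts (ts + δ0), s < T → ∀ x, u s x ≤ Λ := fun s hs hsT x => (hΛ0 s hs hsT x).trans (le_max_left _ _)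
  have hΛp : 0 ≤ Λ := le_max_right _ _
  obtain ⟨Cb, hCb, hb⟩ := Sol.b_bdd (d := d) hl hld
  obtain ⟨R0, hR0, hlarge⟩ := large_r (d := d) (S := σ * T + ρ) hl hld hX (by positivity)
  set W := (2:ℝ) ^ ((d : ℝ) / 2) * (Cb * (1 + Λ)) * Λ with hW
  have hWp : 0 ≤ W := by positivity
  set Z := 1/4 * X * (R0 + (σ * T + ρ)) ^ (-a) with hZ
  have hZp : 0 < Z := by positivity
  have hlim : Tendsto (fun t => W * (2 / σ) * √(σ * (t - ts))) (𝓝 ts) (𝓝 0) := by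
    have : Continuous (fun t => W * (2 / σ) * √(σ * (t - ts))) := by fun_prop
    have := this.tendsto ts
    simpa using this
  obtain ⟨δ1, hδ1, hball⟩ := Metric.eventually_nhds_iff.1 (hlim.eventually (gt_mem_nhds hZp))
  refine ⟨min δ0 δ1, lt_min hδ0 hδ1, ?_⟩
  intro t ht htT r hr x
  have ht0 : t < ts + δ0 := ht.2.trans_le (by gcongr; exact min_le_left _ _)
  have ht1 : t < ts + δ1 := ht.2.trans_le (by gcongr; exact min_le_right _ _)
  have htp : 0 ≤ t := hts.1.trans ht.1
  have htI : t ∈ Icc 0 T := ⟨htp, htT.le⟩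
  have hsm : W * (2 / σ) * √(σ * (t - ts)) < Z := hball (by rw [Real.dist_eq, abs_of_nonneg (by linarith [ht.1])]; linarith)
  rcases le_total R0 r with hRr | hRr
  · refine (gc_le_mass hr (h.nice t htI).integrable (h.nonneg t htI) x).trans ?_
    rw [h.mass t htI, mul_one]
    refine (hlarge r hRr).trans ?_
    gcongr ?_ * ?_
    have : σ * t ≤ σ * T := by gcongr
    exact Real.rpow_le_rpow_of_nonpos (by positivity) (by linarith) (by linarith)
  · have hin : ∀ s ∈ Ioo ts t, s ∈ Icc 0 T := fun s hs => ⟨hts.1.trans hs.1.le, hs.2.le.trans htT.le⟩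
    have hbΛ : ∀ s ∈ Ioo ts t, ∀ y, u s y ≤ Λ := fun s hs => hΛ s ⟨hs.1.le, hs.2.trans ht0⟩ (hs.2.trans htT)
    have main := sol_mild (Bm := Cb * (1 + Λ)) (B := fun _ => Cb * (1 + Λ)) hl hld hσ hκ h hr hts.1 ht.1 htT.le ?_ (fun _ _ => le_rfl)
      (H := fun s => - (W * (2 / σ) * √(r + σ * (t - s)))) (hd := fun s => W * (√(r + σ * (t - s)))⁻¹) (by fun_prop) ?_ x ?_
    · have h1 := (abs_le.1 main).2
      simp only [sub_self, mul_zero, add_zero] at h1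
      have hst : 0 ≤ σ * (t - ts) := mul_nonneg hσ.le (by linarith [ht.1])
      have h2 : √(r + σ * (t - ts)) ≤ √r + √(σ * (t - ts)) := by
        refine Real.sqrt_le_iff.2 ⟨by positivity, ?_⟩
        have e1 := Real.sq_sqrt hr.le
        have e2 := Real.sq_sqrt hst
        have := mul_nonneg (Real.sqrt_nonneg r) (Real.sqrt_nonneg (σ * (t - ts)))
        nlinarith
      have h2' := mul_le_mul_of_nonneg_left h2 (show 0 ≤ W * (2 / σ) by positivity)
      have h3 := hP (r + σ * (t - ts)) (by positivity) x
      rw [show r + σ * (t - ts) + (σ * ts + ρ) = r + (σ * t + ρ) by ring] at h3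
      have h4 : Z ≤ 1/4 * X * (r + (σ * t + ρ)) ^ (-a) := by
        rw [hZ]
        gcongr ?_ * ?_
        have : σ * t ≤ σ * T := by gcongr
        exact Real.rpow_le_rpow_of_nonpos (by positivity) (by linarith) (by linarith)
      linarith
    · intro s hs y
      have habs : ∀ x, |u s x| = u s x := fun x => abs_of_nonneg (h.nonneg s (hin s hs) x)
      have := hb ν (u s) Λ (h.nice s (hin s hs)) (fun x => by rw [habs]; exact hbΛ s hs x) y
      simp_rw [habs] at this
      rwa [h.mass s (hin s hs)] at this
    · intro s hs
      have hA : 0 < r + σ * (t - s) := by have : 0 < t - s := by linarith [hs.2]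
                                          positivity
      have d2 : HasDerivAt (fun s => √(r + σ * (t - s))) (-σ / (2 * √(r + σ * (t - s)))) s := by
        refine HasDerivAt.sqrt ?_ hA.ne'
        have := (((hasDerivAt_id' s).const_sub t).const_mul σ).const_add r
        simpa using this
      refine (d2.const_mul (W * (2 / σ))).fun_neg.congr_deriv ?_
      field_simp
    · intro s hs
      have hA : 0 < r + σ * (t - s) := by have : 0 < t - s := by linarith [hs.2]
                                          positivity
      rw [rpow_neg_half hA]
      have := gc_le_sup (r := 2 * (r + σ * (t - s))) (by positivity) (h.nice s (hin s hs)).integrable (hbΛ s hs) x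
      calc _ ≤ (2:ℝ) ^ ((d : ℝ) / 2) * (√(r + σ * (t - s)))⁻¹ * (Cb * (1 + Λ) * Λ) := by gcongr
        _ = _ := by rw [hW]; ring

lemma bootstrap {d : ℕ} {lam : ℝ} (hl : 0 < lam) (hld : lam + 2 < d) (σ : ℝ) (hσ : 0 < σ) : ∃ c : ℝ, 0 < c ∧ ∀ (ν : Measure (EE d)) [IsProbabilityMeasure ν]
    (κ T : ℝ) (u : ℝ → EE d → ℝ), |κ| = 1 → Sol ν lam σ κ T u → ∀ X ρ : ℝ, 0 < X → 0 < ρ → c * X ≤ 1 / 4 →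
    (∀ r, 0 < r → ∀ x, gc d r (u 0) x ≤ X / 2 * (r + ρ) ^ (-(((d:ℝ) - lam)/2))) → ∀ t ∈ Icc 0 T, PX X (((d:ℝ) - lam)/2) σ ρ u t := by
  obtain ⟨c, hc, hI⟩ := improve (d := d) hl hld σ hσ
  refine ⟨c, hc, ?_⟩
  intro ν _ κ T u hκ h X ρ hX hρ hcX h0
  set a := ((d:ℝ) - lam)/2 with ha
  have imp : ∀ t ∈ Icc 0 T, (∀ s ∈ Ioo 0 t, PX X a σ ρ u s) → PX (3/4 * X) a σ ρ u t := by
    intro t ht hs r hr x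
    have h1 := hI ν κ T u hκ h X ρ hX hρ t ht.1 ht.2 hs r hr x
    have hst := mul_nonneg hσ.le ht.1
    have h2 := h0 (r + σ * t) (by positivity) x
    rw [show r + σ * t + ρ = r + (σ * t + ρ) by ring] at h2
    have hq : 0 ≤ (r + (σ * t + ρ)) ^ (-a) := by positivity
    have h3 : c * X ^ 2 * (r + (σ * t + ρ)) ^ (-a) ≤ 1/4 * X * (r + (σ * t + ρ)) ^ (-a) := by
      refine mul_le_mul_of_nonneg_right ?_ hq
      nlinarith
    linarith
  have weaken : ∀ t, 0 ≤ t → PX (3/4 * X) a σ ρ u t → PX X a σ ρ u t := by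
    intro t ht hp r hr x
    have hst := mul_nonneg hσ.le ht
    have hq : 0 ≤ (r + (σ * t + ρ)) ^ (-a) := by positivity
    exact (hp r hr x).trans (mul_le_mul_of_nonneg_right (by linarith) hq)
  have all : ∀ t ∈ Ico 0 T, PX X a σ ρ u t := by
    by_contra hcon
    push Not at hcon
    set S := {s | s ∈ Ico 0 T ∧ ¬ PX X a σ ρ u s} with hS
    have hne : S.Nonempty := by obtain ⟨t, ht, hb⟩ := hcon; exact ⟨t, ht, hb⟩
    have hbd : BddBelow S := ⟨0, fun s hs => hs.1.1⟩
    obtain ⟨t1, ht1⟩ := hne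
    set ts := sInf S with hts
    have hts0 : 0 ≤ ts := le_csInf ⟨t1, ht1⟩ fun s hs => hs.1.1
    have htsT : ts < T := (csInf_le hbd ht1).trans_lt ht1.1.2
    have hgood : ∀ s ∈ Ioo 0 ts, PX X a σ ρ u s := by
      intro s hs
      by_contra hb
      have := csInf_le hbd (show s ∈ S from ⟨⟨hs.1.le, hs.2.trans htsT⟩, hb⟩)
      linarith [hs.2]
    obtain ⟨δ, hδ, hext⟩ := extend hl hld hσ hκ h hX hρ ⟨hts0, htsT⟩ (imp ts ⟨hts0, htsT.le⟩ hgood)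
    obtain ⟨s, hs, hsl⟩ := exists_lt_of_csInf_lt ⟨t1, ht1⟩ (show sInf S < ts + δ by linarith)
    exact hs.2 (hext s ⟨csInf_le hbd hs, hsl⟩ hs.1.2)
  intro t ht
  exact weaken t ht.1 (imp t ht fun s hs => all s ⟨hs.1.le, hs.2.trans_le ht.2⟩)

lemma uniform {d : ℕ} {lam : ℝ} (hl : 0 < lam) (hld : lam + 2 < d) (σ : ℝ) (hσ : 0 < σ) : ∃ Cs : ℝ, 0 < Cs ∧ ∀ M : ℝ, 0 < M → ∃ Λ : ℝ, 0 < Λ ∧ ∀ (ν : Measure (EE d)) [IsProbabilityMeasure ν]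
    (κ T : ℝ) (u : ℝ → EE d → ℝ), |κ| = 1 → 0 ≤ T → Sol ν lam σ κ T u → eLpNorm (u 0) (ENNReal.ofReal ((d : ℝ) / ((d : ℝ) - lam))) volume ≤ ENNReal.ofReal Cs →
    (∀ x, u 0 x ≤ M) → ∀ t ∈ Icc 0 T, ∀ x, u t x ≤ Λ := by
  obtain ⟨c, hc, hB⟩ := bootstrap (d := d) hl hld σ hσ
  set a := ((d:ℝ) - lam)/2 with ha
  have hap : 0 < a := by rw [ha]; linarith
  set CH := (4 * Real.pi) ^ (-a) with hCH
  have hCHp : 0 < CH := by positivity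
  set ε := 1 / (8 * c * (2 ^ a * CH)) with hε
  have hεp : 0 < ε := by positivity
  refine ⟨ε, hεp, fun M hM => ?_⟩
  set ρ := (CH * ε / M) ^ (1 / a) with hρ
  have hρp : 0 < ρ := by positivity
  have hρa : ρ ^ (-a) = M / (CH * ε) := by
    rw [hρ, ← Real.rpow_mul (by positivity), show 1 / a * (-a) = -1 by field_simp, Real.rpow_neg_one, inv_div]
  set X := 2 * (2 ^ a * CH) * ε with hXd
  have hX : 0 < X := by positivity
  refine ⟨X * ρ ^ (-a), by positivity, ?_⟩
  intro ν _ κ T u hκ hT h hn hM0 t ht x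
  have h00 : (0:ℝ) ∈ Icc 0 T := ⟨le_rfl, hT⟩
  have hP := hB ν κ T u hκ h X ρ hX hρp (by rw [hXd, hε]; apply le_of_eq; field_simp; norm_num) ?_ t ht
  · have hst := mul_nonneg hσ.le ht.1
    refine (hP.le hap hX.le (by positivity) (h.nice t ht) x).trans ?_
    gcongr ?_ * ?_
    exact Real.rpow_le_rpow_of_nonpos hρp (by linarith) (by linarith)
  · intro r hr x
    have b1 : gc d r (u 0) x ≤ CH * ε * ρ ^ (-a) := by
      rw [hρa, mul_div_cancel₀ _ (by positivity)]
      exact gc_le_sup hr (h.nice 0 h00).integrable hM0 x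
    have b2 : gc d r (u 0) x ≤ CH * ε * r ^ (-a) := by
      have := gc_holder hl (by linarith) (h.nice 0 h00).integrable (h.nonneg 0 h00) hn hεp.le hr x
      rw [← ha, Real.mul_rpow (by positivity) hr.le] at this
      linarith
    have b3 : gc d r (u 0) x ≤ CH * ε * (max r ρ) ^ (-a) := by
      rcases le_total r ρ with h | h
      · rw [max_eq_right h]; exact b1
      · rw [max_eq_left h]; exact b2
    refine b3.trans ?_
    have hm : 0 < max r ρ := by positivity
    have : (max r ρ) ^ (-a) = 2 ^ a * (2 * max r ρ) ^ (-a) := by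
      rw [Real.mul_rpow (by norm_num) hm.le, ← mul_assoc, ← Real.rpow_add (by norm_num)]; simp
    rw [this]
    have h4 : (2 * max r ρ) ^ (-a) ≤ (r + ρ) ^ (-a) := Real.rpow_le_rpow_of_nonpos (by positivity) (by linarith [le_max_left r ρ, le_max_right r ρ]) (by linarith)
    calc CH * ε * (2 ^ a * (2 * max r ρ) ^ (-a)) ≤ CH * ε * (2 ^ a * (r + ρ) ^ (-a)) := by gcongr
      _ = _ := by rw [hXd]; ring

lemma bdiff {d : ℕ} {lam : ℝ} (hl : 0 < lam) (hld : lam + 2 < d) : ∃ C : ℝ, 0 < C ∧ ∀ (ν : Measure (EE d)) [IsProbabilityMeasure ν]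
    (w u : EE d → ℝ) (Λ R Z : ℝ), Nice w → Nice u → (∀ x, |w x| ≤ Λ) → (∫ x, |w x|) ≤ 1 → 0 ≤ R → (∀ᵐ z ∂ν, ‖z‖ ≤ R) →
    (∫ x, |w x - u x|) ≤ Z → (∀ x, |w x - u x| ≤ Z) → ∀ x, ‖bn ν lam w x - bn (Measure.dirac 0) lam u x‖ ≤ C * ((1 + Λ) * R + Z) := by
  obtain ⟨C1, hC1, h1⟩ := IR_bdd (d := d) (β := lam + 1) (by linarith) (by linarith)
  obtain ⟨C2, hC2, h2⟩ := IR_bdd (d := d) (β := lam + 2) (by linarith) (by linarith)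
  refine ⟨lam * (lam + 3) * (2 * C2) + 2 * lam * C1, by positivity, ?_⟩
  intro ν _ w u Λ R Z hw hu hΛ hm hR hsupp hZ1 hZ2 x
  have hZ0 : 0 ≤ Z := (abs_nonneg _).trans (hZ2 0)
  have hΛ0 : 0 ≤ Λ := (abs_nonneg _).trans (hΛ 0)
  have e1 : bn (Measure.dirac 0) lam u x = bt lam u x := by unfold bn; simp
  obtain ⟨⟨A, hA⟩, -⟩ := bt_bdds hl hld hw
  have hbc : Continuous (bt lam w) := (bt_contDiff hl (by linarith) hw).continuous
  have hi : Integrable (fun z => bt lam w (x - z)) ν :=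
    Integrable.of_bound (C := A) (hbc.comp (continuous_const.sub continuous_id)).aestronglyMeasurable (ae_of_all _ fun z => hA _)
  have e2 : bn ν lam w x - bt lam w x = ∫ z, (bt lam w (x - z) - bt lam w x) ∂ν := by
    rw [integral_sub hi (integrable_const _)]; simp [bn]
  have hIR : ∀ y, IR (lam + 2) w y ≤ C2 * (1 + Λ) := fun y => (h2 w Λ hw hΛ y).trans (mul_le_mul_of_nonneg_left (by linarith) hC2.le)
  have b1 : ‖bn ν lam w x - bt lam w x‖ ≤ lam * (lam + 3) * (2 * C2) * ((1 + Λ) * R) := by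
    rw [e2]
    have := norm_integral_le_of_norm_le_const (μ := ν) (f := fun z => bt lam w (x - z) - bt lam w x) (C := lam * (lam + 3) * R * (C2 * (1 + Λ) + C2 * (1 + Λ))) (by
      filter_upwards [hsupp] with z hz
      refine (bt_diff hl hld hw _ _).trans ?_
      rw [show x - z - x = -z by abel, norm_neg]
      have := IR_nonneg (lam + 2) w (x - z)
      have := IR_nonneg (lam + 2) w x
      gcongr
      · exact hIR _
      · exact hIR _)
    refine this.trans (le_of_eq ?_)
    simp; ring
  have b2 : ‖bt lam w x - bt lam u x‖ ≤ 2 * lam * C1 * Z := by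
    rw [bt_sub hl (by linarith) hw hu]
    refine (bt_norm_le hl _ x).trans ?_
    have := h1 _ Z (hw.sub hu) hZ2 x
    calc lam * IR (lam + 1) (fun y => w y - u y) x ≤ lam * (C1 * (Z + Z)) := by
          gcongr; exact this.trans (mul_le_mul_of_nonneg_left (by linarith) hC1.le)
      _ = _ := by ring
  rw [e1, show bn ν lam w x - bt lam u x = (bn ν lam w x - bt lam w x) + (bt lam w x - bt lam u x) by abel]
  refine (norm_add_le _ _).trans ((add_le_add b1 b2).trans ?_)
  have p1 : 0 ≤ lam * (lam + 3) * (2 * C2) * Z := by positivity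
  have p2 : 0 ≤ 2 * lam * C1 * ((1 + Λ) * R) := by positivity
  linarith

lemma gc_joint {d : ℕ} {t0 t θ0 : ℝ} {q : ℝ → EE d → ℝ} {θ : ℝ → ℝ} (hθ0 : 0 < θ0) (hθ : ∀ s ∈ Icc t0 t, θ0 ≤ θ s) (hθc : ContinuousOn θ (Icc t0 t))
    (hqi : ∀ s ∈ Icc t0 t, Integrable (q s)) (hqL : ∀ s ∈ Icc t0 t, Tendsto (fun s' => ∫ x, |q s' x - q s x|) (𝓝[Icc t0 t] s) (𝓝 0)) :
    ContinuousOn (fun p : ℝ × EE d => gc d (θ p.1) (q p.1) p.2) (Icc t0 t ×ˢ univ) := by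
  rintro ⟨s, x⟩ hs
  have hs' : s ∈ Icc t0 t := hs.1
  set K := (4 * Real.pi * θ0) ^ (-(d:ℝ)/2) with hK
  have hgkK : ∀ s ∈ Icc t0 t, ∀ y : EE d, gk d (θ s) y ≤ K := by
    intro s hs y
    refine (gk_le (hθ0.trans_le (hθ s hs)) y).trans ?_
    refine Real.rpow_le_rpow_of_nonpos (by positivity) ?_ (by have := d.cast_nonneg (α := ℝ); linarith)
    have := hθ s hs
    gcongr
  have hgkp : ∀ s ∈ Icc t0 t, ∀ y : EE d, 0 ≤ gk d (θ s) y := fun s hs y => (gk_pos (hθ0.trans_le (hθ s hs)) y).le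
  have hfst : Tendsto (fun p : ℝ × EE d => p.1) (𝓝[Icc t0 t ×ˢ univ] (s, x)) (𝓝[Icc t0 t] s) :=
    tendsto_nhdsWithin_iff.2 ⟨continuous_fst.continuousAt.tendsto.mono_left nhdsWithin_le_nhds, by
      filter_upwards [self_mem_nhdsWithin] with p hp using hp.1⟩
  have hev : ∀ᶠ p : ℝ × EE d in 𝓝[Icc t0 t ×ˢ univ] (s, x), p.1 ∈ Icc t0 t := by
    filter_upwards [self_mem_nhdsWithin] with p hp using hp.1
  have B : Tendsto (fun p : ℝ × EE d => gc d (θ p.1) (q s) p.2) (𝓝[Icc t0 t ×ˢ univ] (s, x)) (𝓝 (gc d (θ s) (q s) x)) := by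
    unfold gc
    refine tendsto_integral_filter_of_dominated_convergence (fun y => K * |q s y|) ?_ ?_ ((hqi s hs').abs.const_mul _) ?_
    · filter_upwards [hev] with p hp
      exact ((gk_sub_continuous _ _).aestronglyMeasurable).mul (hqi s hs').1
    · filter_upwards [hev] with p hp
      refine ae_of_all _ fun y => ?_
      rw [norm_mul, Real.norm_of_nonneg (hgkp _ hp _), Real.norm_eq_abs]
      exact mul_le_mul_of_nonneg_right (hgkK _ hp _) (abs_nonneg _)
    · refine ae_of_all _ fun y => Tendsto.mul_const _ ?_
      have h1 : ContinuousOn (fun p : ℝ × EE d => gk d (θ p.1) (p.2 - y)) (Icc t0 t ×ˢ univ) := by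
        refine gk_joint_continuousOn.comp (f := fun p : ℝ × EE d => (θ p.1, p.2 - y)) ?_ (fun p hp => ⟨hθ0.trans_le (hθ _ hp.1), mem_univ _⟩)
        exact (hθc.comp continuousOn_fst fun p hp => hp.1).prodMk (by fun_prop)
      exact h1 (s, x) hs
  have A : Tendsto (fun p : ℝ × EE d => gc d (θ p.1) (q p.1) p.2 - gc d (θ p.1) (q s) p.2) (𝓝[Icc t0 t ×ˢ univ] (s, x)) (𝓝 0) := by
    have h1 := ((hqL s hs').comp hfst).const_mul K
    rw [mul_zero] at h1
    refine squeeze_zero_norm' ?_ h1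
    filter_upwards [hev] with p hp
    have hp0 := hθ0.trans_le (hθ _ hp)
    unfold gc
    rw [← integral_sub (gc_integrable hp0 (hqi _ hp) _) (gc_integrable hp0 (hqi s hs') _)]
    simp only [Function.comp]
    rw [← integral_const_mul]
    refine norm_integral_le_of_norm_le (((hqi _ hp).sub (hqi s hs')).abs.const_mul _) (ae_of_all _ fun y => ?_)
    rw [← mul_sub, norm_mul, Real.norm_of_nonneg (hgkp _ hp _), Real.norm_eq_abs]
    exact mul_le_mul_of_nonneg_right (hgkK _ hp _) (abs_nonneg _)
  have := A.add B
  simp only [sub_add_cancel, zero_add] at this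
  exact this

lemma lintegral_gc {d : ℕ} {r : ℝ} (hr : 0 < r) {f : EE d → ℝ} (hf : Integrable f) (hm : Measurable f) (hf0 : ∀ y, 0 ≤ f y) :
    ∫⁻ x, ENNReal.ofReal (gc d r f x) = ENNReal.ofReal (∫ y, f y) := by
  simp_rw [ofReal_gc hr hf hf0]
  unfold GG
  have hgc := gk_continuous (d := d) r
  rw [lintegral_lintegral_swap (by
    refine Measurable.aemeasurable ?_
    unfold Function.uncurry; fun_prop)]
  have : ∀ y, ∫⁻ x, ENNReal.ofReal (gk d r (x - y)) * ENNReal.ofReal (f y) = ENNReal.ofReal (f y) := by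
    intro y
    rw [lintegral_mul_const _ (by fun_prop)]
    have : ∫⁻ x, ENNReal.ofReal (gk d r (x - y)) = 1 := by
      rw [lintegral_sub_right_eq_self (fun x => ENNReal.ofReal (gk d r x)) y,
        ← ofReal_integral_eq_lintegral_ofReal (gk_integrable hr) (ae_of_all _ fun x => (gk_pos hr x).le), gk_integral_aux hr]
      simp
    rw [this, one_mul]
  simp_rw [this]
  rw [ofReal_integral_eq_lintegral_ofReal hf (ae_of_all _ hf0)]

lemma L1_of {d : ℕ} {t0 t θ0 : ℝ} (ht : t0 ≤ t) {q : ℝ → EE d → ℝ} {θ k : ℝ → ℝ} {G : EE d → ℝ} (hθ0 : 0 < θ0) (hθ : ∀ s ∈ Icc t0 t, θ0 ≤ θ s) (hθc : ContinuousOn θ (Icc t0 t))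
    (hkc : ContinuousOn k (Icc t0 t)) (hk0 : ∀ s ∈ Icc t0 t, 0 ≤ k s)
    (hqi : ∀ s ∈ Icc t0 t, Integrable (q s)) (hqm : ∀ s ∈ Icc t0 t, Measurable (q s)) (hq0 : ∀ s ∈ Icc t0 t, ∀ x, 0 ≤ q s x)
    (hqL : ∀ s ∈ Icc t0 t, Tendsto (fun s' => ∫ x, |q s' x - q s x|) (𝓝[Icc t0 t] s) (𝓝 0))
    (hm : ∀ (x : EE d) (H h : ℝ → ℝ), ContinuousOn H (Icc t0 t) → (∀ s ∈ Ioo t0 t, HasDerivAt H (h s) s) →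
      (∀ s ∈ Ioo t0 t, k s * gc d (θ s) (q s) x ≤ h s) → |G x| ≤ H t - H t0)
    {H h : ℝ → ℝ} (hH : ContinuousOn H (Icc t0 t)) (hHd : ∀ s ∈ Ioo t0 t, HasDerivAt H (h s) s)
    (hh : ∀ s ∈ Ioo t0 t, k s * ∫ y, q s y ≤ h s) :
    ∫⁻ x, ENNReal.ofReal |G x| ≤ ENNReal.ofReal (H t - H t0) := by
  have hj := gc_joint hθ0 hθ hθc hqi hqL
  set J : ℝ → EE d → ℝ := fun s x => k s * gc d (θ s) (q s) x with hJ
  have hJc : ContinuousOn (fun p : ℝ × EE d => J p.1 p.2) (Icc t0 t ×ˢ univ) :=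
    (hkc.comp continuousOn_fst fun p hp => hp.1).mul hj
  have hJ0 : ∀ s ∈ Icc t0 t, ∀ x, 0 ≤ J s x := fun s hs x => mul_nonneg (hk0 s hs) (gc_nonneg (hθ0.trans_le (hθ s hs)) (hq0 s hs) x)
  have hJs : ∀ x, ContinuousOn (fun s => J s x) (Icc t0 t) := fun x =>
    hJc.comp (f := fun s : ℝ => (s, x)) (by fun_prop) (fun s hs => ⟨hs, mem_univ x⟩)
  have b1 : ∀ x, ENNReal.ofReal |G x| ≤ ∫⁻ s in Ioc t0 t, ENNReal.ofReal (J s x) := by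
    intro x
    have hJint : IntervalIntegrable (fun s => J s x) volume t0 t := (hJs x).intervalIntegrable_of_Icc ht
    have h1 := hm x (fun s => ∫ τ in t0..s, J τ x) (fun s => J s x)
      (by
        have := intervalIntegral.continuousOn_primitive_interval (f := fun s => J s x) (μ := volume) (a := t0) (b := t) (by
          rw [uIcc_of_le ht]; exact (hJs x).integrableOn_Icc)
        rwa [uIcc_of_le ht] at this)
      (fun s hs => by
        have hJint' : IntervalIntegrable (fun s => J s x) volume t0 s := hJint.mono_set (by
          rw [uIcc_of_le ht, uIcc_of_le hs.1.le]; exact Icc_subset_Icc_right hs.2.le)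
        refine intervalIntegral.integral_hasDerivAt_right hJint' ?_ ((hJs x).continuousAt (Icc_mem_nhds hs.1 hs.2))
        exact ((hJs x).mono Ioo_subset_Icc_self).stronglyMeasurableAtFilter isOpen_Ioo s hs)
      (fun s _ => le_rfl)
    simp only [intervalIntegral.integral_same, sub_zero] at h1
    refine (ENNReal.ofReal_le_ofReal h1).trans (le_of_eq ?_)
    rw [intervalIntegral.integral_of_le ht, ofReal_integral_eq_lintegral_ofReal hJint.1]
    exact (ae_restrict_iff' measurableSet_Ioc).2 (ae_of_all _ fun s hs => hJ0 s (Ioc_subset_Icc_self hs) x)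
  refine (lintegral_mono b1).trans ?_
  rw [lintegral_lintegral_swap (by
    have h1 : AEMeasurable (fun p : EE d × ℝ => J p.2 p.1) ((volume.prod volume).restrict (univ ×ˢ Ioc t0 t)) := by
      refine ContinuousOn.aemeasurable ?_ (MeasurableSet.univ.prod measurableSet_Ioc)
      exact hJc.comp (f := fun p : EE d × ℝ => (p.2, p.1)) (by fun_prop) (fun p hp => ⟨Ioc_subset_Icc_self hp.2, mem_univ _⟩)
    rw [← Measure.prod_restrict, Measure.restrict_univ] at h1
    exact h1.ennreal_ofReal)]
  have b2 : ∫⁻ s in Ioc t0 t, ∫⁻ x, ENNReal.ofReal (J s x) ≤ ∫⁻ s in Ioc t0 t, ENNReal.ofReal (h s) := by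
    rw [← restrict_Ioo_eq_restrict_Ioc]
    refine setLIntegral_mono' measurableSet_Ioo fun s hs => ?_
    have hs' := Ioo_subset_Icc_self hs
    simp only [hJ]
    simp_rw [ENNReal.ofReal_mul (hk0 s hs')]
    rw [lintegral_const_mul' _ _ ENNReal.ofReal_ne_top, lintegral_gc (hθ0.trans_le (hθ s hs')) (hqi s hs') (hqm s hs') (hq0 s hs'),
      ← ENNReal.ofReal_mul (hk0 s hs')]
    exact ENNReal.ofReal_le_ofReal (hh s hs)
  refine b2.trans ?_
  have h0 : ∀ s ∈ Ioo t0 t, 0 ≤ h s := fun s hs => le_trans (mul_nonneg (hk0 s (Ioo_subset_Icc_self hs)) (integral_nonneg (hq0 s (Ioo_subset_Icc_self hs)))) (hh s hs)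
  have hJint := intervalIntegral.integrableOn_deriv_of_nonneg hH hHd h0
  have := intervalIntegral.integral_eq_sub_of_hasDerivAt_of_le ht hH hHd ((intervalIntegrable_iff_integrableOn_Ioc_of_le ht).2 hJint)
  rw [← this, intervalIntegral.integral_of_le ht, ofReal_integral_eq_lintegral_ofReal hJint]
  rw [← restrict_Ioo_eq_restrict_Ioc]
  exact (ae_restrict_iff' measurableSet_Ioo).2 (ae_of_all _ h0)

lemma lapl_sub' {d : ℕ} {f g : EE d → ℝ} (hf : ContDiff ℝ 2 f) (hg : ContDiff ℝ 2 g) (x : EE d) :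
    lapl (fun y => f y - g y) x = lapl f x - lapl g x := by
  unfold lapl
  rw [← Finset.sum_sub_distrib]
  refine Finset.sum_congr rfl fun i _ => ?_
  have e : (fun y => fderiv ℝ (fun y => f y - g y) y (EuclideanSpace.single i 1)) =
      fun y => fderiv ℝ f y (EuclideanSpace.single i 1) - fderiv ℝ g y (EuclideanSpace.single i 1) := by
    funext y
    rw [fderiv_fun_sub (hf.differentiable (by simp) y) (hg.differentiable (by simp) y)]; rfl
  have d1 : DifferentiableAt ℝ (fun y => fderiv ℝ f y (EuclideanSpace.single i 1)) x :=
    ((hf.fderiv_right (m := 1) (by norm_num)).clm_apply contDiff_const).differentiable (by simp) x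
  have d2 : DifferentiableAt ℝ (fun y => fderiv ℝ g y (EuclideanSpace.single i 1)) x :=
    ((hg.fderiv_right (m := 1) (by norm_num)).clm_apply contDiff_const).differentiable (by simp) x
  rw [e, fderiv_fun_sub d1 d2]; rfl

lemma diverg_sub' {d : ℕ} {f g : EE d → EE d} (hf : ContDiff ℝ 1 f) (hg : ContDiff ℝ 1 g) (x : EE d) :
    diverg (fun y => f y - g y) x = diverg f x - diverg g x := by
  unfold diverg
  rw [← Finset.sum_sub_distrib]
  refine Finset.sum_congr rfl fun i _ => ?_
  have d1 : DifferentiableAt ℝ (fun y => f y i) x := by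
    have := hf.differentiable (by simp) x
    fun_prop
  have d2 : DifferentiableAt ℝ (fun y => g y i) x := by
    have := hg.differentiable (by simp) x
    fun_prop
  rw [show (fun y => (f y - g y) i) = fun y => f y i - g y i from rfl, fderiv_fun_sub d1 d2]; rfl

lemma diff_mild {d : ℕ} {lam : ℝ} (hl : 0 < lam) (hld : lam + 2 < d) {ν : Measure (EE d)} [IsProbabilityMeasure ν]
    {σ κ T : ℝ} {w u : ℝ → EE d → ℝ} (hσ : 0 < σ) (hκ : |κ| = 1) (hw : Sol ν lam σ κ T w) (hu : Sol (Measure.dirac 0) lam σ κ T u)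
    (h0 : ∀ x, w 0 x = u 0 x) {B Em : ℝ} {E : ℝ → ℝ} (hB : 0 ≤ B) (hE : ∀ s ∈ Icc 0 T, E s ≤ Em)
    (hF : ∀ s ∈ Icc 0 T, ∀ y, ‖w s y • bn ν lam (w s) y - u s y • bn (Measure.dirac 0) lam (u s) y‖ ≤ B * |w s y - u s y| + E s * u s y)
    {r t : ℝ} (hr : 0 < r) (ht : t ∈ Icc 0 T) (x : EE d) (H h : ℝ → ℝ) (hHc : ContinuousOn H (Icc 0 t)) (hH : ∀ s ∈ Ioo 0 t, HasDerivAt H (h s) s)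
    (hh : ∀ s ∈ Ioo 0 t, (2:ℝ) ^ ((d : ℝ) / 2) * (r + σ * (t - s)) ^ (-(1:ℝ)/2) * gc d (2 * (r + σ * (t - s))) (fun y => B * |w s y - u s y| + E s * u s y) x ≤ h s) :
    |gc d r (fun y => w t y - u t y) x| ≤ H t - H 0 := by
  have hsub : Icc 0 t ⊆ Icc 0 T := Icc_subset_Icc le_rfl ht.2
  have hsub' : Ioo 0 t ⊆ Ioo 0 T := Ioo_subset_Ioo le_rfl ht.2
  have hin : ∀ s ∈ Ioo 0 t, s ∈ Icc 0 T := fun s hs => hsub (Ioo_subset_Icc_self hs)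
  have hFw : ∀ s ∈ Ioo 0 T, ContDiff ℝ 1 (fun z => w s z • bn ν lam (w s) z) := fun s hs =>
    ((hw.nice s (Ioo_subset_Icc_self hs)).smooth.of_le (by exact_mod_cast le_top)).smul (bn_contDiff ν hl hld (hw.nice s (Ioo_subset_Icc_self hs)))
  have hFu : ∀ s ∈ Ioo 0 T, ContDiff ℝ 1 (fun z => u s z • bn (Measure.dirac 0) lam (u s) z) := fun s hs =>
    ((hu.nice s (Ioo_subset_Icc_self hs)).smooth.of_le (by exact_mod_cast le_top)).smul (bn_contDiff _ hl hld (hu.nice s (Ioo_subset_Icc_self hs)))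
  have hzi : ∀ s ∈ Icc 0 T, Integrable (fun y => w s y - u s y) := fun s hs => ((hw.nice s hs).sub (hu.nice s hs)).integrable
  have hqi : ∀ s ∈ Icc 0 T, Integrable (fun y => B * |w s y - u s y| + E s * u s y) := fun s hs =>
    ((hzi s hs).abs.const_mul B).add ((hu.nice s hs).integrable.const_mul _)
  have hF1 : ∀ s ∈ Ioo 0 T, ContDiff ℝ 1 (fun z => w s z • bn ν lam (w s) z - u s z • bn (Measure.dirac 0) lam (u s) z) :=
    fun s hs => (hFw s hs).sub (hFu s hs)
  have hFi : ∀ s ∈ Ioo 0 t, Integrable (fun z => ‖w s z • bn ν lam (w s) z - u s z • bn (Measure.dirac 0) lam (u s) z‖) := by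
    intro s hs
    refine (hqi s (hin s hs)).mono' (hF1 s (hsub' hs)).continuous.norm.aestronglyMeasurable (ae_of_all _ fun y => ?_)
    rw [norm_norm]; exact hF s (hin s hs) y
  have hz2 : ∀ s ∈ Icc 0 T, ∫ y, |w s y - u s y| ≤ 2 := by
    intro s hs
    have i1 := (hw.nice s hs).integrable
    have i2 := (hu.nice s hs).integrable
    calc _ ≤ ∫ y, (w s y + u s y) := integral_mono (hzi s hs).abs (i1.add i2) fun y => by
            have a := hw.nonneg s hs y
            have b := hu.nonneg s hs y
            exact abs_le.2 ⟨by linarith, by linarith⟩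
      _ = 2 := by rw [integral_add i1 i2, hw.mass s hs, hu.mass s hs]; norm_num
  have heq : ∀ s ∈ Ioo 0 T, ∀ x, HasDerivAt (fun s => w s x - u s x) (σ * lapl (fun y => w s y - u s y) x -
      κ * diverg (fun z => w s z • bn ν lam (w s) z - u s z • bn (Measure.dirac 0) lam (u s) z) x) s := by
    intro s hs x
    have hs' := Ioo_subset_Icc_self hs
    refine ((hw.eqn s hs x).fun_sub (hu.eqn s hs x)).congr_deriv ?_
    rw [lapl_sub' ((hw.nice s hs').smooth.of_le two_le_top') ((hu.nice s hs').smooth.of_le two_le_top'), diverg_sub' (hFw s hs) (hFu s hs)]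
    ring
  have hsm : ContDiffOn ℝ (⊤ : ℕ∞) (fun p : ℝ × EE d => w p.1 p.2 - u p.1 p.2) (Icc 0 T ×ˢ univ) := hw.smooth.sub hu.smooth
  have main := mild (c := max 2 (B * 2 + Em)) hσ hκ hr ht.1 (f := fun s y => w s y - u s y)
    (F := fun s z => w s z • bn ν lam (w s) z - u s z • bn (Measure.dirac 0) lam (u s) z) (hsm.continuousOn.mono (prod_mono hsub subset_rfl))
    (fun s hs => ((hw.nice s (hin s hs)).sub (hu.nice s (hin s hs))).smooth.of_le two_le_top') (fun s hs => hF1 s (hsub' hs))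
    (fun s hs => heq s (hsub' hs)) ((deriv_cont hsm heq).mono (prod_mono hsub' subset_rfl)) (fun s hs => hzi s (hsub hs))
    (fun s hs => (hz2 s (hsub hs)).trans (le_max_left _ _)) hFi ?_ hHc hH x ?_
  · have e : gc d (r + σ * (t - 0)) (fun y => w 0 y - u 0 y) x = 0 := by
      unfold gc; simp [h0]
    rw [e, sub_zero] at main
    exact main
  · intro s hs
    have hs' := hin s hs
    calc _ ≤ ∫ y, (B * |w s y - u s y| + E s * u s y) := integral_mono (hFi s hs) (hqi s hs') (hF s hs')
      _ = B * (∫ y, |w s y - u s y|) + E s := by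
          rw [integral_add (by exact (hzi s hs').abs.const_mul B) (by exact (hu.nice s hs').integrable.const_mul _), integral_const_mul, integral_const_mul, hu.mass s hs', mul_one]
      _ ≤ B * 2 + Em := add_le_add (mul_le_mul_of_nonneg_left (hz2 s hs') hB) (hE s hs')
      _ ≤ _ := le_max_right _ _
  · intro s hs
    have hA : 0 < r + σ * (t - s) := by have : 0 < t - s := by linarith [hs.2]
                                        positivity
    refine le_trans ?_ (hh s hs)
    refine mul_le_mul_of_nonneg_left ?_ (by positivity)
    unfold gc
    have hg := gc_integrable (d := d) (r := 2 * (r + σ * (t - s))) (by positivity) (hqi s (hin s hs)) x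
    refine integral_mono_of_nonneg (ae_of_all _ fun y => ?_) hg (ae_of_all _ fun y => ?_)
    · exact mul_nonneg (norm_nonneg _) (gk_pos (by positivity) _).le
    · have := mul_le_mul_of_nonneg_right (hF s (hin s hs) y) (gk_pos (d := d) (s := 2 * (r + σ * (t - s))) (by positivity) (x - y)).le
      refine this.trans (le_of_eq ?_)
      ring

lemma scal {d : ℕ} {σ T c1 c2 : ℝ} (hσ : 0 < σ) (hT : 0 ≤ T) (hc1 : 0 < c1) (hc2 : 0 ≤ c2) : ∃ μ : ℝ, 0 < μ ∧ ∀ S η r t : ℝ, 0 ≤ S → 0 ≤ η → 0 < r → r ≤ 1 → t ∈ Icc 0 T →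
    ∃ H h : ℝ → ℝ, ContinuousOn H (Icc 0 t) ∧ (∀ s ∈ Ioo 0 t, HasDerivAt H (h s) s) ∧
      (∀ s ∈ Ioo 0 t, (2:ℝ) ^ ((d : ℝ) / 2) * (r + σ * (t - s)) ^ (-(1:ℝ)/2) * (c1 * (S * Real.exp (μ * s)) + c2 * η) ≤ h s) ∧
      H t - H 0 ≤ ((2:ℝ) ^ ((d : ℝ) / 2) * c2 * (2 / σ) * √(1 + σ * T)) * η + S / 2 * Real.exp (μ * t) := by
  set D := (2:ℝ) ^ ((d : ℝ) / 2) with hD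
  have hDp : 0 < D := by positivity
  set P := D * c1 * (4 / σ) * (1 + σ * T) ^ ((1:ℝ)/4) with hP
  have hPp : 0 < P := by positivity
  set n := 1 / (4 * P) with hn
  have hnp : 0 < n := by positivity
  set N := 1 / n ^ 2 with hN
  have hNp : 0 < N := by positivity
  set μ := 4 * D * c1 * N with hμ
  have hμp : 0 < μ := by positivity
  refine ⟨μ, hμp, ?_⟩
  intro S η r t hS hη hr hr1 ht
  refine ⟨fun s => D * (c1 * S * (N / μ * Real.exp (μ * s) - n * (4 / σ) * (r + σ * (t - s)) ^ ((1:ℝ)/4) * Real.exp (μ * t)) - c2 * η * (2 / σ) * √(r + σ * (t - s))),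
    fun s => D * (c1 * S * (N * Real.exp (μ * s) + n * (r + σ * (t - s)) ^ (-(3:ℝ)/4) * Real.exp (μ * t)) + c2 * η * (√(r + σ * (t - s)))⁻¹), ?_, ?_, ?_, ?_⟩
  · have : Continuous fun s : ℝ => (r + σ * (t - s)) ^ ((1:ℝ)/4) := Continuous.rpow_const (by fun_prop) (fun _ => Or.inr (by norm_num))
    fun_prop
  · intro s hs
    have hA : 0 < r + σ * (t - s) := by have : 0 < t - s := by linarith [hs.2]
                                        positivity
    have d0 : HasDerivAt (fun s => r + σ * (t - s)) (-σ) s := by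
      have := (((hasDerivAt_id' s).const_sub t).const_mul σ).const_add r
      simpa using this
    have d2 := d0.sqrt hA.ne'
    have d3 := d0.rpow_const (p := (1:ℝ)/4) (Or.inl hA.ne')
    have d4 : HasDerivAt (fun s => Real.exp (μ * s)) (Real.exp (μ * s) * (μ * 1)) s := ((hasDerivAt_id' s).const_mul μ).exp
    refine (((((d4.const_mul (N / μ)).fun_sub ((d3.const_mul (n * (4 / σ))).mul_const (Real.exp (μ * t)))).const_mul (c1 * S)).fun_sub (d2.const_mul (c2 * η * (2 / σ)))).const_mul D).congr_deriv ?_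
    rw [show (1:ℝ)/4 - 1 = -(3:ℝ)/4 by norm_num]
    field_simp
    ring
  · intro s hs
    have hA : 0 < r + σ * (t - s) := by have : 0 < t - s := by linarith [hs.2]
                                        positivity
    set A := r + σ * (t - s)
    have key : A ^ (-(1:ℝ)/2) ≤ N + n * A ^ (-(3:ℝ)/4) := by
      set a := A ^ (-(1:ℝ)/4) with ha
      have hap : 0 < a := by positivity
      have e1 : A ^ (-(1:ℝ)/2) = a ^ 2 := by rw [ha, ← Real.rpow_natCast, ← Real.rpow_mul hA.le]; norm_num
      have e2 : A ^ (-(3:ℝ)/4) = a ^ 3 := by rw [ha, ← Real.rpow_natCast, ← Real.rpow_mul hA.le]; norm_num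
      rw [e1, e2]
      rcases le_total (n * a) 1 with q | q
      · have : a ^ 2 ≤ N := by
          rw [hN, le_div_iff₀ (by positivity), ← mul_pow, mul_comm a n]
          exact pow_le_one₀ (by positivity) q
        have : 0 ≤ n * a ^ 3 := by positivity
        linarith
      · have : a ^ 2 ≤ n * a ^ 3 := by
          rw [show n * a ^ 3 = (n * a) * a ^ 2 by ring]
          exact le_mul_of_one_le_left (by positivity) q
        linarith
    have hexp : Real.exp (μ * s) ≤ Real.exp (μ * t) := Real.exp_le_exp.2 (mul_le_mul_of_nonneg_left hs.2.le hμp.le)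
    have k1 : A ^ (-(1:ℝ)/2) * Real.exp (μ * s) ≤ N * Real.exp (μ * s) + n * A ^ (-(3:ℝ)/4) * Real.exp (μ * t) := by
      calc _ ≤ (N + n * A ^ (-(3:ℝ)/4)) * Real.exp (μ * s) := by gcongr
        _ = N * Real.exp (μ * s) + n * A ^ (-(3:ℝ)/4) * Real.exp (μ * s) := by ring
        _ ≤ _ := by gcongr
    have k2 := mul_le_mul_of_nonneg_left k1 (by positivity : 0 ≤ D * (c1 * S))
    show _ ≤ D * (c1 * S * (N * Real.exp (μ * s) + n * A ^ (-(3:ℝ)/4) * Real.exp (μ * t)) + c2 * η * (√A)⁻¹)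
    rw [← rpow_neg_half hA]
    linarith
  · have hA : r + σ * t ≤ 1 + σ * T := by have := mul_le_mul_of_nonneg_left ht.2 hσ.le; linarith
    have hA0 : 0 < r + σ * t := by have := mul_nonneg hσ.le ht.1; linarith
    simp only [sub_self, sub_zero, mul_zero, add_zero, Real.exp_zero, mul_one]
    have a1 : √(r + σ * t) ≤ √(1 + σ * T) := Real.sqrt_le_sqrt hA
    have a2 : (r + σ * t) ^ ((1:ℝ)/4) ≤ (1 + σ * T) ^ ((1:ℝ)/4) := Real.rpow_le_rpow hA0.le hA (by norm_num)
    have b1 : D * (c2 * η * (2 / σ) * √(r + σ * t)) ≤ D * (c2 * η * (2 / σ) * √(1 + σ * T)) := by gcongr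
    have b2 : D * (c1 * S * (n * (4 / σ) * (r + σ * t) ^ ((1:ℝ)/4) * Real.exp (μ * t))) ≤ D * (c1 * S * (n * (4 / σ) * (1 + σ * T) ^ ((1:ℝ)/4) * Real.exp (μ * t))) := by gcongr
    have b3 : D * (c1 * S * (n * (4 / σ) * (1 + σ * T) ^ ((1:ℝ)/4) * Real.exp (μ * t))) = S / 4 * Real.exp (μ * t) := by
      rw [show D * (c1 * S * (n * (4 / σ) * (1 + σ * T) ^ ((1:ℝ)/4) * Real.exp (μ * t))) = P * n * (S * Real.exp (μ * t)) by rw [hP]; ring, hn]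
      field_simp
    have b4 : D * (c1 * S * (N / μ * Real.exp (μ * t))) = S / 4 * Real.exp (μ * t) := by
      rw [hμ]; field_simp
    have c1' : 0 ≤ D * (c1 * S * (N / μ)) := by positivity
    have c2' : 0 ≤ D * (c1 * S * (n * (4 / σ) * r ^ ((1:ℝ)/4) * Real.exp (μ * t))) := by positivity
    have c3' : 0 ≤ D * (c2 * η * (2 / σ) * √r) := by positivity
    linarith

def KS {d : ℕ} (μ T : ℝ) (w u : ℝ → EE d → ℝ) (S : ℝ) : Prop := ∀ s ∈ Icc 0 T, (∫ x, |w s x - u s x|) ≤ S * Real.exp (μ * s) ∧ ∀ x, |w s x - u s x| ≤ S * Real.exp (μ * s)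

lemma gc_cont {d : ℕ} {r : ℝ} (hr : 0 < r) {f : EE d → ℝ} (hf : Integrable f) : Continuous (fun x => gc d r f x) := by
  have hc := gc_joint (t0 := 0) (t := 0) (q := fun _ => f) (θ := fun _ => r) hr (fun _ _ => le_rfl) continuousOn_const (fun _ _ => hf) (fun s _ => by simp only [sub_self, abs_zero, integral_zero]; exact tendsto_const_nhds)
  rw [← continuousOn_univ]
  exact hc.comp (f := fun x : EE d => ((0:ℝ), x)) (by fun_prop) (fun x _ => ⟨by simp, mem_univ _⟩)

set_option maxHeartbeats 1000000 in
lemma step {d : ℕ} {lam : ℝ} (hl : 0 < lam) (hld : lam + 2 < d) {σ T Λ R : ℝ} (hσ : 0 < σ) (hT : 0 ≤ T) (hΛ : 0 < Λ) (hR : 0 < R) :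
    ∃ C μ : ℝ, 0 < C ∧ 0 < μ ∧ ∀ (ν : Measure (EE d)) [IsProbabilityMeasure ν] (κ η : ℝ) (w u : ℝ → EE d → ℝ), |κ| = 1 → 0 < η →
      (∀ᵐ z ∂ν, ‖z‖ ≤ R * η) → Sol ν lam σ κ T w → Sol (Measure.dirac 0) lam σ κ T u → (∀ x, w 0 x = u 0 x) →
      (∀ s ∈ Icc 0 T, ∀ x, w s x ≤ Λ) → (∀ s ∈ Icc 0 T, ∀ x, u s x ≤ Λ) → ∀ S, 0 ≤ S → KS μ T w u S → KS μ T w u (C * η + S / 2) := by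
  obtain ⟨Cb, hCb, hb⟩ := Sol.b_bdd (d := d) hl hld
  obtain ⟨C2, hC2, hbd⟩ := bdiff (d := d) hl hld
  set B := Cb * (1 + Λ) with hB
  have hBp : 0 < B := by positivity
  set c1 := B + C2 * (Λ + 1) with hc1
  set c2 := C2 * ((1 + Λ) * R) * (Λ + 1) with hc2
  have hc1p : 0 < c1 := by positivity
  have hc2p : 0 < c2 := by positivity
  obtain ⟨μ, hμ, hsc⟩ := scal (d := d) hσ hT hc1p hc2p.le
  set C := ((2:ℝ) ^ ((d : ℝ) / 2) * c2 * (2 / σ) * √(1 + σ * T)) with hC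
  have hCp : 0 < C := by positivity
  refine ⟨C, μ, hCp, hμ, ?_⟩
  intro ν _ κ η w u hκ hη hsupp hw hu h0 hwΛ huΛ S hS hK t ht
  set E : ℝ → ℝ := fun s => C2 * ((1 + Λ) * (R * η) + S * Real.exp (μ * s)) with hE
  have hE0 : ∀ s, 0 ≤ E s := fun s => by rw [hE]; positivity
  have hEm : ∀ s ∈ Icc 0 T, E s ≤ E T := by
    intro s hs
    have : Real.exp (μ * s) ≤ Real.exp (μ * T) := Real.exp_le_exp.2 (mul_le_mul_of_nonneg_left hs.2 hμ.le)
    simp only [hE]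
    gcongr
  have hwa : ∀ s ∈ Icc 0 T, ∀ x, |w s x| ≤ Λ := fun s hs x => by rw [abs_of_nonneg (hw.nonneg s hs x)]; exact hwΛ s hs x
  have hwm : ∀ s ∈ Icc 0 T, ∫ x, |w s x| = 1 := fun s hs => by
    rw [integral_congr_ae (ae_of_all _ fun y => abs_of_nonneg (hw.nonneg s hs y)), hw.mass s hs]
  set q : ℝ → EE d → ℝ := fun s y => B * |w s y - u s y| + E s * u s y with hq
  have hF : ∀ s ∈ Icc 0 T, ∀ y, ‖w s y • bn ν lam (w s) y - u s y • bn (Measure.dirac 0) lam (u s) y‖ ≤ B * |w s y - u s y| + E s * u s y := by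
    intro s hs y
    have e : w s y • bn ν lam (w s) y - u s y • bn (Measure.dirac 0) lam (u s) y =
      (w s y - u s y) • bn ν lam (w s) y + u s y • (bn ν lam (w s) y - bn (Measure.dirac 0) lam (u s) y) := by
      rw [sub_smul, smul_sub]; abel
    rw [e]
    refine (norm_add_le _ _).trans ?_
    rw [norm_smul, norm_smul, Real.norm_eq_abs, Real.norm_of_nonneg (hu.nonneg s hs y), mul_comm B, mul_comm (E s)]
    have b1 := hb ν (w s) Λ (hw.nice s hs) (hwa s hs) y
    rw [hwm s hs] at b1
    have b2 := hbd ν (w s) (u s) Λ (R * η) (S * Real.exp (μ * s)) (hw.nice s hs) (hu.nice s hs) (hwa s hs) (hwm s hs).le (by positivity) hsupp (hK s hs).1 (hK s hs).2 y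
    exact add_le_add (mul_le_mul_of_nonneg_left b1 (abs_nonneg _)) (mul_le_mul_of_nonneg_left b2 (hu.nonneg s hs y))
  have hsub : Icc 0 t ⊆ Icc 0 T := Icc_subset_Icc le_rfl ht.2
  have hin : ∀ s ∈ Ioo 0 t, s ∈ Icc 0 T := fun s hs => hsub (Ioo_subset_Icc_self hs)
  have hzn : ∀ s ∈ Icc 0 T, Nice (fun y => w s y - u s y) := fun s hs => (hw.nice s hs).sub (hu.nice s hs)
  have hzi : ∀ s ∈ Icc 0 T, Integrable (fun y => |w s y - u s y|) := fun s hs => (hzn s hs).integrable.abs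
  have hqi : ∀ s ∈ Icc 0 T, Integrable (q s) := fun s hs =>
    ((hzi s hs).const_mul B).add ((hu.nice s hs).integrable.const_mul _)
  have hq0 : ∀ s ∈ Icc 0 T, ∀ y, 0 ≤ q s y := fun s hs y => by
    have := hu.nonneg s hs y
    have := hE0 s
    simp only [hq]; positivity
  have hEb : ∀ s, B * (S * Real.exp (μ * s)) + E s * (Λ + 1) = c1 * (S * Real.exp (μ * s)) + c2 * η := by
    intro s; simp only [hE, hc1, hc2]; ring
  have hqs : ∀ s ∈ Icc 0 T, ∀ y, q s y ≤ c1 * (S * Real.exp (μ * s)) + c2 * η := by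
    intro s hs y
    rw [← hEb]
    have := huΛ s hs y
    exact add_le_add (mul_le_mul_of_nonneg_left ((hK s hs).2 y) hBp.le) (mul_le_mul_of_nonneg_left (by linarith) (hE0 s))
  have hqm : ∀ s ∈ Icc 0 T, ∫ y, q s y ≤ c1 * (S * Real.exp (μ * s)) + c2 * η := by
    intro s hs
    rw [← hEb]
    simp only [hq]
    rw [integral_add (by exact (hzi s hs).const_mul B) (by exact (hu.nice s hs).integrable.const_mul _), integral_const_mul, integral_const_mul, hu.mass s hs]
    exact add_le_add (mul_le_mul_of_nonneg_left (hK s hs).1 hBp.le) (mul_le_mul_of_nonneg_left (by linarith) (hE0 s))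
  have hexp1 : 1 ≤ Real.exp (μ * t) := Real.one_le_exp (mul_nonneg hμ.le ht.1)
  have hfin : C * η + S / 2 * Real.exp (μ * t) ≤ (C * η + S / 2) * Real.exp (μ * t) := by
    have := mul_le_mul_of_nonneg_left hexp1 (by positivity : 0 ≤ C * η)
    linarith
  have hrn : ∀ n : ℕ, 0 < (1 / ((n:ℝ) + 1)) ^ 2 ∧ (1 / ((n:ℝ) + 1)) ^ 2 ≤ 1 := by
    intro n
    refine ⟨by positivity, pow_le_one₀ (by positivity) ?_⟩
    rw [div_le_one (by positivity)]
    have : (0:ℝ) ≤ n := by positivity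
    linarith
  obtain ⟨L, hL0, hL⟩ := (hzn t ht).bdd
  have hApos : ∀ r, 0 < r → ∀ s ∈ Icc 0 t, r ≤ r + σ * (t - s) := fun r hr s hs => by nlinarith [hs.2]
  have hsup : ∀ r, 0 < r → r ≤ 1 → ∀ x, |gc d r (fun y => w t y - u t y) x| ≤ C * η + S / 2 * Real.exp (μ * t) := by
    intro r hr hr1 x
    obtain ⟨H, h, g1, g2, g3, g4⟩ := hsc S η r t hS hη.le hr hr1 ht
    refine (diff_mild hl hld hσ hκ hw hu h0 hBp.le hEm hF hr ht x H h g1 g2 fun s hs => ?_).trans g4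
    have hA := hr.trans_le (hApos r hr s (Ioo_subset_Icc_self hs))
    refine le_trans ?_ (g3 s hs)
    refine mul_le_mul_of_nonneg_left ?_ (by positivity)
    exact gc_le_sup (by positivity) (hqi s (hin s hs)) (hqs s (hin s hs)) x
  have hEc : Continuous E := by simp only [hE]; fun_prop
  have hL1 : ∀ r, 0 < r → r ≤ 1 → ∫⁻ x, ENNReal.ofReal |gc d r (fun y => w t y - u t y) x| ≤ ENNReal.ofReal (C * η + S / 2 * Real.exp (μ * t)) := by
    intro r hr hr1
    obtain ⟨H, h, g1, g2, g3, g4⟩ := hsc S η r t hS hη.le hr hr1 ht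
    refine (L1_of (q := q) (θ := fun s => 2 * (r + σ * (t - s))) (k := fun s => (2:ℝ) ^ ((d : ℝ) / 2) * (r + σ * (t - s)) ^ (-(1:ℝ)/2)) (θ0 := 2 * r)
      ht.1 (by positivity) (fun s hs => by have := hApos r hr s hs; linarith) (by fun_prop) ?_ ?_ (fun s hs => hqi s (hsub hs)) ?_
      (fun s hs => hq0 s (hsub hs)) ?_ (fun x H h g1 g2 g3 => diff_mild hl hld hσ hκ hw hu h0 hBp.le hEm hF hr ht x H h g1 g2 g3) g1 g2 ?_).trans (ENNReal.ofReal_le_ofReal g4)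
    · refine ContinuousOn.mul continuousOn_const (ContinuousOn.rpow_const (by fun_prop) fun s hs => Or.inl ?_)
      exact (hr.trans_le (hApos r hr s hs)).ne'
    · intro s hs
      have := hr.trans_le (hApos r hr s hs)
      positivity
    · intro s hs
      have c1 := (hw.nice s (hsub hs)).continuous.measurable
      have c2 := (hu.nice s (hsub hs)).continuous.measurable
      simp only [hq]
      have := (c1.sub c2).norm
      exact (this.const_mul B).add (c2.const_mul _)
    · intro s hs
      have hs' := hsub hs
      have l1 := (hw.L1cont hs').mono_left (nhdsWithin_mono s hsub)
      have l2 := (hu.L1cont hs').mono_left (nhdsWithin_mono s hsub)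
      have l3 : Tendsto (fun s' => |E s' - E s|) (𝓝[Icc 0 t] s) (𝓝 0) := by
        have : Tendsto (fun s' => |E s' - E s|) (𝓝 s) (𝓝 |E s - E s|) := (by fun_prop : Continuous fun s' => |E s' - E s|).tendsto s
        rw [sub_self, abs_zero] at this
        exact this.mono_left nhdsWithin_le_nhds
      have l4 := (((l1.add l2).const_mul B).add (l2.const_mul (E T))).add l3
      simp only [add_zero, mul_zero] at l4
      refine tendsto_of_tendsto_of_tendsto_of_le_of_le' tendsto_const_nhds l4 (Eventually.of_forall fun s' => integral_nonneg fun x => abs_nonneg _) ?_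
      filter_upwards [self_mem_nhdsWithin] with s' hs1
      have hs1' := hsub hs1
      have iw : Integrable (fun x => |w s' x - w s x|) := ((hw.nice s' hs1').sub (hw.nice s hs')).integrable.abs
      have iu : Integrable (fun x => |u s' x - u s x|) := ((hu.nice s' hs1').sub (hu.nice s hs')).integrable.abs
      have i1 : Integrable (fun x => B * (|w s' x - w s x| + |u s' x - u s x|)) := (iw.add iu).const_mul B
      have i2 : Integrable (fun x => E T * |u s' x - u s x|) := iu.const_mul _
      have i3 : Integrable (fun x => |E s' - E s| * u s x) := (hu.nice s hs').integrable.const_mul _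
      calc _ ≤ ∫ x, (B * (|w s' x - w s x| + |u s' x - u s x|) + E T * |u s' x - u s x| + |E s' - E s| * u s x) := by
            refine integral_mono ((hqi s' hs1').sub (hqi s hs')).abs ((i1.add i2).add i3) fun x => ?_
            have us := hu.nonneg s hs' x
            have e : q s' x - q s x = B * (|w s' x - u s' x| - |w s x - u s x|) + E s' * (u s' x - u s x) + (E s' - E s) * u s x := by
              simp only [hq]; ring
            show |q s' x - q s x| ≤ _
            rw [e]
            refine (abs_add_three _ _ _).trans ?_
            rw [abs_mul B, abs_mul (E s'), abs_mul (E s' - E s), abs_of_pos hBp, abs_of_nonneg (hE0 s'), abs_of_nonneg us]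
            have f1 : |(|w s' x - u s' x| - |w s x - u s x|)| ≤ |w s' x - w s x| + |u s' x - u s x| := by
              refine (abs_abs_sub_abs_le _ _).trans ?_
              rw [show w s' x - u s' x - (w s x - u s x) = (w s' x - w s x) - (u s' x - u s x) by ring]
              exact abs_sub _ _
            have f2 := hEm s' hs1'
            gcongr
        _ = _ := by
            rw [integral_add (by exact i1.add i2) i3, integral_add i1 i2, integral_const_mul, integral_const_mul, integral_const_mul, integral_add iw iu, hu.mass s hs', mul_one]
    · intro s hs
      have hA := hr.trans_le (hApos r hr s (Ioo_subset_Icc_self hs))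
      refine le_trans ?_ (g3 s hs)
      exact mul_le_mul_of_nonneg_left (hqm s (hin s hs)) (by positivity)
  refine ⟨le_trans ?_ hfin, fun x => le_trans ?_ hfin⟩
  · have hnn : 0 ≤ C * η + S / 2 * Real.exp (μ * t) := by positivity
    rw [integral_eq_lintegral_of_nonneg_ae (ae_of_all _ fun x => abs_nonneg _) (hzi t ht).aestronglyMeasurable]
    refine ENNReal.toReal_le_of_le_ofReal hnn ?_
    have hlim : ∀ x, liminf (fun n : ℕ => ENNReal.ofReal |gc d ((1 / ((n:ℝ) + 1)) ^ 2) (fun y => w t y - u t y) x|) atTop = ENNReal.ofReal |w t x - u t x| := by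
      intro x
      refine Tendsto.liminf_eq ?_
      exact (ENNReal.continuous_ofReal.tendsto _).comp (gc_tendsto (hzn t ht).continuous hL x).abs
    calc ∫⁻ x, ENNReal.ofReal |w t x - u t x| = ∫⁻ x, liminf (fun n : ℕ => ENNReal.ofReal |gc d ((1 / ((n:ℝ) + 1)) ^ 2) (fun y => w t y - u t y) x|) atTop := by
          simp_rw [hlim]
      _ ≤ liminf (fun n : ℕ => ∫⁻ x, ENNReal.ofReal |gc d ((1 / ((n:ℝ) + 1)) ^ 2) (fun y => w t y - u t y) x|) atTop := by
          refine lintegral_liminf_le' fun n => ?_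
          have hc2 := gc_cont (hrn n).1 (hzn t ht).integrable
          exact (ENNReal.continuous_ofReal.comp hc2.abs).aemeasurable
      _ ≤ ENNReal.ofReal (C * η + S / 2 * Real.exp (μ * t)) := by
          refine liminf_le_of_frequently_le' (Frequently.of_forall fun n => hL1 _ (hrn n).1 (hrn n).2)
  · exact le_of_tendsto' (gc_tendsto (hzn t ht).continuous hL x).abs fun n => hsup _ (hrn n).1 (hrn n).2 x

lemma iterate_KS {d : ℕ} {μ T C η S0 : ℝ} {w u : ℝ → EE d → ℝ} (hC : 0 ≤ C * η) (hS0 : 0 ≤ S0) (h0 : KS μ T w u S0)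
    (hs : ∀ S, 0 ≤ S → KS μ T w u S → KS μ T w u (C * η + S / 2)) : KS μ T w u (2 * (C * η)) := by
  have h : ∀ n : ℕ, KS μ T w u (2 * (C * η) + S0 * (1/2) ^ n) := by
    intro n
    induction n with
    | zero =>
      intro s hs'
      obtain ⟨a, b⟩ := h0 s hs'
      have : S0 * Real.exp (μ * s) ≤ (2 * (C * η) + S0 * (1/2) ^ 0) * Real.exp (μ * s) := by
        refine mul_le_mul_of_nonneg_right ?_ (Real.exp_pos _).le
        simp; linarith
      exact ⟨a.trans this, fun x => (b x).trans this⟩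
    | succ n ih =>
      have := hs _ (by positivity) ih
      rwa [show C * η + (2 * (C * η) + S0 * (1/2) ^ n) / 2 = 2 * (C * η) + S0 * (1/2) ^ (n+1) by rw [pow_succ]; ring] at this
  have hl : ∀ s, Tendsto (fun n : ℕ => (2 * (C * η) + S0 * (1/2) ^ n) * Real.exp (μ * s)) atTop (𝓝 (2 * (C * η) * Real.exp (μ * s))) := by
    intro s
    have := tendsto_pow_atTop_nhds_zero_of_lt_one (r := (1:ℝ)/2) (by norm_num) (by norm_num)
    have := ((this.const_mul S0).const_add (2 * (C * η))).mul_const (Real.exp (μ * s))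
    simpa using this
  intro s hs'
  exact ⟨ge_of_tendsto' (hl s) fun n => (h n s hs').1, fun x => ge_of_tendsto' (hl s) fun n => (h n s hs').2 x⟩

lemma le_of_top {d : ℕ} {f : EE d → ℝ} {M : ℝ} (hf : Nice f) (h : (eLpNorm f ⊤ volume).toReal ≤ M) (x : EE d) : f x ≤ M := by
  obtain ⟨L, hL0, hL⟩ := hf.bdd
  have hfin : eLpNorm f ⊤ volume ≠ ⊤ := by
    rw [eLpNorm_exponent_top]
    exact ((eLpNormEssSup_le_of_ae_bound (C := L) (ae_of_all _ hL)).trans_lt ENNReal.ofReal_lt_top).ne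
  have hae : ∀ᵐ x, ‖f x‖ ≤ M := by
    have := enorm_ae_le_eLpNormEssSup f (volume : Measure (EE d))
    filter_upwards [this] with y hy
    rw [← eLpNorm_exponent_top] at hy
    have := ENNReal.toReal_mono hfin hy
    rw [toReal_enorm] at this
    exact this.trans h
  have hcl : IsClosed {x | ‖f x‖ ≤ M} := isClosed_le hf.continuous.norm continuous_const
  have : x ∈ {x | ‖f x‖ ≤ M} := by
    have hd : Dense {x | ‖f x‖ ≤ M} := Measure.dense_of_ae hae
    rw [← hcl.closure_eq]; exact hd x
  exact (le_abs_self _).trans this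

/-- Quantitative convergence of the intermediate equation to the limit equation:
for `d ≥ 3`, `0 < λ < d-2`, `σ > 0` there is `C* > 0` depending only on `d, λ, σ`, and
for every `T > 0`, `M > 0` and mollifier `χ` a constant `C > 0` depending only on
`d, λ, σ, T, M, χ`, such that for every probability density `u₀` with
`‖u₀‖_{L^{p*}} < C*` and `‖u₀‖_{L¹} + ‖u₀‖_{L^∞} ≤ M`, every `κ ∈ {1,-1}`,
`η ∈ (0,1]`, every classical Schwartz-class solution `w` of
`∂_t w = σΔw − κ div(w ∇V^η * w)` with `w(0) = u₀` and every classical Schwartz-class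
solution `u` of `∂_t u = σΔu − κ div(u ∇Φ * u)` with `u(0) = u₀`, one has
`sup_{0≤t≤T} (‖w(t)−u(t)‖_{L¹} + ‖w(t)−u(t)‖_{L^∞}) ≤ C η`. -/
theorem intermediate_to_limit_convergence
    (d : ℕ) (hd : 3 ≤ d) (lam : ℝ) (hlam0 : 0 < lam) (hlamd : lam < (d : ℝ) - 2)
    (σ : ℝ) (hσ : 0 < σ) :
    ∃ Cstar : ℝ, 0 < Cstar ∧
      ∀ (T : ℝ), 0 < T →
      ∀ (M : ℝ), 0 < M →
      ∀ (χ : EuclideanSpace ℝ (Fin d) → ℝ),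
        ContDiff ℝ (⊤ : ℕ∞) χ → HasCompactSupport χ → (∀ x, 0 ≤ χ x) → (∫ x, χ x) = 1 →
      ∃ C : ℝ, 0 < C ∧
        ∀ (κ : ℝ), (κ = 1 ∨ κ = -1) →
        ∀ (η : ℝ), 0 < η → η ≤ 1 →
        ∀ (u0 : EuclideanSpace ℝ (Fin d) → ℝ),
          (∀ x, 0 ≤ u0 x) → (∫ x, u0 x) = 1 →
          eLpNorm u0 (ENNReal.ofReal ((d : ℝ) / ((d : ℝ) - lam))) volume
            < ENNReal.ofReal Cstar →
          (eLpNorm u0 1 volume).toReal + (eLpNorm u0 ⊤ volume).toReal ≤ M →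
        ∀ (w u : ℝ → EuclideanSpace ℝ (Fin d) → ℝ),
          IsAggregationSolution σ κ T (gradient (Veta lam χ η)) w →
          (∀ x, w 0 x = u0 x) →
          IsAggregationSolution σ κ T
            (gradient (fun x : EuclideanSpace ℝ (Fin d) => ‖x‖ ^ (-lam))) u →
          (∀ x, u 0 x = u0 x) →
        ∀ t ∈ Icc (0:ℝ) T,
          (eLpNorm (fun x => w t x - u t x) 1 volume).toReal +
              (eLpNorm (fun x => w t x - u t x) ⊤ volume).toReal ≤ C * η := by
  have hld : lam + 2 < d := by linarith
  obtain ⟨Cs, hCs, hU⟩ := uniform (d := d) hlam0 hld σ hσ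
  refine ⟨Cs, hCs, ?_⟩
  intro T hT M hM χ hχ hcs hχ0 hχ1
  obtain ⟨Λ, hΛ, hU⟩ := hU M hM
  obtain ⟨R, hR, hRs⟩ := nue_supp hcs hχ.continuous
  obtain ⟨C6, μ, hC6, hμ, hst⟩ := step (d := d) hlam0 hld hσ hT.le hΛ hR
  refine ⟨4 * C6 * Real.exp (μ * T), by positivity, ?_⟩
  intro κ hκ η hη hη1 u0 hu00 hu01 hup hum w u hw hw0 hu hu0 t ht
  have hκ' : |κ| = 1 := by rcases hκ with h | h <;> simp [h]
  haveI := nue_prob hχ.continuous hcs hχ0 hη hχ1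
  have sw : Sol (nue χ η) lam σ κ T w := sol_of hw fun f hf z => kernel_eta hlam0 hld hχ.continuous hcs hχ0 hη f hf z
  have su : Sol (Measure.dirac 0) lam σ κ T u := sol_of hu fun f hf z => kernel_limit (by omega) f z
  have ew : w 0 = u0 := funext hw0
  have eu : u 0 = u0 := funext hu0
  have h0T : (0:ℝ) ∈ Icc 0 T := ⟨le_rfl, hT.le⟩
  have hN0 : Nice u0 := eu ▸ su.nice 0 h0T
  have hM0 : ∀ x, u0 x ≤ M := le_of_top hN0 (by linarith [(ENNReal.toReal_nonneg : 0 ≤ (eLpNorm u0 1 volume).toReal)])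
  have bw := hU (nue χ η) κ T w hκ' hT.le sw (by rw [ew]; exact hup.le) (by rw [ew]; exact hM0)
  have bu := hU (Measure.dirac 0) κ T u hκ' hT.le su (by rw [eu]; exact hup.le) (by rw [eu]; exact hM0)
  have hstep := hst (nue χ η) κ η w u hκ' hη (hRs η hη) sw su (fun x => by rw [hw0, hu0]) bw bu
  have hbase : KS μ T w u (Λ + 2) := by
    intro s hs
    have he : 1 ≤ Real.exp (μ * s) := Real.one_le_exp (mul_nonneg hμ.le hs.1)
    have hle : Λ + 2 ≤ (Λ + 2) * Real.exp (μ * s) := le_mul_of_one_le_right (by positivity) he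
    have i1 := (sw.nice s hs).integrable
    have i2 := (su.nice s hs).integrable
    refine ⟨?_, fun x => ?_⟩
    · have : ∫ y, |w s y - u s y| ≤ 2 := by
        calc _ ≤ ∫ y, (w s y + u s y) := integral_mono (i1.sub i2).abs (i1.add i2) fun y => by
                have a := sw.nonneg s hs y
                have b := su.nonneg s hs y
                show |w s y - u s y| ≤ w s y + u s y; exact abs_le.2 ⟨by linarith, by linarith⟩
          _ = 2 := by rw [integral_add i1 i2, sw.mass s hs, su.mass s hs]; norm_num
      linarith
    · have a := sw.nonneg s hs x
      have b := su.nonneg s hs x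
      have a' := bw s hs x
      have b' := bu s hs x
      exact abs_le.2 ⟨by linarith, by linarith⟩
  obtain ⟨k1, k2⟩ := iterate_KS (by positivity) (by positivity) hbase hstep t ht
  have he : Real.exp (μ * t) ≤ Real.exp (μ * T) := Real.exp_le_exp.2 (mul_le_mul_of_nonneg_left ht.2 hμ.le)
  have hfin : 2 * (C6 * η) * Real.exp (μ * t) ≤ 2 * (C6 * η) * Real.exp (μ * T) := by gcongr
  have hzi := ((sw.nice t ht).sub (su.nice t ht)).integrable
  have n1 : (eLpNorm (fun x => w t x - u t x) 1 volume).toReal ≤ 2 * (C6 * η) * Real.exp (μ * t) := by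
    refine le_trans (le_of_eq ?_) k1
    rw [eLpNorm_one_eq_lintegral_enorm, ← integral_norm_eq_lintegral_enorm hzi.aestronglyMeasurable]
    rfl
  have n2 : (eLpNorm (fun x => w t x - u t x) ⊤ volume).toReal ≤ 2 * (C6 * η) * Real.exp (μ * t) := by
    rw [eLpNorm_exponent_top]
    refine ENNReal.toReal_le_of_le_ofReal (by positivity) ?_
    exact eLpNormEssSup_le_of_ae_bound (ae_of_all _ k2)
  linarith
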